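/- For any p ≥ 0, the functional 𝓔_p[φ] = ∫_{ℝ²}(|∇φ|² + V⊥|φ|² + p|φ|⁴) has, under the normalization condition ∫_{ℝ²}|φ|² = 1, a unique minimizer up to a constant phase factor, which can be chosen strictly positive; denote it φ_p. Moreover, for every P > 0 both φ_p and ∇φ_p are bounded uniformly for p ∈ [0,P], i.e., sup{ |φ_p(x⊥)| + |∇φ_p(x⊥)| : x⊥ ∈ ℝ², p ∈ [0,P] } < ∞. -/

import Mathlib

open MeasureTheory Real Filter Set
open scoped ENNReal

noncomputable section

abbrev R2 := EuclideanSpace ℝ (Fin 2)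

/-- Hypotheses on the transverse trap potential `V⊥`. -/
structure IsTrapPotential (Vp : R2 → ℝ) : Prop where
  meas : Measurable Vp
  nonneg : ∀ x, 0 ≤ Vp x
  locBdd : ∀ R : ℝ, ∃ C : ℝ, ∀ x : R2, ‖x‖ ≤ R → Vp x ≤ C
  polyBdd : ∃ C m : ℝ, ∀ x : R2, Vp x ≤ C * (1 + ‖x‖) ^ m
  tendsto_top : Filter.Tendsto Vp (Filter.cocompact R2) Filter.atTop

/-- Normalized C¹ transverse wave functions. -/
def adm2 (φ : R2 → ℝ) : Prop :=
  ContDiff ℝ 1 φ ∧ (∫⁻ x : R2, ENNReal.ofReal ((φ x)^2)) = 1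

/-- The auxiliary 2D Gross–Pitaevskii functional `∫ (|∇φ|² + V⊥|φ|² + p|φ|⁴)`. -/
noncomputable def Eaux (Vp : R2 → ℝ) (p : ℝ) (φ : R2 → ℝ) : ℝ≥0∞ :=
  ∫⁻ x : R2, ENNReal.ofReal (‖fderiv ℝ φ x‖ ^ 2 + Vp x * (φ x) ^ 2 + p * (φ x) ^ 4)

/-- The auxiliary 2D Gross–Pitaevskii ground state energy `E^{aux}(p)`. -/
noncomputable def EauxInf (Vp : R2 → ℝ) (p : ℝ) : ℝ≥0∞ :=
  sInf {E | ∃ φ, adm2 φ ∧ Eaux Vp p φ = E}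

open scoped Topology NNReal

/-! ### The radial profile and the mollifying kernels -/

/-- The derivative of `expNegInvGlue`. -/
def glueD (t : ℝ) : ℝ := t⁻¹ ^ 2 * expNegInvGlue t

/-- The second derivative of `expNegInvGlue`. -/
def glueDD (t : ℝ) : ℝ := (t⁻¹ ^ 4 - 2 * t⁻¹ ^ 3) * expNegInvGlue t

lemma hasDerivAt_expNegInvGlue (t : ℝ) : HasDerivAt expNegInvGlue (glueD t) t := by
  have h := expNegInvGlue.hasDerivAt_polynomial_eval_inv_mul 1 t
  simpa [glueD] using h

lemma hasDerivAt_glueD (t : ℝ) : HasDerivAt glueD (glueDD t) t := by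
  have h := expNegInvGlue.hasDerivAt_polynomial_eval_inv_mul (Polynomial.X ^ 2) t
  have e : (fun x : ℝ => (Polynomial.X ^ 2 : Polynomial ℝ).eval x⁻¹ * expNegInvGlue x) = glueD := by
    funext x; simp [glueD]
  rw [e] at h
  convert h using 1
  simp [glueDD]
  left
  ring

lemma contDiff_glueD : ContDiff ℝ 2 glueD := by
  have h := expNegInvGlue.contDiff_polynomial_eval_inv_mul (n := 2) (Polynomial.X ^ 2)
  have e : (fun x : ℝ => (Polynomial.X ^ 2 : Polynomial ℝ).eval x⁻¹ * expNegInvGlue x) = glueD := by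
    funext x; simp [glueD]
  rw [e] at h
  exact h

lemma contDiff_glueDD : ContDiff ℝ 2 glueDD := by
  have h := expNegInvGlue.contDiff_polynomial_eval_inv_mul (n := 2)
    (Polynomial.X ^ 4 - 2 * Polynomial.X ^ 3)
  have e : (fun x : ℝ => (Polynomial.X ^ 4 - 2 * Polynomial.X ^ 3 : Polynomial ℝ).eval x⁻¹ *
      expNegInvGlue x) = glueDD := by
    funext x; simp [glueDD]
  rw [e] at h
  exact h

lemma glueD_of_nonpos {t : ℝ} (h : t ≤ 0) : glueD t = 0 := by
  simp [glueD, expNegInvGlue.zero_of_nonpos h]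

lemma glueDD_of_nonpos {t : ℝ} (h : t ≤ 0) : glueDD t = 0 := by
  simp [glueDD, expNegInvGlue.zero_of_nonpos h]

lemma glueD_nonneg (t : ℝ) : 0 ≤ glueD t :=
  mul_nonneg (by positivity) (expNegInvGlue.nonneg t)

lemma glueD_pos {t : ℝ} (h : 0 < t) : 0 < glueD t :=
  mul_pos (by positivity) (expNegInvGlue.pos_of_pos h)

lemma expNegInvGlue_le_glueD {t : ℝ} (h : t ≤ 1) : expNegInvGlue t ≤ glueD t := by
  rcases le_or_gt t 0 with h0 | h0
  · simp [glueD, expNegInvGlue.zero_of_nonpos h0]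
  · have : 1 ≤ t⁻¹ ^ 2 := one_le_pow₀ ((one_le_inv₀ h0).2 h)
    unfold glueD
    nlinarith [expNegInvGlue.nonneg t]

lemma exists_bound_of_continuous_of_nonpos {f : ℝ → ℝ} (hf : Continuous f)
    (h0 : ∀ t ≤ 0, f t = 0) : ∃ C, 0 < C ∧ ∀ t ≤ 1, |f t| ≤ C := by
  obtain ⟨C, hC⟩ := (isCompact_Icc (a := (0 : ℝ)) (b := 1)).exists_bound_of_continuousOn
    hf.continuousOn
  refine ⟨max C 1, by positivity, fun t ht => ?_⟩
  rcases le_or_gt t 0 with h | h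
  · simp [h0 t h]
  · exact (hC t ⟨h.le, ht⟩).trans (le_max_left _ _)

/-- The argument of the profile in the kernels at scale `s`. -/
def qarg (s : ℝ) (z : R2) : ℝ := 1 - ‖z‖ ^ 2 / s ^ 2

lemma qarg_le_one (s : ℝ) (z : R2) : qarg s z ≤ 1 := by
  unfold qarg
  have : 0 ≤ ‖z‖ ^ 2 / s ^ 2 := by positivity
  linarith

lemma qarg_nonpos {s : ℝ} (hs : 0 < s) {z : R2} (hz : s ≤ ‖z‖) : qarg s z ≤ 0 := by
  unfold qarg
  rw [sub_nonpos, one_le_div (by positivity)]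
  exact pow_le_pow_left₀ hs.le hz 2

lemma qarg_pos {s : ℝ} (hs : 0 < s) {z : R2} (hz : ‖z‖ < s) : 0 < qarg s z := by
  unfold qarg
  rw [sub_pos, div_lt_one (by positivity)]
  exact pow_lt_pow_left₀ hz (norm_nonneg _) two_ne_zero

lemma contDiff_qarg (s : ℝ) {n : WithTop ℕ∞} : ContDiff ℝ n (qarg s) := by
  unfold qarg
  exact contDiff_const.sub ((contDiff_norm_sq ℝ).div_const _)

/-- Total mass of the unnormalized unit-scale mollifier. -/
def kmass : ℝ := ∫ z : R2, 2 * glueD (qarg 1 z)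

/-- The mollifier at scale `s`. -/
def rho (s : ℝ) (z : R2) : ℝ := 2 / kmass / s ^ 2 * glueD (qarg s z)

/-- A potential of the mollifier: `∇ (pot s) z = - (rho s z / s ^ 2) z`. -/
def pot (s : ℝ) (z : R2) : ℝ := 1 / kmass / s ^ 2 * expNegInvGlue (qarg s z)

/-- The Laplacian of `pot s`; also `s⁻¹` times the derivative of `rho` with respect to `s`. -/
def lapPot (s : ℝ) (z : R2) : ℝ :=
  4 / kmass / s ^ 6 * glueDD (qarg s z) * ‖z‖ ^ 2 - 4 / kmass / s ^ 4 * glueD (qarg s z)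

lemma hasCompactSupport_of_zero {f : R2 → ℝ} {s : ℝ} (h : ∀ z, s ≤ ‖z‖ → f z = 0) :
    HasCompactSupport f := by
  refine HasCompactSupport.intro (isCompact_closedBall (0 : R2) s) fun x hx => h x ?_
  simp only [Metric.mem_closedBall, dist_zero_right, not_le] at hx
  exact hx.le

lemma kmass_pos : 0 < kmass := by
  have hc : Continuous fun z : R2 => 2 * glueD (qarg 1 z) :=
    continuous_const.mul (contDiff_glueD.continuous.comp (contDiff_qarg 1 (n := 0)).continuous)
  have hs : HasCompactSupport fun z : R2 => 2 * glueD (qarg 1 z) :=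
    hasCompactSupport_of_zero (s := 1) fun z hz => by
      rw [glueD_of_nonpos (qarg_nonpos one_pos hz), mul_zero]
  refine hc.integral_pos_of_hasCompactSupport_nonneg_nonzero hs
    (fun z => mul_nonneg zero_le_two (glueD_nonneg _)) (x := 0) ?_
  have := glueD_pos (qarg_pos one_pos (z := 0) (by simp))
  positivity

lemma rho_nonneg {s : ℝ} (z : R2) : 0 ≤ rho s z :=
  mul_nonneg (by have := kmass_pos; positivity) (glueD_nonneg _)

lemma pot_nonneg {s : ℝ} (z : R2) : 0 ≤ pot s z :=
  mul_nonneg (by have := kmass_pos; positivity) (expNegInvGlue.nonneg _)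

lemma rho_pos {s : ℝ} (hs : 0 < s) {z : R2} (hz : ‖z‖ < s) : 0 < rho s z :=
  mul_pos (by have := kmass_pos; positivity) (glueD_pos (qarg_pos hs hz))

lemma rho_eq_zero {s : ℝ} (hs : 0 < s) {z : R2} (hz : s ≤ ‖z‖) : rho s z = 0 := by
  simp [rho, glueD_of_nonpos (qarg_nonpos hs hz)]

lemma pot_eq_zero {s : ℝ} (hs : 0 < s) {z : R2} (hz : s ≤ ‖z‖) : pot s z = 0 := by
  simp [pot, expNegInvGlue.zero_of_nonpos (qarg_nonpos hs hz)]

lemma lapPot_eq_zero {s : ℝ} (hs : 0 < s) {z : R2} (hz : s ≤ ‖z‖) : lapPot s z = 0 := by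
  simp [lapPot, glueD_of_nonpos (qarg_nonpos hs hz), glueDD_of_nonpos (qarg_nonpos hs hz)]

lemma contDiff_rho (s : ℝ) : ContDiff ℝ 2 (rho s) :=
  contDiff_const.mul (contDiff_glueD.comp (contDiff_qarg s))

lemma contDiff_pot (s : ℝ) : ContDiff ℝ 2 (pot s) :=
  contDiff_const.mul
    ((expNegInvGlue.contDiff (n := 2)).comp (contDiff_qarg s))

lemma contDiff_lapPot (s : ℝ) : ContDiff ℝ 2 (lapPot s) :=
  ((contDiff_const.mul (contDiff_glueDD.comp (contDiff_qarg s))).mul (contDiff_norm_sq ℝ)).sub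
    (contDiff_const.mul (contDiff_glueD.comp (contDiff_qarg s)))

lemma hasCompactSupport_rho {s : ℝ} (hs : 0 < s) : HasCompactSupport (rho s) :=
  hasCompactSupport_of_zero fun _ hz => rho_eq_zero hs hz

lemma hasCompactSupport_pot {s : ℝ} (hs : 0 < s) : HasCompactSupport (pot s) :=
  hasCompactSupport_of_zero fun _ hz => pot_eq_zero hs hz

lemma hasCompactSupport_lapPot {s : ℝ} (hs : 0 < s) : HasCompactSupport (lapPot s) :=
  hasCompactSupport_of_zero fun _ hz => lapPot_eq_zero hs hz

lemma qarg_scale {s : ℝ} (hs : 0 < s) (z : R2) : qarg s z = qarg 1 (s⁻¹ • z) := by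
  simp only [qarg, norm_smul, norm_inv, Real.norm_eq_abs, abs_of_pos hs]
  field_simp

lemma rho_scale {s : ℝ} (hs : 0 < s) (z : R2) : rho s z = (s ^ 2)⁻¹ * rho 1 (s⁻¹ • z) := by
  simp only [rho, qarg_scale hs z]
  field_simp

lemma pot_scale {s : ℝ} (hs : 0 < s) (z : R2) : pot s z = (s ^ 2)⁻¹ * pot 1 (s⁻¹ • z) := by
  simp only [pot, qarg_scale hs z]
  field_simp

lemma integral_rho {s : ℝ} (hs : 0 < s) : ∫ z, rho s z = 1 := by
  simp_rw [rho_scale hs]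
  rw [integral_const_mul, Measure.integral_comp_inv_smul_of_nonneg _ _ hs.le]
  have h1 : ∫ z, rho 1 z = 1 := by
    have : ∀ z, rho 1 z = kmass⁻¹ * (2 * glueD (qarg 1 z)) := fun z => by
      simp only [rho]; ring
    simp_rw [this]
    rw [integral_const_mul]
    exact inv_mul_cancel₀ kmass_pos.ne'
  rw [h1]
  simp only [finrank_euclideanSpace, Fintype.card_fin, smul_eq_mul, mul_one]
  field_simp

lemma hasDerivAt_rho {s : ℝ} (hs : 0 < s) (z : R2) :
    HasDerivAt (fun s => rho s z) (s * lapPot s z) s := by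
  have hk := kmass_pos.ne'
  have h2 : HasDerivAt (fun s : ℝ => s ^ 2) (2 * s) s := by simpa using hasDerivAt_pow 2 s
  have hq : HasDerivAt (fun s => qarg s z) (2 * ‖z‖ ^ 2 / s ^ 3) s := by
    have := ((hasDerivAt_const s (‖z‖ ^ 2)).div h2 (by positivity)).const_sub 1
    refine HasDerivAt.congr_deriv this ?_
    field_simp
    ring
  have hg := (hasDerivAt_glueD (qarg s z)).comp s hq
  have hc := (hasDerivAt_const s (2 / kmass)).div h2 (by positivity)
  refine HasDerivAt.congr_deriv (hc.mul hg) ?_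
  simp only [lapPot, Pi.div_apply]
  field_simp
  ring

lemma pot_le_rho {s : ℝ} (z : R2) : pot s z ≤ rho s z := by
  have hk := kmass_pos
  unfold pot rho
  have h1 := expNegInvGlue_le_glueD (qarg_le_one s z)
  have h2 := glueD_nonneg (qarg s z)
  have h3 := expNegInvGlue.nonneg (qarg s z)
  refine mul_le_mul ?_ h1 h3 (by positivity)
  gcongr
  norm_num

/-- Scale-invariant size and Lipschitz bounds for the kernels. -/
lemma exists_kernel_bound : ∃ C : ℝ, 0 < C ∧ ∀ s : ℝ, 0 < s → ∀ z z' : R2,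
    |rho s z| ≤ C / s ^ 2 ∧ |pot s z| ≤ C / s ^ 2 ∧ |lapPot s z| ≤ C / s ^ 4 ∧
    |rho s z - rho s z'| ≤ C / s ^ 3 * ‖z - z'‖ ∧ |pot s z - pot s z'| ≤ C / s ^ 3 * ‖z - z'‖ := by
  have hk := kmass_pos
  obtain ⟨C0, hC0, h0⟩ := exists_bound_of_continuous_of_nonpos
    (expNegInvGlue.contDiff (n := 0)).continuous (fun t => expNegInvGlue.zero_of_nonpos)
  obtain ⟨C1, hC1, h1⟩ := exists_bound_of_continuous_of_nonpos contDiff_glueD.continuous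
    (fun t => glueD_of_nonpos)
  obtain ⟨C2, hC2, h2⟩ := exists_bound_of_continuous_of_nonpos contDiff_glueDD.continuous
    (fun t => glueDD_of_nonpos)
  obtain ⟨L1, hL1⟩ := (contDiff_rho 1).lipschitzWith_of_hasCompactSupport
    (hasCompactSupport_rho one_pos) (by norm_num)
  obtain ⟨L2, hL2⟩ := (contDiff_pot 1).lipschitzWith_of_hasCompactSupport
    (hasCompactSupport_pot one_pos) (by norm_num)
  have hlip : ∀ (f : ℝ → R2 → ℝ) (L : ℝ≥0), LipschitzWith L (f 1) →
      (∀ s, 0 < s → ∀ z, f s z = (s ^ 2)⁻¹ * f 1 (s⁻¹ • z)) → ∀ s, 0 < s → ∀ z z',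
      |f s z - f s z'| ≤ L / s ^ 3 * ‖z - z'‖ := by
    intro f L hL hf s hs z z'
    rw [hf s hs, hf s hs, ← mul_sub, abs_mul, abs_of_pos (by positivity)]
    have := hL.dist_le_mul (s⁻¹ • z) (s⁻¹ • z')
    rw [Real.dist_eq, dist_eq_norm, ← smul_sub, norm_smul, norm_inv, Real.norm_eq_abs,
      abs_of_pos hs] at this
    calc _ ≤ (s ^ 2)⁻¹ * (L * (s⁻¹ * ‖z - z'‖)) := by gcongr
      _ = _ := by field_simp
  set C := 1 / kmass * C0 + 2 / kmass * C1 + 4 / kmass * (C1 + C2) + L1 + L2 with hC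
  have hCa : 1 / kmass * C0 ≤ C := by
    rw [hC]; have := L1.2; have := L2.2
    have : 0 ≤ 2 / kmass * C1 := by positivity
    have : 0 ≤ 4 / kmass * (C1 + C2) := by positivity
    linarith
  have hCb : 2 / kmass * C1 ≤ C := by
    rw [hC]; have := L1.2; have := L2.2
    have : 0 ≤ 1 / kmass * C0 := by positivity
    have : 0 ≤ 4 / kmass * (C1 + C2) := by positivity
    linarith
  have hCc : 4 / kmass * (C1 + C2) ≤ C := by
    rw [hC]; have := L1.2; have := L2.2
    have : 0 ≤ 1 / kmass * C0 := by positivity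
    have : 0 ≤ 2 / kmass * C1 := by positivity
    linarith
  have hp : 0 ≤ 1 / kmass * C0 + 2 / kmass * C1 + 4 / kmass * (C1 + C2) := by positivity
  have hCd : L1 ≤ C := by rw [hC]; have := L2.2; linarith
  have hCe : L2 ≤ C := by rw [hC]; have := L1.2; linarith
  refine ⟨C, lt_of_lt_of_le (by positivity) hCa, fun s hs z z' => ⟨?_, ?_, ?_, ?_, ?_⟩⟩
  · rw [rho, abs_mul, abs_of_pos (by positivity)]
    calc _ ≤ 2 / kmass / s ^ 2 * C1 := by gcongr; exact h1 _ (qarg_le_one _ _)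
      _ = 2 / kmass * C1 / s ^ 2 := by ring
      _ ≤ _ := by gcongr
  · rw [pot, abs_mul, abs_of_pos (by positivity)]
    calc _ ≤ 1 / kmass / s ^ 2 * C0 := by gcongr; exact h0 _ (qarg_le_one _ _)
      _ = 1 / kmass * C0 / s ^ 2 := by ring
      _ ≤ _ := by gcongr
  · rcases le_or_gt s ‖z‖ with hz | hz
    · rw [lapPot_eq_zero hs hz, abs_zero]
      have := lt_of_lt_of_le (by positivity) hCa
      positivity
    · rw [lapPot]
      calc _ ≤ |4 / kmass / s ^ 6 * glueDD (qarg s z) * ‖z‖ ^ 2| +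
            |4 / kmass / s ^ 4 * glueD (qarg s z)| := abs_sub _ _
        _ ≤ 4 / kmass / s ^ 6 * C2 * s ^ 2 + 4 / kmass / s ^ 4 * C1 := by
          rw [abs_mul, abs_mul, abs_mul, abs_of_pos (a := 4 / kmass / s ^ 6) (by positivity),
            abs_of_pos (a := 4 / kmass / s ^ 4) (by positivity),
            abs_of_nonneg (a := ‖z‖ ^ 2) (by positivity)]
          gcongr
          · exact h2 _ (qarg_le_one _ _)
          · exact h1 _ (qarg_le_one _ _)
        _ = 4 / kmass * (C1 + C2) / s ^ 4 := by field_simp; ring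
        _ ≤ _ := by gcongr
  · exact (hlip rho L1 hL1 (fun s hs z => rho_scale hs z) s hs z z').trans (by gcongr)
  · exact (hlip pot L2 hL2 (fun s hs z => pot_scale hs z) s hs z z').trans (by gcongr)

lemma exists_rho_half_le_pot : ∃ c : ℝ, 0 < c ∧ ∀ s : ℝ, 0 < s → ∀ z : R2,
    c * rho (s / 2) z ≤ pot s z := by
  obtain ⟨C, hC, h⟩ := exists_kernel_bound
  have hk := kmass_pos
  have he : 0 < expNegInvGlue (3 / 4) := expNegInvGlue.pos_of_pos (by norm_num)
  refine ⟨expNegInvGlue (3 / 4) / (4 * C * kmass), by positivity, fun s hs z => ?_⟩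
  rcases le_or_gt (s / 2) ‖z‖ with hz | hz
  · rw [rho_eq_zero (by positivity) hz, mul_zero]; exact pot_nonneg z
  · have h1 : 3 / 4 ≤ qarg s z := by
      have : ‖z‖ ^ 2 / s ^ 2 ≤ 1 / 4 := by
        rw [div_le_iff₀ (by positivity)]; nlinarith [norm_nonneg z]
      unfold qarg; linarith
    have h2 := expNegInvGlue.monotone h1
    have h3 := (le_abs_self _).trans (h (s / 2) (by positivity) z z).1
    calc _ ≤ expNegInvGlue (3 / 4) / (4 * C * kmass) * (C / (s / 2) ^ 2) := by gcongr
      _ = 1 / kmass / s ^ 2 * expNegInvGlue (3 / 4) := by field_simp; norm_num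
      _ ≤ _ := by unfold pot; gcongr

/-! ### Mollification -/

/-- Mollification of `u` at scale `s`. -/
def mol (s : ℝ) (u : R2 → ℝ) (x : R2) : ℝ := ∫ y, u y * rho s (x - y)

lemma hasCompactSupport_comp_sub {k : R2 → ℝ} (hk : HasCompactSupport k) (x : R2) :
    HasCompactSupport fun y => k (x - y) :=
  hk.comp_homeomorph (Homeomorph.subLeft x)

lemma integrable_mul_ker {u k : R2 → ℝ} (hu : LocallyIntegrable u) (hk : Continuous k)
    (hs : HasCompactSupport k) (x : R2) : Integrable fun y => u y * k (x - y) :=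
  hu.integrable_smul_right_of_hasCompactSupport
    (hk.comp (continuous_const.sub continuous_id)) (hasCompactSupport_comp_sub hs x)

lemma integral_rho_sub {s : ℝ} (hs : 0 < s) (x : R2) : ∫ y, rho s (x - y) = 1 := by
  rw [integral_sub_left_eq_self (rho s) volume x, integral_rho hs]

lemma integrable_rho {s : ℝ} (hs : 0 < s) : Integrable (rho s) :=
  (contDiff_rho s).continuous.integrable_of_hasCompactSupport (hasCompactSupport_rho hs)

lemma integrable_rho_sub {s : ℝ} (hs : 0 < s) (x : R2) : Integrable fun y => rho s (x - y) :=
  (integrable_rho hs).comp_sub_left x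

lemma integrable_mul_rho {u : R2 → ℝ} (hu : LocallyIntegrable u) {s : ℝ} (hs : 0 < s) (x : R2) :
    Integrable fun y => u y * rho s (x - y) :=
  integrable_mul_ker hu (contDiff_rho s).continuous (hasCompactSupport_rho hs) x

lemma integrable_mul_pot {u : R2 → ℝ} (hu : LocallyIntegrable u) {s : ℝ} (hs : 0 < s) (x : R2) :
    Integrable fun y => u y * pot s (x - y) :=
  integrable_mul_ker hu (contDiff_pot s).continuous (hasCompactSupport_pot hs) x

lemma integrable_mul_lapPot {u : R2 → ℝ} (hu : LocallyIntegrable u) {s : ℝ} (hs : 0 < s)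
    (x : R2) : Integrable fun y => u y * lapPot s (x - y) :=
  integrable_mul_ker hu (contDiff_lapPot s).continuous (hasCompactSupport_lapPot hs) x

lemma hasDerivAt_mol {u : R2 → ℝ} (hu : LocallyIntegrable u) {s : ℝ} (hs : 0 < s) (x : R2) :
    HasDerivAt (fun s => mol s u x) (s * ∫ y, u y * lapPot s (x - y)) s := by
  obtain ⟨C, hC, hb⟩ := exists_kernel_bound
  have key := hasDerivAt_integral_of_dominated_loc_of_deriv_le (μ := volume) (x₀ := s)
    (s := Ioo (s / 2) (2 * s)) (F := fun s y => u y * rho s (x - y))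
    (F' := fun s y => u y * (s * lapPot s (x - y)))
    (bound := (Metric.closedBall x (2 * s)).indicator fun y => |u y| * (C / (s / 2) ^ 3))
    (Ioo_mem_nhds (by linarith) (by linarith)) ?_ ?_ ?_ ?_ ?_ ?_
  · refine HasDerivAt.congr_deriv key.2 ?_
    rw [← integral_const_mul]
    congr 1; ext y; ring
  · filter_upwards [lt_mem_nhds hs] with r hr
    exact (integrable_mul_rho hu hr x).aestronglyMeasurable
  · exact integrable_mul_rho hu hs x
  · have := (integrable_mul_lapPot hu hs x).const_mul s
    refine this.aestronglyMeasurable.congr (ae_of_all _ fun y => ?_)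
    simp only; ring
  · refine ae_of_all _ fun y r hr => ?_
    have hr0 : 0 < r := by linarith [hr.1]
    by_cases hy : y ∈ Metric.closedBall x (2 * s)
    · rw [indicator_of_mem hy, norm_mul, norm_mul, Real.norm_eq_abs, Real.norm_eq_abs,
        Real.norm_eq_abs, abs_of_pos hr0]
      gcongr
      calc r * |lapPot r (x - y)| ≤ r * (C / r ^ 4) := by
            gcongr; exact (hb r hr0 (x - y) 0).2.2.1
        _ = C / r ^ 3 := by field_simp
        _ ≤ _ := by gcongr; exact hr.1.le
    · rw [indicator_of_notMem hy, lapPot_eq_zero hr0]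
      · simp
      · rw [Metric.mem_closedBall, dist_comm, dist_eq_norm] at hy
        linarith [hr.2]
  · rw [integrable_indicator_iff Metric.isClosed_closedBall.measurableSet]
    exact ((hu.integrableOn_isCompact (isCompact_closedBall _ _)).abs).mul_const _
  · refine ae_of_all _ fun y r hr => ?_
    exact (hasDerivAt_rho (by linarith [hr.1]) (x - y)).const_mul (u y)

lemma ae_tendsto_mol {u : R2 → ℝ} (hu : LocallyIntegrable u) :
    ∀ᵐ x, Tendsto (fun s => mol s u x) (𝓝[>] 0) (𝓝 (u x)) := by
  obtain ⟨C, hC, hb⟩ := exists_kernel_bound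
  filter_upwards [(Besicovitch.vitaliFamily (volume : Measure R2)).ae_tendsto_average_norm_sub hu]
    with x h
  have h' := h.comp (Besicovitch.tendsto_filterAt volume x)
  have key := tendsto_integral_smul_of_tendsto_average_norm_sub
    (g := fun s y => rho s (x - y)) (C * volume.real (Metric.ball (0 : R2) 1)) h' ?_ ?_ ?_ ?_
  · refine key.congr fun s => ?_
    simp only [mol, smul_eq_mul, mul_comm]
  · exact Eventually.of_forall fun s => hu.integrableOn_isCompact (isCompact_closedBall _ _)
  · refine tendsto_const_nhds.congr' ?_
    filter_upwards [self_mem_nhdsWithin] with s hs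
    exact (integral_rho_sub hs x).symm
  · filter_upwards [self_mem_nhdsWithin] with s hs y hy
    by_contra hc
    rw [Metric.mem_closedBall, dist_comm, dist_eq_norm, not_le] at hc
    exact hy (rho_eq_zero hs hc.le)
  · filter_upwards [self_mem_nhdsWithin] with s hs y
    have hs' : 0 < s := hs
    rw [Measure.addHaar_real_closedBall _ _ hs'.le]
    have hv : 0 < volume.real (Metric.ball (0 : R2) 1) :=
      ENNReal.toReal_pos (Metric.measure_ball_pos _ _ one_pos).ne' measure_ball_lt_top.ne
    refine (hb s hs (x - y) 0).1.trans (le_of_eq ?_)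
    simp only [finrank_euclideanSpace, Fintype.card_fin]
    field_simp

lemma contDiff_mol {u : R2 → ℝ} (hu : LocallyIntegrable u) {s : ℝ} (hs : 0 < s) :
    ContDiff ℝ 1 (mol s u) :=
  (hasCompactSupport_rho hs).contDiff_convolution_right (ContinuousLinearMap.mul ℝ ℝ)
    (n := 1) hu ((contDiff_rho s).of_le (by norm_num))

lemma fderiv_mol_apply {u : R2 → ℝ} (hu : LocallyIntegrable u) {s : ℝ} (hs : 0 < s) (x v : R2) :
    fderiv ℝ (mol s u) x v = ∫ y, u y * fderiv ℝ (rho s) (x - y) v := by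
  have hc : ContDiff ℝ 1 (rho s) := (contDiff_rho s).of_le (by norm_num)
  have h := (hasCompactSupport_rho hs).hasFDerivAt_convolution_right
    (ContinuousLinearMap.mul ℝ ℝ) hu hc x
  have h2 := convolution_precompR_apply (ContinuousLinearMap.mul ℝ ℝ) hu
    ((hasCompactSupport_rho hs).fderiv ℝ) (hc.continuous_fderiv one_ne_zero) x v
  rw [show fderiv ℝ (mol s u) x = _ from h.fderiv, h2]
  rfl

/-- Jensen's inequality for squares, with respect to a probability density. -/
lemma sq_integral_mul_le {X : Type*} [MeasurableSpace X] {μ : Measure X} {u k : X → ℝ}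
    (hk : ∀ x, 0 ≤ k x) (hk1 : ∫ x, k x ∂μ = 1) (hki : Integrable k μ)
    (h1 : Integrable (fun x => u x * k x) μ) (h2 : Integrable (fun x => u x ^ 2 * k x) μ) :
    (∫ x, u x * k x ∂μ) ^ 2 ≤ ∫ x, u x ^ 2 * k x ∂μ := by
  set m := ∫ x, u x * k x ∂μ with hm
  have h0 : 0 ≤ ∫ x, (u x - m) ^ 2 * k x ∂μ :=
    integral_nonneg fun x => mul_nonneg (sq_nonneg _) (hk x)
  have e : ∀ x, (u x - m) ^ 2 * k x = u x ^ 2 * k x - 2 * m * (u x * k x) + m ^ 2 * k x :=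
    fun x => by ring
  simp_rw [e] at h0
  have h3 : Integrable (fun x => u x ^ 2 * k x - 2 * m * (u x * k x)) μ :=
    h2.sub (h1.const_mul _)
  rw [integral_add h3 (hki.const_mul _),
    integral_sub h2 (h1.const_mul _), integral_const_mul, integral_const_mul, hk1, ← hm] at h0
  nlinarith

lemma sq_mol_le {u : R2 → ℝ} (hu : LocallyIntegrable u)
    (hu2 : LocallyIntegrable fun x => u x ^ 2) {s : ℝ} (hs : 0 < s) (x : R2) :
    mol s u x ^ 2 ≤ mol s (fun x => u x ^ 2) x :=
  sq_integral_mul_le (fun _ => rho_nonneg _) (integral_rho_sub hs x) (integrable_rho_sub hs x)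
    (integrable_mul_rho hu hs x) (integrable_mul_rho hu2 hs x)

lemma lintegral_rho_sub {s : ℝ} (hs : 0 < s) (y : R2) :
    ∫⁻ x, ENNReal.ofReal (rho s (x - y)) = 1 := by
  rw [lintegral_sub_right_eq_self (fun x => ENNReal.ofReal (rho s x)) y,
    ← ofReal_integral_eq_lintegral_ofReal (integrable_rho hs) (ae_of_all _ fun _ => rho_nonneg _),
    integral_rho hs, ENNReal.ofReal_one]

lemma lintegral_sq_mol_le {u : R2 → ℝ} (hm : Measurable u) (hu : LocallyIntegrable u)
    (hu2 : LocallyIntegrable fun x => u x ^ 2) {s : ℝ} (hs : 0 < s) :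
    ∫⁻ x, ENNReal.ofReal (mol s u x ^ 2) ≤ ∫⁻ x, ENNReal.ofReal (u x ^ 2) := by
  have hr : Measurable (rho s) := (contDiff_rho s).continuous.measurable
  calc ∫⁻ x, ENNReal.ofReal (mol s u x ^ 2)
      ≤ ∫⁻ x, ∫⁻ y, ENNReal.ofReal (u y ^ 2) * ENNReal.ofReal (rho s (x - y)) := by
        refine lintegral_mono fun x => ?_
        refine (ENNReal.ofReal_le_ofReal (sq_mol_le hu hu2 hs x)).trans (le_of_eq ?_)
        rw [mol, ofReal_integral_eq_lintegral_ofReal (integrable_mul_rho hu2 hs x)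
          (ae_of_all _ fun y => mul_nonneg (sq_nonneg _) (rho_nonneg _))]
        exact lintegral_congr fun y => ENNReal.ofReal_mul (sq_nonneg _)
    _ = ∫⁻ y, ∫⁻ x, ENNReal.ofReal (u y ^ 2) * ENNReal.ofReal (rho s (x - y)) := by
        refine lintegral_lintegral_swap (Measurable.aemeasurable ?_)
        fun_prop
    _ = _ := by
        refine lintegral_congr fun y => ?_
        rw [lintegral_const_mul _ (by fun_prop), lintegral_rho_sub hs, mul_one]

lemma sq_sub_translate_le {u : R2 → ℝ} (hu : ContDiff ℝ 1 u) (x z : R2) :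
    (u x - u (x - z)) ^ 2 ≤ ∫ t in Ioc (0 : ℝ) 1, ‖fderiv ℝ u (x - t • z)‖ ^ 2 * ‖z‖ ^ 2 := by
  have hc : Continuous (fderiv ℝ u) := hu.continuous_fderiv one_ne_zero
  have hpath : Continuous fun t : ℝ => x - t • z := by fun_prop
  have hD : Continuous fun t : ℝ => fderiv ℝ u (x - t • z) z :=
    (hc.comp hpath).clm_apply continuous_const
  have hd : ∀ t : ℝ, HasDerivAt (fun t : ℝ => -u (x - t • z)) (fderiv ℝ u (x - t • z) z) t := by
    intro t
    have h1 : HasDerivAt (fun t : ℝ => x - t • z) (-z) t := by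
      simpa using ((hasDerivAt_id t).smul_const z).const_sub x
    have h2 := ((hu.differentiable one_ne_zero (x - t • z)).hasFDerivAt.comp_hasDerivAt t h1).neg
    exact HasDerivAt.congr_deriv h2 (by simp)
  have hftc : ∫ t in (0 : ℝ)..1, fderiv ℝ u (x - t • z) z = u x - u (x - z) := by
    rw [intervalIntegral.integral_eq_sub_of_hasDerivAt (fun t _ => hd t)
      (hD.intervalIntegrable _ _)]
    simp; ring
  rw [← hftc, intervalIntegral.integral_of_le zero_le_one]
  have hint : ∀ f : ℝ → ℝ, Continuous f → IntegrableOn f (Ioc 0 1) := fun f hf =>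
    (hf.integrableOn_Icc).mono_set Ioc_subset_Icc_self
  have hJ := sq_integral_mul_le (μ := volume.restrict (Ioc (0 : ℝ) 1))
    (u := fun t => fderiv ℝ u (x - t • z) z) (k := fun _ => 1) (fun _ => zero_le_one)
    (by simp) (hint _ continuous_const) (hint _ (by simpa using hD))
    (hint _ (by simp only [mul_one]; exact hD.pow 2))
  simp only [mul_one] at hJ
  refine hJ.trans (integral_mono (hint _ (hD.pow 2)) (hint _ ?_) fun t => ?_)
  · exact ((hc.comp hpath).norm.pow 2).mul continuous_const
  · have := (fderiv ℝ u (x - t • z)).le_opNorm z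
    simp only
    rw [← mul_pow, ← sq_abs]
    exact pow_le_pow_left₀ (abs_nonneg _) this 2

lemma lintegral_sq_sub_translate_le {u : R2 → ℝ} (hu : ContDiff ℝ 1 u) (z : R2) :
    ∫⁻ x, ENNReal.ofReal ((u x - u (x - z)) ^ 2) ≤
      ENNReal.ofReal (‖z‖ ^ 2) * ∫⁻ x, ENNReal.ofReal (‖fderiv ℝ u x‖ ^ 2) := by
  have hc : Continuous (fderiv ℝ u) := hu.continuous_fderiv one_ne_zero
  calc _ ≤ ∫⁻ x, ∫⁻ t in Ioc (0 : ℝ) 1,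
        ENNReal.ofReal (‖z‖ ^ 2) * ENNReal.ofReal (‖fderiv ℝ u (x - t • z)‖ ^ 2) := by
        refine lintegral_mono fun x => ?_
        refine (ENNReal.ofReal_le_ofReal (sq_sub_translate_le hu x z)).trans (le_of_eq ?_)
        rw [ofReal_integral_eq_lintegral_ofReal _ (ae_of_all _ fun t => by positivity)]
        · refine lintegral_congr fun t => ?_
          rw [mul_comm, ENNReal.ofReal_mul (by positivity)]
        · have : Continuous fun t : ℝ => ‖fderiv ℝ u (x - t • z)‖ ^ 2 * ‖z‖ ^ 2 := by fun_prop
          exact (this.integrableOn_Icc).mono_set Ioc_subset_Icc_self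
    _ = ∫⁻ t in Ioc (0 : ℝ) 1, ∫⁻ x,
        ENNReal.ofReal (‖z‖ ^ 2) * ENNReal.ofReal (‖fderiv ℝ u (x - t • z)‖ ^ 2) := by
        refine lintegral_lintegral_swap (Measurable.aemeasurable ?_)
        have : Continuous fun p : R2 × ℝ => ‖fderiv ℝ u (p.1 - p.2 • z)‖ ^ 2 := by fun_prop
        exact (this.measurable.ennreal_ofReal).const_mul _
    _ = _ := by
        have : ∀ t : ℝ, ∫⁻ x, ENNReal.ofReal (‖z‖ ^ 2) *
            ENNReal.ofReal (‖fderiv ℝ u (x - t • z)‖ ^ 2) =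
            ENNReal.ofReal (‖z‖ ^ 2) * ∫⁻ x, ENNReal.ofReal (‖fderiv ℝ u x‖ ^ 2) := fun t => by
          rw [lintegral_const_mul' _ _ ENNReal.ofReal_ne_top,
            lintegral_sub_right_eq_self (fun x => ENNReal.ofReal (‖fderiv ℝ u x‖ ^ 2)) (t • z)]
        simp_rw [this]
        simp

lemma lintegral_sq_sub_mol_le {u : R2 → ℝ} (hu : ContDiff ℝ 1 u) {s : ℝ} (hs : 0 < s) :
    ∫⁻ x, ENNReal.ofReal ((u x - mol s u x) ^ 2) ≤
      ENNReal.ofReal (s ^ 2) * ∫⁻ x, ENNReal.ofReal (‖fderiv ℝ u x‖ ^ 2) := by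
  have hcu : Continuous u := hu.continuous
  have hr : Continuous (rho s) := (contDiff_rho s).continuous
  calc _ ≤ ∫⁻ x, ∫⁻ z, ENNReal.ofReal (rho s z) * ENNReal.ofReal ((u x - u (x - z)) ^ 2) := by
        refine lintegral_mono fun x => ?_
        have hv : Continuous fun y => u x - u y := by fun_prop
        have e : u x - mol s u x = mol s (fun y => u x - u y) x := by
          simp only [mol, sub_mul]
          rw [integral_sub ((integrable_rho_sub hs x).const_mul _)
            (integrable_mul_rho hcu.locallyIntegrable hs x), integral_const_mul,
            integral_rho_sub hs, mul_one]
        rw [e]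
        have hv2 : LocallyIntegrable fun y => (u x - u y) ^ 2 := (hv.pow 2).locallyIntegrable
        refine (ENNReal.ofReal_le_ofReal
          (sq_mol_le hv.locallyIntegrable hv2 hs x)).trans (le_of_eq ?_)
        rw [mol, ofReal_integral_eq_lintegral_ofReal (integrable_mul_rho hv2 hs x)
          (ae_of_all _ fun y => mul_nonneg (sq_nonneg _) (rho_nonneg _)),
          ← lintegral_sub_left_eq_self _ x]
        refine lintegral_congr fun y => ?_
        rw [sub_sub_cancel, mul_comm, ENNReal.ofReal_mul (rho_nonneg _)]
    _ = ∫⁻ z, ∫⁻ x, ENNReal.ofReal (rho s z) * ENNReal.ofReal ((u x - u (x - z)) ^ 2) := by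
        refine lintegral_lintegral_swap (Measurable.aemeasurable ?_)
        have := hcu.measurable
        have := hr.measurable
        fun_prop
    _ ≤ ∫⁻ z, ENNReal.ofReal (rho s z) *
          (ENNReal.ofReal (s ^ 2) * ∫⁻ x, ENNReal.ofReal (‖fderiv ℝ u x‖ ^ 2)) := by
        refine lintegral_mono fun z => ?_
        simp only
        rw [lintegral_const_mul' _ _ ENNReal.ofReal_ne_top]
        rcases le_or_gt s ‖z‖ with hz | hz
        · simp [rho_eq_zero hs hz]
        · refine mul_le_mul_right ((lintegral_sq_sub_translate_le hu z).trans ?_) _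
          gcongr
    _ = _ := by
        rw [lintegral_mul_const _ (by have := hr.measurable; fun_prop)]
        have := lintegral_rho_sub hs 0
        simp only [sub_zero] at this
        rw [this, one_mul]

lemma fderiv_mol_eq {u : R2 → ℝ} (hu : ContDiff ℝ 1 u) {s : ℝ} (hs : 0 < s) (x v : R2) :
    fderiv ℝ (mol s u) x v = mol s (fun y => fderiv ℝ u y v) x := by
  have hc : Continuous fun y => fderiv ℝ u y v :=
    (hu.continuous_fderiv one_ne_zero).clm_apply continuous_const
  have hcr : ContDiff ℝ 1 (rho s) := (contDiff_rho s).of_le (by norm_num)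
  have hd : ∀ y, HasFDerivAt (fun y => rho s (x - y)) (-fderiv ℝ (rho s) (x - y)) y := by
    intro y
    have h1 : HasFDerivAt (fun y : R2 => x - y) (-ContinuousLinearMap.id ℝ R2) y :=
      (hasFDerivAt_id y).const_sub x
    have := ((hcr.differentiable one_ne_zero (x - y)).hasFDerivAt).comp y h1
    refine this.congr_fderiv ?_
    ext w; simp
  have hi : Integrable fun y => u y * fderiv ℝ (rho s) (x - y) v :=
    integrable_mul_ker hu.continuous.locallyIntegrable
      ((hcr.continuous_fderiv one_ne_zero).clm_apply continuous_const)
      ((hasCompactSupport_rho hs).fderiv_apply ℝ v) x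
  have hp := integral_mul_fderiv_eq_neg_fderiv_mul_of_integrable (μ := (volume : Measure R2))
    (f := u) (g := fun y => rho s (x - y)) (v := v)
    (integrable_mul_rho hc.locallyIntegrable hs x)
    (by simp only [(hd _).fderiv, neg_apply, mul_neg]; exact hi.neg)
    (integrable_mul_rho hu.continuous.locallyIntegrable hs x)
    (fun y _ => hu.differentiable one_ne_zero y) (fun y _ => (hd y).differentiableAt)
  simp only [(hd _).fderiv, neg_apply, mul_neg, integral_neg, neg_inj] at hp
  rw [fderiv_mol_apply hu.continuous.locallyIntegrable hs, hp]
  rfl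

/-- Integration by parts against `∇ (pot s (x - ·))`. -/
lemma integral_fderiv_mul_rho {u : R2 → ℝ} (hu : ContDiff ℝ 1 u) {s : ℝ} (hs : 0 < s) (x : R2) :
    ∫ y, fderiv ℝ u y (x - y) * (rho s (x - y) / s ^ 2) = - ∫ y, u y * lapPot s (x - y) := by
  set e : Fin 2 → R2 := fun i => EuclideanSpace.single i 1 with he
  have hdec : ∀ w : R2, w = ∑ i, w i • e i := fun w => by
    ext j; fin_cases j <;> simp [he, Fin.sum_univ_two]
  have hcr : ContDiff ℝ 1 (rho s) := (contDiff_rho s).of_le (by norm_num)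
  have hq : ∀ z, HasFDerivAt (qarg s) (-((2 / s ^ 2) • innerSL ℝ z)) z := by
    intro z
    have h1 : HasFDerivAt (fun z : R2 => ‖z‖ ^ 2) (2 • innerSL ℝ z) z :=
      (hasStrictFDerivAt_norm_sq z).hasFDerivAt
    have h2 := (h1.mul_const ((s ^ 2)⁻¹)).const_sub 1
    refine h2.congr_fderiv ?_
    ext w
    simp
    ring
  have hr : ∀ z, HasFDerivAt (rho s)
      (-((4 / kmass / s ^ 4 * glueDD (qarg s z)) • innerSL ℝ z)) z := by
    intro z
    have h2 := ((hasDerivAt_glueD (qarg s z)).comp_hasFDerivAt z (hq z)).const_mul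
      (2 / kmass / s ^ 2)
    refine h2.congr_fderiv ?_
    ext w
    simp
    field_simp
    ring
  have hg : ∀ i y, HasFDerivAt (fun y => rho s (x - y) / s ^ 2 * (x - y) i)
      ((rho s (x - y) / s ^ 2) • (-(EuclideanSpace.proj i : R2 →L[ℝ] ℝ)) +
        (x - y) i • ((4 / kmass / s ^ 6 * glueDD (qarg s (x - y))) • innerSL ℝ (x - y))) y := by
    intro i y
    have h1 : HasFDerivAt (fun y : R2 => x - y) (-ContinuousLinearMap.id ℝ R2) y :=
      (hasFDerivAt_id y).const_sub x
    have h2 := ((hr (x - y)).comp y h1).mul_const ((s ^ 2)⁻¹)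
    have h3 : HasFDerivAt (fun y : R2 => (x - y) i) (-(EuclideanSpace.proj i : R2 →L[ℝ] ℝ)) y := by
      have := (EuclideanSpace.proj i : R2 →L[ℝ] ℝ).hasFDerivAt.comp y h1
      refine this.congr_fderiv ?_
      ext w; simp
    refine (h2.mul h3).congr_fderiv ?_
    ext w
    simp
    field_simp
  have hDk : ∀ i : Fin 2, Continuous fun z : R2 => -(rho s z / s ^ 2) +
      z i * (4 / kmass / s ^ 6 * glueDD (qarg s z) * z i) := by
    intro i
    have h1 := (contDiff_rho s).continuous
    have h2 := (contDiff_glueDD.comp (contDiff_qarg s)).continuous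
    simp only [Function.comp_def] at h2
    fun_prop
  have hDs : ∀ i : Fin 2, HasCompactSupport fun z : R2 => -(rho s z / s ^ 2) +
      z i * (4 / kmass / s ^ 6 * glueDD (qarg s z) * z i) := fun i =>
    hasCompactSupport_of_zero (s := s) fun z hz => by
      simp [rho_eq_zero hs hz, glueDD_of_nonpos (qarg_nonpos hs hz)]
  have hkc : ∀ i : Fin 2, Continuous fun z : R2 => rho s z / s ^ 2 * z i := by
    intro i
    have h1 := (contDiff_rho s).continuous
    fun_prop
  have hks : ∀ i : Fin 2, HasCompactSupport fun z : R2 => rho s z / s ^ 2 * z i := fun i =>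
    hasCompactSupport_of_zero (s := s) fun z hz => by simp [rho_eq_zero hs hz]
  have hDe : ∀ i y, fderiv ℝ (fun y => rho s (x - y) / s ^ 2 * (x - y) i) y (e i) =
      -(rho s (x - y) / s ^ 2) +
        (x - y) i * (4 / kmass / s ^ 6 * glueDD (qarg s (x - y)) * (x - y) i) := by
    intro i y
    rw [(hg i y).fderiv]
    have h1 : ∀ w : R2, inner ℝ w (e i) = w i := fun w => by
      simp [he, EuclideanSpace.inner_single_right]
    have h2 : (e i) i = 1 := by simp [he]
    simp [h2, h1]
  have hui : ∀ i, Integrable fun y => u y * (-(rho s (x - y) / s ^ 2) +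
        (x - y) i * (4 / kmass / s ^ 6 * glueDD (qarg s (x - y)) * (x - y) i)) := fun i =>
    integrable_mul_ker hu.continuous.locallyIntegrable (hDk i) (hDs i) x
  have hci : ∀ i, Continuous fun y => fderiv ℝ u y (e i) := fun i =>
    (hu.continuous_fderiv one_ne_zero).clm_apply continuous_const
  have hdi : ∀ i, Integrable fun y => fderiv ℝ u y (e i) * (rho s (x - y) / s ^ 2 * (x - y) i) :=
    fun i => integrable_mul_ker (hci i).locallyIntegrable (hkc i) (hks i) x
  have hp : ∀ i, ∫ y, u y * (-(rho s (x - y) / s ^ 2) +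
        (x - y) i * (4 / kmass / s ^ 6 * glueDD (qarg s (x - y)) * (x - y) i)) =
      - ∫ y, fderiv ℝ u y (e i) * (rho s (x - y) / s ^ 2 * (x - y) i) := by
    intro i
    have := integral_mul_fderiv_eq_neg_fderiv_mul_of_integrable (μ := (volume : Measure R2))
      (f := u) (g := fun y => rho s (x - y) / s ^ 2 * (x - y) i) (v := e i) (hdi i)
      (by simp only [hDe]; exact hui i)
      (integrable_mul_ker hu.continuous.locallyIntegrable (hkc i) (hks i) x)
      (fun y _ => hu.differentiable one_ne_zero y) (fun y _ => (hg i y).differentiableAt)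
    simpa only [hDe] using this
  have e1 : ∀ y, fderiv ℝ u y (x - y) * (rho s (x - y) / s ^ 2) =
      ∑ i, fderiv ℝ u y (e i) * (rho s (x - y) / s ^ 2 * (x - y) i) := by
    intro y
    conv_lhs => rw [hdec (x - y), map_sum]
    rw [Finset.sum_mul]
    refine Finset.sum_congr rfl fun i _ => ?_
    rw [map_smul, smul_eq_mul, ← hdec (x - y)]
    ring
  have e2 : ∀ y, u y * lapPot s (x - y) = ∑ i, u y * (-(rho s (x - y) / s ^ 2) +
        (x - y) i * (4 / kmass / s ^ 6 * glueDD (qarg s (x - y)) * (x - y) i)) := by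
    intro y
    rw [← Finset.mul_sum]
    congr 1
    rw [lapPot, EuclideanSpace.norm_sq_eq, rho]
    simp only [Fin.sum_univ_two, Real.norm_eq_abs, sq_abs]
    field_simp
    ring
  simp_rw [e1, e2]
  rw [integral_finsetSum _ fun i _ => hdi i, integral_finsetSum _ fun i _ => hui i,
    ← Finset.sum_neg_distrib]
  exact Finset.sum_congr rfl fun i _ => by rw [hp i, neg_neg]

/-! ### Consequences of the mollified Euler-Lagrange equation -/

lemma mul_sub_le_of_hasDerivAt {f f' : ℝ → ℝ} {a b m : ℝ} (hab : a ≤ b)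
    (h : ∀ s ∈ Icc a b, HasDerivAt f (f' s) s) (hm : ∀ s ∈ Icc a b, m ≤ f' s) :
    m * (b - a) ≤ f b - f a := by
  refine Convex.mul_sub_le_image_sub_of_le_deriv (convex_Icc a b)
    (fun s hs => (h s hs).continuousAt.continuousWithinAt)
    (fun s hs => (h s (interior_subset hs)).differentiableAt.differentiableWithinAt)
    (fun s hs => ?_) a (left_mem_Icc.2 hab) b (right_mem_Icc.2 hab) hab
  rw [(h s (interior_subset hs)).deriv]
  exact hm s (interior_subset hs)

lemma memLp_two_of_lintegral_ne_top {X : Type*} [MeasurableSpace X] {μ : Measure X} {u : X → ℝ}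
    (hm : AEStronglyMeasurable u μ) (h : ∫⁻ x, ENNReal.ofReal (u x ^ 2) ∂μ ≠ ∞) : MemLp u 2 μ := by
  rw [memLp_two_iff_integrable_sq hm]
  refine ⟨hm.pow 2, ?_⟩
  rw [hasFiniteIntegral_iff_ofReal (ae_of_all _ fun x => sq_nonneg _)]
  exact h.lt_top

lemma integrable_pot_sub {s : ℝ} (hs : 0 < s) (x : R2) : Integrable fun y => pot s (x - y) := by
  simpa using integrable_mul_pot (u := fun _ => 1) (locallyIntegrable_const 1) hs x

lemma integral_pot_sub_le {s : ℝ} (hs : 0 < s) (x : R2) : ∫ y, pot s (x - y) ≤ 1 := by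
  rw [← integral_rho_sub hs x]
  exact integral_mono (integrable_pot_sub hs x) (integrable_rho_sub hs x) fun y => pot_le_rho _

lemma mol_nonneg {u : R2 → ℝ} (hu : ∀ x, 0 ≤ u x) (s : ℝ) (x : R2) : 0 ≤ mol s u x :=
  integral_nonneg fun y => mul_nonneg (hu y) (rho_nonneg _)

lemma mol_congr {u v : R2 → ℝ} (h : u =ᵐ[volume] v) (s : ℝ) : mol s u = mol s v := by
  funext x
  exact integral_congr_ae (h.mono fun y hy => by simp only [hy])

lemma abs_integral_mul_le {X : Type*} [MeasurableSpace X] {μ : Measure X} {F k : X → ℝ} {B : ℝ}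
    (hF : ∀ᵐ y ∂μ, |F y| ≤ B) (hk : Integrable k μ) : |∫ y, F y * k y ∂μ| ≤ B * ∫ y, |k y| ∂μ := by
  rw [← Real.norm_eq_abs, ← integral_const_mul]
  refine norm_integral_le_of_norm_le (hk.abs.const_mul B) (hF.mono fun y hy => ?_)
  rw [norm_mul]
  exact mul_le_mul_of_nonneg_right hy (norm_nonneg _)

lemma tendsto_mol_of_continuous {u : R2 → ℝ} (hu : Continuous u) (x : R2) :
    Tendsto (fun s => mol s u x) (𝓝[>] 0) (𝓝 (u x)) := by
  rw [Metric.tendsto_nhdsWithin_nhds]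
  intro ε hε
  obtain ⟨δ, hδ, h⟩ := Metric.continuousAt_iff.1 hu.continuousAt (ε / 2) (half_pos hε)
  refine ⟨δ, hδ, fun s hs hsd => ?_⟩
  have hs : 0 < s := hs
  have hsd : s < δ := by simpa [abs_of_pos hs] using hsd
  have e : mol s u x - u x = ∫ y, (u y - u x) * rho s (x - y) := by
    simp only [sub_mul]
    rw [integral_sub (integrable_mul_rho hu.locallyIntegrable hs x)
      ((integrable_rho_sub hs x).const_mul _), integral_const_mul, integral_rho_sub hs, mul_one]
    rfl
  rw [Real.dist_eq, e]
  refine lt_of_le_of_lt ?_ (half_lt_self hε)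
  rw [← Real.norm_eq_abs]
  refine (norm_integral_le_of_norm_le ((integrable_rho_sub hs x).const_mul (ε / 2))
    (ae_of_all _ fun y => ?_)).trans (by rw [integral_const_mul, integral_rho_sub hs, mul_one])
  rw [norm_mul, Real.norm_of_nonneg (rho_nonneg _)]
  by_cases hy : s ≤ ‖x - y‖
  · simp [rho_eq_zero hs hy]
  · refine mul_le_mul_of_nonneg_right ?_ (rho_nonneg _)
    rw [← dist_eq_norm]
    refine (h ?_).le
    rw [dist_comm, dist_eq_norm]
    linarith

lemma integral_abs_sub_ker_le {k : ℝ → R2 → ℝ} {C : ℝ} (hC : 0 ≤ C)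
    (hk : ∀ s, 0 < s → ∀ z, s ≤ ‖z‖ → k s z = 0)
    (hl : ∀ s, 0 < s → ∀ z z', |k s z - k s z'| ≤ C / s ^ 3 * ‖z - z'‖) {s : ℝ} (hs : 0 < s)
    (x x' : R2) : ∫ y, |k s (x - y) - k s (x' - y)| ≤
      2 * C * volume.real (Metric.ball (0 : R2) 1) / s * ‖x - x'‖ := by
  have hb : ∀ x : R2, volume.real (Metric.ball x s) = s ^ 2 * volume.real (Metric.ball (0 : R2) 1) := by
    intro x
    rw [Measure.real, Measure.addHaar_ball _ _ hs.le, ENNReal.toReal_mul,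
      ENNReal.toReal_ofReal (by positivity)]
    simp [Measure.real]
  set D := C / s ^ 3 * ‖x - x'‖ with hD
  have hD0 : 0 ≤ D := by positivity
  have hi : ∀ z : R2, Integrable ((Metric.ball z s).indicator fun _ => D) := fun z =>
    (integrable_indicator_iff measurableSet_ball).2 (integrableOn_const (measure_ball_lt_top.ne))
  have hI : ∀ z : R2, ∫ y, (Metric.ball z s).indicator (fun _ => D) y =
      s ^ 2 * volume.real (Metric.ball (0 : R2) 1) * D := by
    intro z
    rw [integral_indicator measurableSet_ball, setIntegral_const, hb, smul_eq_mul]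
  calc ∫ y, |k s (x - y) - k s (x' - y)|
      ≤ ∫ y, ((Metric.ball x s).indicator (fun _ => D) y +
          (Metric.ball x' s).indicator (fun _ => D) y) := by
        refine integral_mono_of_nonneg (ae_of_all _ fun y => abs_nonneg _) ((hi x).add (hi x'))
          (ae_of_all _ fun y => ?_)
        have h0 : ∀ z : R2, 0 ≤ (Metric.ball z s).indicator (fun _ => D) y := fun z =>
          indicator_nonneg (fun _ _ => hD0) y
        by_cases h1 : y ∈ Metric.ball x s ∨ y ∈ Metric.ball x' s
        · have : |k s (x - y) - k s (x' - y)| ≤ D := by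
            have := hl s hs (x - y) (x' - y)
            rwa [sub_sub_sub_cancel_right] at this
          rcases h1 with h1 | h1
          · have := h0 x'
            simp only [indicator_of_mem h1]; linarith
          · have := h0 x
            simp only [indicator_of_mem h1]; linarith
        · push Not at h1
          have a1 := hk s hs (x - y) (by
            have := h1.1; rw [Metric.mem_ball, not_lt, dist_comm, dist_eq_norm] at this; exact this)
          have a2 := hk s hs (x' - y) (by
            have := h1.2; rw [Metric.mem_ball, not_lt, dist_comm, dist_eq_norm] at this; exact this)
          simp only [a1, a2, sub_zero, abs_zero]
          exact add_nonneg (h0 x) (h0 x')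
    _ = _ := by
        rw [integral_add (hi x) (hi x'), hI, hI, hD]
        field_simp
        ring

/-- A Lipschitz bound in `L¹` for the translated kernels. -/
lemma exists_integral_abs_sub_le : ∃ C : ℝ, 0 < C ∧ ∀ s : ℝ, 0 < s → ∀ x x' : R2,
    ∫ y, |rho s (x - y) - rho s (x' - y)| ≤ C / s * ‖x - x'‖ ∧
    ∫ y, |pot s (x - y) - pot s (x' - y)| ≤ C / s * ‖x - x'‖ := by
  obtain ⟨C, hC, h⟩ := exists_kernel_bound
  have hv : 0 < volume.real (Metric.ball (0 : R2) 1) :=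
    ENNReal.toReal_pos (Metric.measure_ball_pos _ _ one_pos).ne' measure_ball_lt_top.ne
  exact ⟨2 * C * volume.real (Metric.ball (0 : R2) 1), by positivity, fun s hs x x' =>
    ⟨integral_abs_sub_ker_le hC.le (fun s hs z hz => rho_eq_zero hs hz)
      (fun s hs z z' => (h s hs z z').2.2.2.1) hs x x',
     integral_abs_sub_ker_le hC.le (fun s hs z hz => pot_eq_zero hs hz)
      (fun s hs z z' => (h s hs z z').2.2.2.2) hs x x'⟩⟩

lemma mol_sub_eq_integral {u : R2 → ℝ} (hu : LocallyIntegrable u) {s : ℝ} (hs : 0 < s)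
    (x x' : R2) : mol s u x - mol s u x' = ∫ y, u y * (rho s (x - y) - rho s (x' - y)) := by
  simp only [mul_sub]
  exact (integral_sub (integrable_mul_rho hu hs x) (integrable_mul_rho hu hs x')).symm

/-- The mollified Poisson equation with bounded right-hand side gives `C¹` regularity. -/
lemma exists_contDiff_of_hasDerivAt_mol : ∃ C : ℝ, 0 < C ∧ ∀ (u F : R2 → ℝ) (B : ℝ), 0 ≤ B →
    LocallyIntegrable u → LocallyIntegrable F → (∀ᵐ y, |u y| ≤ B) → (∀ᵐ y, |F y| ≤ B) →
    (∀ s, 0 < s → ∀ x, HasDerivAt (fun s => mol s u x) (s * ∫ y, F y * pot s (x - y)) s) →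
    ∃ v : R2 → ℝ, u =ᵐ[volume] v ∧ ContDiff ℝ 1 v ∧ ∀ x, |v x| + ‖fderiv ℝ v x‖ ≤ C * B := by
  obtain ⟨C, hC, hk⟩ := exists_integral_abs_sub_le
  refine ⟨1 + 2 * C, by positivity, fun u F B hB hu hF huB hFB hd => ?_⟩
  have hpot : ∀ s, 0 < s → ∀ x : R2, |s * ∫ y, F y * pot s (x - y)| ≤ s * B := by
    intro s hs x
    rw [abs_mul, abs_of_pos hs]
    refine mul_le_mul_of_nonneg_left ((abs_integral_mul_le hFB (integrable_pot_sub hs x)).trans ?_)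
      hs.le
    simp only [abs_of_nonneg (pot_nonneg _)]
    exact mul_le_of_le_one_right hB (integral_pot_sub_le hs x)
  have hmv : ∀ (f f' : ℝ → ℝ) (m a b : ℝ), a ≤ b → (∀ s ∈ Icc a b, HasDerivAt f (f' s) s) →
      (∀ s ∈ Icc a b, |f' s| ≤ m) → |f b - f a| ≤ m * (b - a) := by
    intro f f' m a b hab h hm
    have h1 := mul_sub_le_of_hasDerivAt hab h (m := -m) fun s hs => (abs_le.1 (hm s hs)).1
    have h2 := mul_sub_le_of_hasDerivAt hab (fun s hs => (h s hs).neg) (m := -m)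
      fun s hs => neg_le_neg (abs_le.1 (hm s hs)).2
    simp only [Pi.neg_apply] at h2
    rw [abs_le]
    constructor <;> linarith
  have hval : ∀ a b, 0 < a → a ≤ b → b ≤ 1 → ∀ x, |mol b u x - mol a u x| ≤ B * (b - a) := by
    intro a b ha hab hb x
    refine hmv (fun s => mol s u x) _ B a b hab (fun s hs => hd s (ha.trans_le hs.1) x) ?_
    intro s hs
    exact (hpot s (ha.trans_le hs.1) x).trans (mul_le_of_le_one_left hB (hs.2.trans hb))
  have hlip : ∀ a b, 0 < a → a ≤ b → ∀ x x',
      |(mol b u x - mol a u x) - (mol b u x' - mol a u x')| ≤ (B * C * (b - a)) * ‖x - x'‖ := by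
    intro a b ha hab x x'
    have := hmv (fun s => mol s u x - mol s u x')
      (fun s => (s * ∫ y, F y * pot s (x - y)) - (s * ∫ y, F y * pot s (x' - y))) (B * C * ‖x - x'‖)
      a b hab (fun s hs => (hd s (ha.trans_le hs.1) x).sub (hd s (ha.trans_le hs.1) x')) ?_
    · calc _ = |mol b u x - mol b u x' - (mol a u x - mol a u x')| := by congr 1; ring
        _ ≤ _ := this
        _ = _ := by ring
    · intro s hs
      have hs0 : 0 < s := ha.trans_le hs.1
      have e : ∀ I J : ℝ, s * I - s * J = s * (I - J) := fun I J => by ring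
      rw [e, ← integral_sub (integrable_mul_pot hF hs0 x) (integrable_mul_pot hF hs0 x')]
      simp only [← mul_sub]
      rw [abs_mul, abs_of_pos hs0]
      calc s * |∫ y, F y * (pot s (x - y) - pot s (x' - y))|
          ≤ s * (B * (C / s * ‖x - x'‖)) := by
            refine mul_le_mul_of_nonneg_left ((abs_integral_mul_le hFB
              ((integrable_pot_sub hs0 x).sub (integrable_pot_sub hs0 x'))).trans ?_) hs0.le
            exact mul_le_mul_of_nonneg_left (hk s hs0 x x').2 hB
        _ = B * C * ‖x - x'‖ := by field_simp
  have hdiff : ∀ s, 0 < s → Differentiable ℝ (mol s u) := fun s hs =>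
    (contDiff_mol hu hs).differentiable (by norm_num)
  have hfd : ∀ a b, 0 < a → a ≤ b → ∀ x,
      ‖fderiv ℝ (mol b u) x - fderiv ℝ (mol a u) x‖ ≤ B * C * (b - a) := by
    intro a b ha hab x
    have h0 : 0 ≤ B * C * (b - a) := mul_nonneg (mul_nonneg hB hC.le) (sub_nonneg.2 hab)
    rw [← fderiv_sub (hdiff b (ha.trans_le hab) x) (hdiff a ha x)]
    refine norm_fderiv_le_of_lipschitz ℝ (C := ⟨B * C * (b - a), h0⟩)
      (LipschitzWith.of_dist_le_mul fun x x' => ?_)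
    rw [Real.dist_eq, dist_eq_norm]
    exact hlip a b ha hab x x'
  have hfd1 : ∀ x, ‖fderiv ℝ (mol 1 u) x‖ ≤ B * C := by
    intro x
    refine norm_fderiv_le_of_lipschitz ℝ (C := ⟨B * C, mul_nonneg hB hC.le⟩)
      (LipschitzWith.of_dist_le_mul fun x x' => ?_)
    rw [Real.dist_eq, dist_eq_norm, mol_sub_eq_integral hu one_pos]
    refine (abs_integral_mul_le huB
      ((integrable_rho_sub one_pos x).sub (integrable_rho_sub one_pos x'))).trans ?_
    have := mul_le_mul_of_nonneg_left (hk 1 one_pos x x').1 hB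
    simp only [div_one] at this
    show _ ≤ B * C * _
    rw [mul_assoc]
    exact this
  set σ : ℕ → ℝ := fun n => 1 / ((n : ℝ) + 1) with hσ
  have hσ0 : ∀ n, 0 < σ n := fun n => by positivity
  have hσ1 : ∀ n, σ n ≤ 1 := fun n => by
    rw [hσ]; exact div_le_one_of_le₀ (by simp) (by positivity)
  have hσa : Antitone σ := fun m n h => one_div_le_one_div_of_le (by positivity) (by gcongr)
  have hσt : Tendsto σ atTop (𝓝 0) := tendsto_one_div_add_atTop_nhds_zero_nat
  have hσt' : Tendsto σ atTop (𝓝[>] 0) :=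
    tendsto_nhdsWithin_iff.2 ⟨hσt, Eventually.of_forall hσ0⟩
  have hc1 : ∀ x, CauchySeq fun n => mol (σ n) u x := fun x => by
    refine cauchySeq_of_le_tendsto_0 (fun n => B * σ n * 2) (fun n m N hn hm => ?_)
      (by simpa using (hσt.const_mul B).mul_const 2)
    have key : ∀ k, N ≤ k → dist (mol (σ k) u x) (mol (σ N) u x) ≤ B * σ N := fun k hk => by
      rw [dist_comm, Real.dist_eq]
      refine (hval _ _ (hσ0 k) (hσa hk) (hσ1 N) x).trans ?_
      exact mul_le_mul_of_nonneg_left (by linarith [hσ0 k]) hB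
    have := dist_triangle_right (mol (σ n) u x) (mol (σ m) u x) (mol (σ N) u x)
    linarith [key n hn, key m hm]
  have hc2 : ∀ x, CauchySeq fun n => fderiv ℝ (mol (σ n) u) x := fun x => by
    refine cauchySeq_of_le_tendsto_0 (fun n => B * C * σ n * 2) (fun n m N hn hm => ?_)
      (by simpa using (hσt.const_mul (B * C)).mul_const 2)
    have key : ∀ k, N ≤ k → dist (fderiv ℝ (mol (σ k) u) x) (fderiv ℝ (mol (σ N) u) x) ≤
        B * C * σ N := fun k hk => by
      rw [dist_comm, dist_eq_norm]
      refine (hfd _ _ (hσ0 k) (hσa hk) x).trans ?_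
      exact mul_le_mul_of_nonneg_left (by linarith [hσ0 k]) (mul_nonneg hB hC.le)
    have := dist_triangle_right (fderiv ℝ (mol (σ n) u) x) (fderiv ℝ (mol (σ m) u) x)
      (fderiv ℝ (mol (σ N) u) x)
    linarith [key n hn, key m hm]
  choose v hv using fun x => cauchySeq_tendsto_of_complete (hc1 x)
  choose g hg using fun x => cauchySeq_tendsto_of_complete (hc2 x)
  have hgn : ∀ n x, ‖fderiv ℝ (mol (σ n) u) x - g x‖ ≤ B * C * σ n := fun n x => by
    refine le_of_tendsto (tendsto_const_nhds.sub (hg x)).norm ?_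
    filter_upwards [eventually_ge_atTop n] with m hm
    refine (hfd _ _ (hσ0 m) (hσa hm) x).trans ?_
    exact mul_le_mul_of_nonneg_left (by linarith [hσ0 m]) (mul_nonneg hB hC.le)
  have hgu : TendstoUniformly (fun n => fderiv ℝ (mol (σ n) u)) g atTop := by
    rw [Metric.tendstoUniformly_iff]
    intro ε hε
    have : Tendsto (fun n => B * C * σ n) atTop (𝓝 0) := by simpa using hσt.const_mul (B * C)
    filter_upwards [this.eventually (gt_mem_nhds hε)] with n hn x
    rw [dist_comm, dist_eq_norm]
    exact (hgn n x).trans_lt hn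
  have hvd : ∀ x, HasFDerivAt v (g x) x := fun x =>
    hasFDerivAt_of_tendstoUniformly hgu
      (fun n x => (hdiff _ (hσ0 n) x).hasFDerivAt) hv x
  have hgc : Continuous g := hgu.continuous (Frequently.of_forall fun n =>
    (contDiff_mol hu (hσ0 n)).continuous_fderiv (by norm_num))
  have hfv : fderiv ℝ v = g := funext fun x => (hvd x).fderiv
  refine ⟨v, ?_, ?_, fun x => ?_⟩
  · filter_upwards [ae_tendsto_mol hu] with x hx
    exact tendsto_nhds_unique (hx.comp hσt') (hv x)
  · rw [contDiff_one_iff_fderiv, hfv]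
    exact ⟨fun x => (hvd x).differentiableAt, hgc⟩
  · have h1 : |v x| ≤ B := by
      refine le_of_tendsto (hv x).abs (Eventually.of_forall fun n => ?_)
      refine (abs_integral_mul_le huB (integrable_rho_sub (hσ0 n) x)).trans ?_
      simp only [abs_of_nonneg (rho_nonneg _), integral_rho_sub (hσ0 n), mul_one, le_refl]
    have h2 : ‖g x‖ ≤ B * C + B * C := by
      have e0 : σ 0 = 1 := by simp [hσ]
      have := hgn 0 x
      rw [e0, mul_one, norm_sub_rev] at this
      have h3 := norm_le_norm_sub_add (g x) (fderiv ℝ (mol 1 u) x)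
      linarith [hfd1 x]
    rw [hfv]
    linarith

lemma IsTrapPotential.exists_pow_bound {V : R2 → ℝ} (hV : IsTrapPotential V) :
    ∃ (C : ℝ) (k : ℕ), 0 ≤ C ∧ ∀ x, V x ≤ C * (1 + ‖x‖) ^ k := by
  obtain ⟨C, m, h⟩ := hV.polyBdd
  refine ⟨|C|, ⌈m⌉₊, abs_nonneg _, fun x => (h x).trans ?_⟩
  have h1 : 1 ≤ 1 + ‖x‖ := by linarith [norm_nonneg x]
  refine mul_le_mul (le_abs_self C) ?_ (by positivity) (abs_nonneg _)
  rw [← Real.rpow_natCast]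
  exact Real.rpow_le_rpow_of_exponent_le h1 (Nat.le_ceil m)

lemma IsTrapPotential.exists_radius {V : R2 → ℝ} (hV : IsTrapPotential V) (L : ℝ) :
    ∃ R : ℝ, 0 ≤ R ∧ ∀ x, R ≤ ‖x‖ → L ≤ V x := by
  have h := hV.tendsto_top.eventually_ge_atTop L
  rw [← Metric.cobounded_eq_cocompact,
    (Metric.hasBasis_cobounded_compl_closedBall (0 : R2)).eventually_iff] at h
  obtain ⟨r, -, hr⟩ := h
  refine ⟨max r 0 + 1, by positivity, fun x hx => hr ?_⟩
  simp only [mem_compl_iff, Metric.mem_closedBall, dist_zero_right, not_le]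
  linarith [le_max_left r 0]

lemma IsTrapPotential.locallyIntegrable_mul {V : R2 → ℝ} (hV : IsTrapPotential V) {u : R2 → ℝ}
    (hu : LocallyIntegrable u) : LocallyIntegrable fun y => V y * u y := by
  rw [locallyIntegrable_iff]
  intro K hK
  obtain ⟨R, hR⟩ := hK.isBounded.subset_closedBall (0 : R2)
  obtain ⟨C, hC⟩ := hV.locBdd R
  refine (hu.integrableOn_isCompact hK).bdd_mul (c := C) hV.meas.aestronglyMeasurable ?_
  filter_upwards [ae_restrict_mem hK.measurableSet] with x hx
  rw [Real.norm_of_nonneg (hV.nonneg x)]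
  exact hC x (by simpa using hR hx)

/-- Nonnegative normalized functions solving, in mollified form, the Gross-Pitaevskii equation
`-Δφ + Vφ + 2pφ³ = μφ`. -/
structure MollifiedGP (V : R2 → ℝ) (p μ : ℝ) (φ : R2 → ℝ) : Prop where
  meas : Measurable φ
  nonneg : ∀ x, 0 ≤ φ x
  norm_eq : ∫⁻ x, ENNReal.ofReal (φ x ^ 2) = 1
  cube : LocallyIntegrable fun y => p * φ y ^ 3
  eqn : ∀ s, 0 < s → ∀ x, HasDerivAt (fun s => mol s φ x)
    (s * ∫ y, (V y * φ y + 2 * (p * φ y ^ 3) - μ * φ y) * pot s (x - y)) s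

namespace MollifiedGP

variable {V : R2 → ℝ} {p μ : ℝ} {φ : R2 → ℝ}

lemma memLp (h : MollifiedGP V p μ φ) : MemLp φ 2 :=
  memLp_two_of_lintegral_ne_top h.meas.aestronglyMeasurable (by simp [h.norm_eq])

lemma locInt (h : MollifiedGP V p μ φ) : LocallyIntegrable φ :=
  h.memLp.locallyIntegrable (by norm_num)

lemma integrable_sq (h : MollifiedGP V p μ φ) : Integrable fun y => φ y ^ 2 := h.memLp.integrable_sq

lemma integral_sq (h : MollifiedGP V p μ φ) : ∫ y, φ y ^ 2 = 1 := by
  rw [integral_eq_lintegral_of_nonneg_ae (ae_of_all _ fun y => sq_nonneg _)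
    (h.meas.pow_const 2).aestronglyMeasurable, h.norm_eq, ENNReal.toReal_one]

lemma locInt_rhs (h : MollifiedGP V p μ φ) (hV : IsTrapPotential V) :
    LocallyIntegrable fun y => V y * φ y + 2 * (p * φ y ^ 3) - μ * φ y :=
  ((hV.locallyIntegrable_mul h.locInt).add (h.cube.smul (2 : ℝ))).sub (h.locInt.smul μ)

lemma eqn_nonneg_part (h : MollifiedGP V p μ φ) (hV : IsTrapPotential V) (hp : 0 ≤ p) (y : R2) :
    0 ≤ V y * φ y + 2 * (p * φ y ^ 3) := by
  have := hV.nonneg y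
  have := h.nonneg y
  positivity

lemma exists_ae_bound : ∃ K : ℝ, 0 < K ∧ ∀ (V : R2 → ℝ) (p μ : ℝ) (φ : R2 → ℝ),
    IsTrapPotential V → 0 ≤ p → 0 ≤ μ → MollifiedGP V p μ φ → ∀ᵐ x, φ x ≤ K * (1 + μ) := by
  obtain ⟨C, hC, hk⟩ := exists_kernel_bound
  refine ⟨(1 + C) / 2, by positivity, fun V p μ φ hV hp hμ h => ?_⟩
  have hker : ∀ k : R2 → ℝ, Continuous k → HasCompactSupport k → (∀ z, 0 ≤ k z) → ∀ s, 0 < s →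
      (∀ z, k z ≤ C / s ^ 2) → (∀ z, k z ≤ rho s z) → ∀ x,
      s * ∫ y, φ y * k (x - y) ≤ (1 + C) / 2 := by
    intro k hkc hks hk0 s hs hkb hkr x
    have hi := integrable_mul_ker h.locInt hkc hks x
    rw [← integral_const_mul]
    calc ∫ y, s * (φ y * k (x - y)) ≤ ∫ y, (φ y ^ 2 / 2 + C * rho s (x - y) / 2) := by
          refine integral_mono (hi.const_mul s) ((h.integrable_sq.div_const 2).add
            (((integrable_rho_sub hs x).const_mul C).div_const 2)) fun y => ?_
          have h1 : s ^ 2 * k (x - y) ^ 2 ≤ C * rho s (x - y) := by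
            calc s ^ 2 * k (x - y) ^ 2 = (s ^ 2 * k (x - y)) * k (x - y) := by ring
              _ ≤ C * rho s (x - y) := by
                refine mul_le_mul ?_ (hkr _) (hk0 _) hC.le
                have := hkb (x - y)
                rwa [le_div_iff₀ (by positivity), mul_comm] at this
          simp only
          nlinarith [sq_nonneg (φ y - s * k (x - y))]
      _ = (1 + C) / 2 := by
          rw [integral_add (h.integrable_sq.div_const 2)
            (((integrable_rho_sub hs x).const_mul C).div_const 2), integral_div, integral_div,
            integral_const_mul, integral_rho_sub hs, h.integral_sq]
          ring
  filter_upwards [ae_tendsto_mol h.locInt] with x hx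
  refine le_of_tendsto hx ?_
  filter_upwards [Ioo_mem_nhdsGT (zero_lt_one' ℝ)] with s hs
  have h1 := hker (rho 1) (contDiff_rho 1).continuous (hasCompactSupport_rho one_pos)
    (fun z => rho_nonneg z) 1 one_pos (fun z => (le_abs_self _).trans (hk 1 one_pos z z).1)
    (fun z => le_rfl) x
  have h2 := mul_sub_le_of_hasDerivAt (m := -(μ * ((1 + C) / 2))) hs.2.le
    (fun t ht => h.eqn t (hs.1.trans_le ht.1) x) fun t ht => ?_
  · simp only [one_mul] at h1
    change mol 1 φ x ≤ _ at h1
    have : μ * ((1 + C) / 2) * (1 - s) ≤ μ * ((1 + C) / 2) :=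
      mul_le_of_le_one_right (by positivity) (by linarith [hs.1])
    linarith
  · have ht0 : 0 < t := hs.1.trans_le ht.1
    have h3 := hker (pot t) (contDiff_pot t).continuous (hasCompactSupport_pot ht0)
      (fun z => pot_nonneg z) t ht0 (fun z => (le_abs_self _).trans (hk t ht0 z z).2.1)
      (fun z => pot_le_rho z) x
    have h4 : -(μ * ∫ y, φ y * pot t (x - y)) ≤
        ∫ y, (V y * φ y + 2 * (p * φ y ^ 3) - μ * φ y) * pot t (x - y) := by
      rw [← integral_const_mul, ← integral_neg]
      refine integral_mono ((integrable_mul_pot h.locInt ht0 x).const_mul μ).neg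
        (integrable_mul_pot (h.locInt_rhs hV) ht0 x) fun y => ?_
      have := mul_nonneg (h.eqn_nonneg_part hV hp y) (pot_nonneg (s := t) (x - y))
      simp only
      linarith
    have h5 := mul_le_mul_of_nonneg_left h4 ht0.le
    have h6 := mul_le_mul_of_nonneg_left h3 hμ
    linarith

lemma exists_ae_decay {V : R2 → ℝ} (hV : IsTrapPotential V) (M : ℝ) (hM : 0 ≤ M) :
    ∃ B R θ : ℝ, 0 < B ∧ 0 ≤ R ∧ 0 ≤ θ ∧ θ < 1 ∧ ∀ (p μ : ℝ) (φ : R2 → ℝ), 0 ≤ p → 0 ≤ μ → μ ≤ M →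
      MollifiedGP V p μ φ → ∀ n : ℕ, ∀ᵐ x, R + n ≤ ‖x‖ ∨ n = 0 → φ x ≤ B * θ ^ n := by
  obtain ⟨K, hK, hb⟩ := exists_ae_bound
  obtain ⟨R, hR, hVR⟩ := hV.exists_radius (M + 1)
  obtain ⟨c, hc, hcp⟩ := exists_rho_half_le_pot
  refine ⟨K * (1 + M), R, (1 + c / 2)⁻¹, by positivity, hR, by positivity,
    inv_lt_one_of_one_lt₀ (by linarith), fun p μ φ hp hμ hμM h n => ?_⟩
  have hc2 : 0 < 1 + c / 2 := by linarith
  induction n with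
  | zero =>
    filter_upwards [hb V p μ φ hV hp hμ h] with x hx _
    rw [pow_zero, mul_one]
    exact hx.trans (by gcongr)
  | succ n ih =>
    filter_upwards [ae_tendsto_mol h.locInt] with x hx hxR
    have hxR : R + n + 1 ≤ ‖x‖ := by
      rcases hxR with hxR | hxR
      · push_cast at hxR; linarith
      · exact absurd hxR (Nat.succ_ne_zero n)
    have hge : ∀ y : R2, ‖x - y‖ < 1 → R + n ≤ ‖y‖ := fun y hy => by
      have := norm_sub_norm_le x y; linarith
    have hge' : ∀ y : R2, ‖x - y‖ < 1 → R ≤ ‖y‖ := fun y hy =>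
      (le_add_of_nonneg_right n.cast_nonneg).trans (hge y hy)
    have hlow : ∀ s, 0 < s → s ≤ 1 → c * mol (s / 2) φ x ≤
        ∫ y, (V y * φ y + 2 * (p * φ y ^ 3) - μ * φ y) * pot s (x - y) := by
      intro s hs hs1
      unfold mol
      rw [← integral_const_mul]
      refine integral_mono ((integrable_mul_rho h.locInt (half_pos hs) x).const_mul c)
        (integrable_mul_pot (h.locInt_rhs hV) hs x) fun y => ?_
      simp only
      have h1 : c * (φ y * rho (s / 2) (x - y)) ≤ φ y * pot s (x - y) := by
        have := mul_le_mul_of_nonneg_left (hcp s hs (x - y)) (h.nonneg y)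
        linarith
      refine h1.trans ?_
      by_cases hy : s ≤ ‖x - y‖
      · simp [pot_eq_zero hs hy]
      · refine mul_le_mul_of_nonneg_right ?_ (pot_nonneg _)
        have h2 := hVR y (hge' y (by linarith))
        have h3 : 0 ≤ (V y - μ - 1) * φ y := mul_nonneg (by linarith) (h.nonneg y)
        have h4 : 0 ≤ p * φ y ^ 3 := mul_nonneg hp (pow_nonneg (h.nonneg y) 3)
        linarith
    have hmono : ∀ s t, 0 < s → s ≤ t → t ≤ 1 → mol s φ x ≤ mol t φ x := by
      intro s t hs hst ht
      have := mul_sub_le_of_hasDerivAt (m := 0) hst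
        (fun r hr => h.eqn r (hs.trans_le hr.1) x) fun r hr => ?_
      · simp only [zero_mul] at this; linarith
      · have hr0 := hs.trans_le hr.1
        exact mul_nonneg hr0.le (le_trans (mul_nonneg hc.le (mol_nonneg h.nonneg _ _))
          (hlow r hr0 (hr.2.trans ht)))
    have hle : ∀ t, 0 < t → t ≤ 1 → φ x ≤ mol t φ x := by
      intro t ht ht1
      refine le_of_tendsto hx ?_
      filter_upwards [Ioo_mem_nhdsGT ht] with s hs
      exact hmono s t hs.1 hs.2.le ht1
    have hgain : ∀ s, 0 < s → s ≤ 1 → mol s φ x + c * φ x / 2 * (1 - s ^ 2) ≤ mol 1 φ x := by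
      intro s hs hs1
      have := mul_sub_le_of_hasDerivAt (m := 0) (f := fun r => mol r φ x - c * φ x / 2 * r ^ 2) hs1
        (fun r hr => (h.eqn r (hs.trans_le hr.1) x).sub
          (((hasDerivAt_pow 2 r).const_mul (c * φ x / 2)))) fun r hr => ?_
      · simp only [zero_mul] at this; linarith
      · have hr0 := hs.trans_le hr.1
        have h1 := hlow r hr0 hr.2
        have h2 := hle (r / 2) (half_pos hr0) (by linarith [hr.2])
        have h3 := mul_le_mul_of_nonneg_left (h1.trans' (mul_le_mul_of_nonneg_left h2 hc.le)) hr0.le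
        norm_num
        linarith
    have hfin : φ x * (1 + c / 2) ≤ mol 1 φ x := by
      have ht : Tendsto (fun s : ℝ => mol s φ x + c * φ x / 2 * (1 - s ^ 2)) (𝓝[>] 0)
          (𝓝 (φ x + c * φ x / 2 * (1 - 0 ^ 2))) := by
        refine hx.add (Tendsto.mono_left ?_ nhdsWithin_le_nhds)
        exact (Continuous.tendsto (by fun_prop) 0)
      have := le_of_tendsto ht (b := mol 1 φ x) (by
        filter_upwards [Ioo_mem_nhdsGT (zero_lt_one' ℝ)] with s hs
        exact hgain s hs.1 hs.2.le)
      linarith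
    have hup : mol 1 φ x ≤ K * (1 + M) * (1 + c / 2)⁻¹ ^ n := by
      have : ∫ y, K * (1 + M) * (1 + c / 2)⁻¹ ^ n * rho 1 (x - y) =
          K * (1 + M) * (1 + c / 2)⁻¹ ^ n := by
        rw [integral_const_mul, integral_rho_sub one_pos, mul_one]
      rw [← this]
      refine integral_mono_ae (integrable_mul_rho h.locInt one_pos x)
        ((integrable_rho_sub one_pos x).const_mul _) ?_
      filter_upwards [ih] with y hy
      by_cases hy1 : 1 ≤ ‖x - y‖
      · simp [rho_eq_zero one_pos hy1]
      · exact mul_le_mul_of_nonneg_right (hy (Or.inl (hge y (not_le.1 hy1)))) (rho_nonneg _)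
    rw [pow_succ, ← mul_assoc]
    exact (le_mul_inv_iff₀ hc2).2 (hfin.trans hup)

lemma exists_pow_mul_bound (a : ℝ) (ha : 0 ≤ a) (k : ℕ) {θ : ℝ} (h0 : 0 ≤ θ) (h1 : θ < 1) :
    ∃ D : ℝ, ∀ n : ℕ, (a + n) ^ k * θ ^ n ≤ D := by
  obtain ⟨m, hm⟩ := exists_nat_ge a
  have ht : Tendsto (fun n : ℕ => (a + n) ^ k * θ ^ n) atTop (𝓝 0) := by
    have h2 := (tendsto_pow_const_mul_const_pow_of_lt_one k h0 h1).const_mul ((a + 1) ^ k)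
    rw [mul_zero] at h2
    refine squeeze_zero' (Eventually.of_forall fun n => by positivity) ?_ h2
    filter_upwards [eventually_ge_atTop 1] with n hn
    rw [← mul_assoc, ← mul_pow]
    refine mul_le_mul_of_nonneg_right (pow_le_pow_left₀ (by positivity) ?_ k) (by positivity)
    have : (1 : ℝ) ≤ n := by exact_mod_cast hn
    nlinarith
  obtain ⟨D, hD⟩ := ht.bddAbove_range
  exact ⟨D, fun n => hD (mem_range_self n)⟩

lemma exists_ae_rhs_bound {V : R2 → ℝ} (hV : IsTrapPotential V) (P M : ℝ) (hP : 0 ≤ P)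
    (hM : 0 ≤ M) : ∃ B : ℝ, 0 ≤ B ∧ ∀ (p μ : ℝ) (φ : R2 → ℝ), 0 ≤ p → p ≤ P → 0 ≤ μ → μ ≤ M →
      MollifiedGP V p μ φ → ∀ᵐ x, |φ x| ≤ B ∧
        |V x * φ x + 2 * (p * φ x ^ 3) - μ * φ x| ≤ B := by
  obtain ⟨B, R, θ, hB, hR, hθ0, hθ1, h⟩ := exists_ae_decay hV M hM
  obtain ⟨C, k, hC, hVk⟩ := hV.exists_pow_bound
  obtain ⟨D, hD⟩ := exists_pow_mul_bound (R + 2) (by linarith) k hθ0 hθ1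
  have hD0 : 0 ≤ D := le_trans (by positivity) (hD 0)
  refine ⟨B + (C * B * D + 2 * P * B ^ 3 + M * B), by positivity,
    fun p μ φ hp hpP hμ hμM hφ => ?_⟩
  filter_upwards [ae_all_iff.2 (h p μ φ hp hμ hμM hφ)] with x hx
  have hx0 : φ x ≤ B := by simpa using hx 0 (Or.inr rfl)
  have hn := hφ.nonneg x
  have hVx := hV.nonneg x
  have h1 : V x * φ x ≤ C * B * D := by
    set n := ⌊‖x‖ - R⌋₊ with hn
    have h2 : φ x ≤ B * θ ^ n := by
      by_cases hn0 : n = 0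
      · exact hx n (Or.inr hn0)
      · refine hx n (Or.inl ?_)
        have := Nat.floor_le (a := ‖x‖ - R) (by
          by_contra hneg
          exact hn0 (Nat.floor_of_nonpos (not_le.1 hneg).le))
        linarith
    have h3 : V x ≤ C * (R + 2 + n) ^ k := by
      refine (hVk x).trans (mul_le_mul_of_nonneg_left (pow_le_pow_left₀ (by positivity) ?_ k) hC)
      have := Nat.lt_floor_add_one (‖x‖ - R)
      linarith
    calc V x * φ x ≤ (C * (R + 2 + n) ^ k) * (B * θ ^ n) :=
          mul_le_mul h3 h2 (hφ.nonneg x) (by positivity)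
      _ = C * B * ((R + 2 + n) ^ k * θ ^ n) := by ring
      _ ≤ C * B * D := mul_le_mul_of_nonneg_left (hD n) (by positivity)
  have h2 : p * φ x ^ 3 ≤ P * B ^ 3 := by gcongr
  have h3 : μ * φ x ≤ M * B := by gcongr
  have e1 : 0 ≤ V x * φ x := by positivity
  have e2 : 0 ≤ p * φ x ^ 3 := by positivity
  have e3 : 0 ≤ μ * φ x := by positivity
  have e4 : 0 ≤ C * B * D := by positivity
  have e5 : 0 ≤ P * B ^ 3 := by positivity
  have e6 : 0 ≤ M * B := by positivity
  rw [abs_of_nonneg hn, abs_le]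
  refine ⟨by linarith, by linarith, by linarith⟩

lemma pos_of_continuous (hV : IsTrapPotential V) (hp : 0 ≤ p) (hμ : 0 ≤ μ)
    (h : MollifiedGP V p μ φ) {v : R2 → ℝ} (hv : Continuous v) (hvφ : φ =ᵐ[volume] v) {B : ℝ}
    (hB : ∀ᵐ x, φ x ≤ B) (x : R2) : 0 < v x := by
  have hv0 : ∀ x, 0 ≤ v x := by
    intro x
    refine ge_of_tendsto (tendsto_mol_of_continuous hv x) (Eventually.of_forall fun s => ?_)
    rw [← mol_congr hvφ]
    exact mol_nonneg h.nonneg s x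
  refine (hv0 x).lt_of_ne fun hx0 => ?_
  have hB0 : 0 ≤ B := by
    obtain ⟨y, hy⟩ := hB.exists
    exact (h.nonneg y).trans hy
  have hzero : ∀ S : ℝ, 0 < S → ∀ᵐ y, ‖x - y‖ < S → φ y = 0 := by
    intro S hS
    obtain ⟨C, hC⟩ := hV.locBdd (‖x‖ + S)
    have hC0 : 0 ≤ C := (hV.nonneg x).trans (hC x (by linarith))
    set m := C + 2 * (p * B ^ 2) with hm
    have hm0 : 0 ≤ m := by positivity
    have hder : ∀ s, 0 < s → s ≤ S →
        (∫ y, (V y * φ y + 2 * (p * φ y ^ 3) - μ * φ y) * pot s (x - y)) ≤ m * mol s φ x := by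
      intro s hs hsS
      unfold mol
      rw [← integral_const_mul]
      refine integral_mono_ae (integrable_mul_pot (h.locInt_rhs hV) hs x)
        ((integrable_mul_rho h.locInt hs x).const_mul m) ?_
      filter_upwards [hB] with y hy
      by_cases hys : s ≤ ‖x - y‖
      · simp [rho_eq_zero hs hys, pot_eq_zero hs hys]
      · have hn := h.nonneg y
        have h1 : V y ≤ C := hC y (by
          have := norm_sub_norm_le y x
          rw [norm_sub_rev] at this
          linarith)
        have h2 : V y * φ y + 2 * (p * φ y ^ 3) - μ * φ y ≤ m * φ y := by
          have h3 : φ y ^ 2 ≤ B ^ 2 := pow_le_pow_left₀ hn hy 2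
          have h4 : V y * φ y ≤ C * φ y := mul_le_mul_of_nonneg_right h1 hn
          have h5 : p * φ y ^ 3 ≤ p * B ^ 2 * φ y := by
            have := mul_le_mul_of_nonneg_left h3 (mul_nonneg hp hn)
            linarith
          have h6 := mul_nonneg hμ hn
          rw [hm]
          linarith
        calc _ ≤ m * φ y * pot s (x - y) := mul_le_mul_of_nonneg_right h2 (pot_nonneg _)
          _ ≤ m * φ y * rho s (x - y) :=
            mul_le_mul_of_nonneg_left (pot_le_rho _) (mul_nonneg hm0 hn)
          _ = _ := by ring
    have hgr : ∀ s, 0 < s → s ≤ S →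
        mol S φ x * rexp (-(m * S * S)) ≤ mol s φ x * rexp (-(m * S * s)) := by
      intro s hs hsS
      have := mul_sub_le_of_hasDerivAt (m := 0)
        (f := fun r => -(mol r φ x * rexp (-(m * S * r)))) hsS
        (fun r hr => ((h.eqn r (hs.trans_le hr.1) x).mul
          (((hasDerivAt_id r).const_mul (m * S)).neg.exp)).neg) fun r hr => ?_
      · simp only [zero_mul] at this; linarith
      · have hr0 := hs.trans_le hr.1
        have h1 := mul_le_mul_of_nonneg_left (hder r hr0 hr.2) hr0.le
        have h2 : r * (m * mol r φ x) ≤ S * (m * mol r φ x) :=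
          mul_le_mul_of_nonneg_right hr.2 (mul_nonneg hm0 (mol_nonneg h.nonneg _ _))
        have h3 := mul_nonneg (sub_nonneg.2 (h1.trans h2)) (exp_pos (-(m * S * r))).le
        simp only [Pi.neg_apply, id, mul_one]
        linarith
    have hS0 : mol S φ x = 0 := by
      refine le_antisymm ?_ (mol_nonneg h.nonneg _ _)
      have ht : Tendsto (fun s => mol s φ x * rexp (-(m * S * s))) (𝓝[>] 0)
          (𝓝 (v x * rexp (-(m * S * 0)))) := by
        simp only [mol_congr hvφ]
        refine (tendsto_mol_of_continuous hv x).mul (Tendsto.mono_left ?_ nhdsWithin_le_nhds)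
        exact (Continuous.tendsto (by fun_prop) 0)
      have := ge_of_tendsto ht (b := mol S φ x * rexp (-(m * S * S))) (by
        filter_upwards [Ioo_mem_nhdsGT hS] with s hs
        exact hgr s hs.1 hs.2.le)
      rw [← hx0, zero_mul] at this
      exact nonpos_of_mul_nonpos_left this (exp_pos _)
    have h0 := (integral_eq_zero_iff_of_nonneg
      (fun y => mul_nonneg (h.nonneg y) (rho_nonneg (s := S) (x - y)))
      (integrable_mul_rho h.locInt hS x)).1 hS0
    filter_upwards [h0] with y hy hyS
    exact (mul_eq_zero.1 hy).resolve_right (rho_pos hS hyS).ne'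
  have hall : ∀ᵐ y, φ y = 0 := by
    filter_upwards [ae_all_iff.2 fun n : ℕ => hzero (n + 1) n.cast_add_one_pos] with y hy
    obtain ⟨n, hn⟩ := exists_nat_gt ‖x - y‖
    exact hy n (by linarith)
  have := h.norm_eq
  rw [lintegral_congr_ae (hall.mono fun y hy => by
    show _ = (0 : ℝ≥0∞)
    rw [hy]; simp)] at this
  simp at this

/-- Regularity, positivity and uniform bounds. -/
theorem exists_uniform_bound {V : R2 → ℝ} (hV : IsTrapPotential V) (P M : ℝ) (hP : 0 ≤ P)
    (hM : 0 ≤ M) : ∃ C : ℝ, ∀ (p μ : ℝ) (φ : R2 → ℝ), 0 ≤ p → p ≤ P → 0 ≤ μ → μ ≤ M →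
      MollifiedGP V p μ φ → ∃ v : R2 → ℝ, φ =ᵐ[volume] v ∧ ContDiff ℝ 1 v ∧ (∀ x, 0 < v x) ∧
        ∀ x, |v x| + ‖fderiv ℝ v x‖ ≤ C := by
  obtain ⟨B, hB, h⟩ := exists_ae_rhs_bound hV P M hP hM
  obtain ⟨C, hC, hreg⟩ := exists_contDiff_of_hasDerivAt_mol
  refine ⟨C * B, fun p μ φ hp hpP hμ hμM hφ => ?_⟩
  have hb := h p μ φ hp hpP hμ hμM hφ
  obtain ⟨v, hv1, hv2, hv3⟩ := hreg φ _ B hB hφ.locInt (hφ.locInt_rhs hV)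
    (hb.mono fun x hx => hx.1) (hb.mono fun x hx => hx.2) hφ.eqn
  exact ⟨v, hv1, hv2, hφ.pos_of_continuous hV hp hμ hv2.continuous hv1
    (hb.mono fun x hx => (le_abs_self _).trans hx.1), hv3⟩

end MollifiedGP

/-! ### Convexity of the functional in the density -/

lemma norm_sq_dual (L : R2 →L[ℝ] ℝ) :
    ‖L‖ ^ 2 = L (EuclideanSpace.single 0 1) ^ 2 + L (EuclideanSpace.single 1 1) ^ 2 := by
  obtain ⟨v, rfl⟩ := (InnerProductSpace.toDual ℝ R2).surjective L
  rw [LinearIsometryEquiv.norm_map, EuclideanSpace.norm_sq_eq, Fin.sum_univ_two]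
  simp [EuclideanSpace.inner_single_right]

/-- The square root of a convex combination of the densities `u²` and `v²`. -/
def mix (t : ℝ) (u v : R2 → ℝ) (x : R2) : ℝ := √((1 - t) * u x ^ 2 + t * v x ^ 2)

lemma mix_arg_pos {t : ℝ} (ht : 0 < t) (ht1 : t ≤ 1) (u : R2 → ℝ) {v : R2 → ℝ} (hv : ∀ x, 0 < v x)
    (x : R2) : 0 < (1 - t) * u x ^ 2 + t * v x ^ 2 :=
  add_pos_of_nonneg_of_pos (mul_nonneg (by linarith) (sq_nonneg _))
    (mul_pos ht (pow_pos (hv x) 2))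

lemma mix_pos {t : ℝ} (ht : 0 < t) (ht1 : t ≤ 1) (u : R2 → ℝ) {v : R2 → ℝ} (hv : ∀ x, 0 < v x)
    (x : R2) : 0 < mix t u v x :=
  Real.sqrt_pos.2 (mix_arg_pos ht ht1 u hv x)

lemma mix_sq {t : ℝ} (ht : 0 < t) (ht1 : t ≤ 1) (u : R2 → ℝ) {v : R2 → ℝ} (hv : ∀ x, 0 < v x)
    (x : R2) : mix t u v x ^ 2 = (1 - t) * u x ^ 2 + t * v x ^ 2 :=
  Real.sq_sqrt (mix_arg_pos ht ht1 u hv x).le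

lemma contDiff_mix {t : ℝ} (ht : 0 < t) (ht1 : t ≤ 1) {u v : R2 → ℝ} (hv : ∀ x, 0 < v x)
    (hu : ContDiff ℝ 1 u) (hvc : ContDiff ℝ 1 v) : ContDiff ℝ 1 (mix t u v) :=
  ContDiff.sqrt (by fun_prop) fun x => (mix_arg_pos ht ht1 u hv x).ne'

lemma norm_sq_fderiv_mix {t : ℝ} (ht : 0 < t) (ht1 : t ≤ 1) {u v : R2 → ℝ} (hv : ∀ x, 0 < v x)
    (hu : ContDiff ℝ 1 u) (hvc : ContDiff ℝ 1 v) (x : R2) :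
    ‖fderiv ℝ (mix t u v) x‖ ^ 2 + t * (1 - t) * (‖u x • fderiv ℝ v x - v x • fderiv ℝ u x‖ ^ 2 /
      mix t u v x ^ 2) = (1 - t) * ‖fderiv ℝ u x‖ ^ 2 + t * ‖fderiv ℝ v x‖ ^ 2 := by
  have hw := mix_pos ht ht1 u hv x
  have hdu := (hu.differentiable one_ne_zero x).hasFDerivAt
  have hdv := (hvc.differentiable one_ne_zero x).hasFDerivAt
  have hdw := ((contDiff_mix ht ht1 hv hu hvc).differentiable one_ne_zero x).hasFDerivAt
  have h1 : HasFDerivAt (fun y => mix t u v y ^ 2) ((2 * mix t u v x) • fderiv ℝ (mix t u v) x) x :=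
    (hdw.pow 2).congr_fderiv (by simp)
  have h2 : HasFDerivAt (fun y => mix t u v y ^ 2)
      ((1 - t) • ((2 * u x) • fderiv ℝ u x) + t • ((2 * v x) • fderiv ℝ v x)) x := by
    simp only [mix_sq ht ht1 u hv]
    exact (((hdu.pow 2).const_mul (1 - t)).add ((hdv.pow 2).const_mul t)).congr_fderiv (by simp)
  have h3 := h1.unique h2
  have h4 : ∀ z, fderiv ℝ (mix t u v) x z =
      ((1 - t) * (u x * fderiv ℝ u x z) + t * (v x * fderiv ℝ v x z)) / mix t u v x := by
    intro z
    have := congrArg (fun L : R2 →L[ℝ] ℝ => L z) h3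
    simp at this
    rw [eq_div_iff hw.ne']
    linarith
  simp only [norm_sq_dual, h4, sub_apply, smul_apply, smul_eq_mul]
  have h5 := mix_sq ht ht1 u hv x
  generalize fderiv ℝ u x (EuclideanSpace.single 0 1) = a0
  generalize fderiv ℝ u x (EuclideanSpace.single 1 1) = a1
  generalize fderiv ℝ v x (EuclideanSpace.single 0 1) = b0
  generalize fderiv ℝ v x (EuclideanSpace.single 1 1) = b1
  have key : ∀ a b : ℝ, ((1 - t) * (u x * a) + t * (v x * b)) ^ 2 +
      t * (1 - t) * (u x * b - v x * a) ^ 2 = ((1 - t) * a ^ 2 + t * b ^ 2) * mix t u v x ^ 2 := by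
    intro a b
    rw [h5]; ring
  have hw2 : mix t u v x ^ 2 ≠ 0 := (pow_pos hw 2).ne'
  rw [div_pow, div_pow, mul_div_assoc', ← add_div, ← add_div, div_eq_iff hw2]
  linear_combination key a0 b0 + key a1 b1

lemma mix_pow_four_le {t : ℝ} (ht : 0 < t) (ht1 : t ≤ 1) (u : R2 → ℝ) {v : R2 → ℝ}
    (hv : ∀ x, 0 < v x) (x : R2) : mix t u v x ^ 4 ≤ (1 - t) * u x ^ 4 + t * v x ^ 4 := by
  have e : mix t u v x ^ 4 = (mix t u v x ^ 2) ^ 2 := by ring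
  rw [e, mix_sq ht ht1 u hv]
  have := mul_nonneg (mul_nonneg ht.le (sub_nonneg.2 ht1)) (sq_nonneg (u x ^ 2 - v x ^ 2))
  linarith

lemma measurable_density {V : R2 → ℝ} (hV : IsTrapPotential V) (p : ℝ) {u : R2 → ℝ}
    (hu : ContDiff ℝ 1 u) : Measurable fun x => ‖fderiv ℝ u x‖ ^ 2 + V x * u x ^ 2 + p * u x ^ 4 := by
  have h1 := (hu.continuous_fderiv one_ne_zero).measurable
  have h2 := hu.continuous.measurable
  have h3 := hV.meas
  fun_prop

lemma adm2_mix {t : ℝ} (ht : 0 < t) (ht1 : t ≤ 1) {u v : R2 → ℝ} (hv : ∀ x, 0 < v x)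
    (hu : adm2 u) (hva : adm2 v) : adm2 (mix t u v) := by
  refine ⟨contDiff_mix ht ht1 hv hu.1 hva.1, ?_⟩
  have hmu := hu.1.continuous.measurable
  have hmv := hva.1.continuous.measurable
  simp only [mix_sq ht ht1 u hv]
  have e : ∀ x, ENNReal.ofReal ((1 - t) * u x ^ 2 + t * v x ^ 2) =
      ENNReal.ofReal (1 - t) * ENNReal.ofReal (u x ^ 2) + ENNReal.ofReal t * ENNReal.ofReal (v x ^ 2) :=
    fun x => by
      rw [ENNReal.ofReal_add (mul_nonneg (by linarith) (sq_nonneg _))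
        (mul_nonneg ht.le (sq_nonneg _)), ENNReal.ofReal_mul (by linarith), ENNReal.ofReal_mul ht.le]
  simp only [e]
  rw [lintegral_add_left (by fun_prop), lintegral_const_mul _ (by fun_prop),
    lintegral_const_mul _ (by fun_prop), hu.2, hva.2, mul_one, mul_one,
    ← ENNReal.ofReal_add (by linarith) ht.le]
  simp

lemma Eaux_mix_add_le {V : R2 → ℝ} (hV : IsTrapPotential V) {p : ℝ} (hp : 0 ≤ p) {t : ℝ}
    (ht : 0 < t) (ht1 : t ≤ 1) {u v : R2 → ℝ} (hv : ∀ x, 0 < v x) (hu : ContDiff ℝ 1 u)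
    (hvc : ContDiff ℝ 1 v) :
    Eaux V p (mix t u v) + ∫⁻ x, ENNReal.ofReal (t * (1 - t) *
      (‖u x • fderiv ℝ v x - v x • fderiv ℝ u x‖ ^ 2 / mix t u v x ^ 2)) ≤
    ENNReal.ofReal (1 - t) * Eaux V p u + ENNReal.ofReal t * Eaux V p v := by
  have hm := contDiff_mix ht ht1 hv hu hvc
  unfold Eaux
  rw [← lintegral_add_left (measurable_density hV p hm).ennreal_ofReal,
    ← lintegral_const_mul _ (measurable_density hV p hu).ennreal_ofReal,
    ← lintegral_const_mul _ (measurable_density hV p hvc).ennreal_ofReal,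
    ← lintegral_add_left ((measurable_density hV p hu).ennreal_ofReal.const_mul _)]
  refine lintegral_mono fun x => ?_
  have hd : ∀ f : R2 → ℝ, 0 ≤ ‖fderiv ℝ f x‖ ^ 2 + V x * f x ^ 2 + p * f x ^ 4 := fun f => by
    have := hV.nonneg x
    positivity
  have ht1' : 0 ≤ 1 - t := by linarith
  rw [← ENNReal.ofReal_add (hd _) (by positivity), ← ENNReal.ofReal_mul ht1',
    ← ENNReal.ofReal_mul ht.le, ← ENNReal.ofReal_add (mul_nonneg ht1' (hd _))
      (mul_nonneg ht.le (hd _))]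
  refine ENNReal.ofReal_le_ofReal ?_
  have h1 := norm_sq_fderiv_mix ht ht1 hv hu hvc x
  have h2 := mul_le_mul_of_nonneg_left (mix_pow_four_le ht ht1 u hv x) hp
  have h3 := mix_sq ht ht1 u hv x
  linear_combination h1 + h2 + V x * h3

lemma EauxInf_le {V : R2 → ℝ} {p : ℝ} {u : R2 → ℝ} (hu : adm2 u) : EauxInf V p ≤ Eaux V p u :=
  sInf_le ⟨u, hu, rfl⟩

/-- A positive minimizer is unique up to sign. -/
lemma eq_or_eq_neg_of_minimizer {V : R2 → ℝ} (hV : IsTrapPotential V) {p : ℝ} (hp : 0 ≤ p)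
    {φ ψ : R2 → ℝ} (hφ : adm2 φ) (hpos : ∀ x, 0 < φ x) (hmin : Eaux V p φ = EauxInf V p)
    (hfin : EauxInf V p ≠ ⊤) (hψ : adm2 ψ) (hψmin : Eaux V p ψ = EauxInf V p) :
    ψ = φ ∨ ψ = fun x => -(φ x) := by
  have hh : (0 : ℝ) < 1 / 2 := by norm_num
  have hh1 : (1 / 2 : ℝ) ≤ 1 := by norm_num
  have h1 := Eaux_mix_add_le hV hp hh hh1 hpos hψ.1 hφ.1
  have h2 := EauxInf_le (V := V) (p := p) (adm2_mix hh hh1 hpos hψ hφ)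
  rw [hmin, hψmin, ← add_mul, ← ENNReal.ofReal_add (by norm_num) (by norm_num),
    sub_add_cancel, ENNReal.ofReal_one, one_mul] at h1
  have h0 := (add_le_add_left h2 _).trans h1
  nth_rewrite 2 [← add_zero (EauxInf V p)] at h0
  have hz := nonpos_iff_eq_zero.1 ((ENNReal.add_le_add_iff_left hfin).1 h0)
  have hw := mix_pos hh hh1 ψ hpos
  have hmc := (contDiff_mix hh hh1 hpos hψ.1 hφ.1).continuous
  have hcψ := hψ.1.continuous_fderiv one_ne_zero
  have hcφ := hφ.1.continuous_fderiv one_ne_zero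
  have hcψ0 := hψ.1.continuous
  have hcφ0 := hφ.1.continuous
  have hc : Continuous fun x => ENNReal.ofReal (1 / 2 * (1 - 1 / 2) *
      (‖ψ x • fderiv ℝ φ x - φ x • fderiv ℝ ψ x‖ ^ 2 / mix (1 / 2) ψ φ x ^ 2)) := by
    refine ENNReal.continuous_ofReal.comp (continuous_const.mul (Continuous.div ?_ (hmc.pow 2)
      fun x => (pow_pos (hw x) 2).ne'))
    fun_prop
  rw [lintegral_eq_zero_iff hc.measurable] at hz
  have hz' := (hc.ae_eq_iff_eq volume continuous_zero).1 hz
  have hd0 : ∀ x, ψ x • fderiv ℝ φ x - φ x • fderiv ℝ ψ x = 0 := by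
    intro x
    have h3 := congrFun hz' x
    simp only [Pi.zero_apply, ENNReal.ofReal_eq_zero] at h3
    by_contra hne
    have := norm_pos_iff.2 hne
    have := hw x
    have : 0 < 1 / 2 * (1 - 1 / 2) * (‖ψ x • fderiv ℝ φ x - φ x • fderiv ℝ ψ x‖ ^ 2 /
      mix (1 / 2) ψ φ x ^ 2) := mul_pos (by norm_num) (by positivity)
    linarith
  have hdφ : Differentiable ℝ φ := hφ.1.differentiable one_ne_zero
  have hdψ : Differentiable ℝ ψ := hψ.1.differentiable one_ne_zero
  have hq : ∀ x, HasFDerivAt (fun y => ψ y * (φ y)⁻¹) (0 : R2 →L[ℝ] ℝ) x := by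
    intro x
    have hi : HasFDerivAt (fun y => (φ y)⁻¹) ((-(φ x ^ 2)⁻¹) • fderiv ℝ φ x) x :=
      (hasDerivAt_inv (hpos x).ne').comp_hasFDerivAt x (hdφ x).hasFDerivAt
    refine ((hdψ x).hasFDerivAt.mul hi).congr_fderiv ?_
    ext z
    have h3 := congrArg (fun L : R2 →L[ℝ] ℝ => L z) (hd0 x)
    simp only [sub_apply, smul_apply, smul_eq_mul, zero_apply] at h3
    simp only [add_apply, smul_apply, smul_eq_mul, zero_apply]
    have := (hpos x).ne'
    field_simp
    linarith
  obtain ⟨c, hcc⟩ : ∃ c, ∀ x, ψ x = c * φ x := by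
    refine ⟨ψ 0 * (φ 0)⁻¹, fun x => ?_⟩
    have h3 := is_const_of_fderiv_eq_zero (fun y => (hq y).differentiableAt)
      (fun y => (hq y).fderiv) x 0
    rw [← h3, mul_assoc, inv_mul_cancel₀ (hpos x).ne', mul_one]
  have hc2 : ENNReal.ofReal (c ^ 2) = 1 := by
    have h3 := hψ.2
    simp only [hcc, mul_pow, ENNReal.ofReal_mul (sq_nonneg c)] at h3
    rw [lintegral_const_mul _ (by fun_prop), hφ.2, mul_one] at h3
    exact h3
  rw [ENNReal.ofReal_eq_one, sq_eq_one_iff] at hc2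
  rcases hc2 with rfl | rfl
  · exact Or.inl (funext fun x => by rw [hcc, one_mul])
  · exact Or.inr (funext fun x => by rw [hcc, neg_one_mul])

/-! ### Finiteness of the ground state energy -/

/-- Functions for which all the terms of the functional are finite. -/
structure FiniteEnergy (V : R2 → ℝ) (p : ℝ) (u : R2 → ℝ) : Prop where
  contDiff : ContDiff ℝ 1 u
  sq : Integrable fun x => u x ^ 2
  grad : Integrable fun x => ‖fderiv ℝ u x‖ ^ 2
  pot : Integrable fun x => V x * u x ^ 2
  quart : Integrable fun x => p * u x ^ 4

lemma lintegral_eq_one_iff {u : R2 → ℝ} (hu : Integrable fun x => u x ^ 2) :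
    (∫⁻ x, ENNReal.ofReal (u x ^ 2)) = 1 ↔ ∫ x, u x ^ 2 = 1 := by
  rw [← ofReal_integral_eq_lintegral_ofReal hu (ae_of_all _ fun x => sq_nonneg _),
    ENNReal.ofReal_eq_one]

lemma FiniteEnergy.Eaux_eq {V : R2 → ℝ} (hV : IsTrapPotential V) {p : ℝ} (hp : 0 ≤ p) {u : R2 → ℝ}
    (h : FiniteEnergy V p u) : Eaux V p u = ENNReal.ofReal
      ((∫ x, ‖fderiv ℝ u x‖ ^ 2) + (∫ x, V x * u x ^ 2) + ∫ x, p * u x ^ 4) := by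
  have h1 : Integrable fun x => ‖fderiv ℝ u x‖ ^ 2 + V x * u x ^ 2 := h.grad.add h.pot
  rw [← integral_add h.grad h.pot, ← integral_add h1 h.quart,
    ofReal_integral_eq_lintegral_ofReal
      (f := fun x => ‖fderiv ℝ u x‖ ^ 2 + V x * u x ^ 2 + p * u x ^ 4) (h1.add h.quart)]
  · rfl
  · refine ae_of_all _ fun x => ?_
    have := hV.nonneg x
    simp only [Pi.zero_apply]
    positivity

lemma finiteEnergy_of_Eaux_ne_top {V : R2 → ℝ} (hV : IsTrapPotential V) {p : ℝ} (hp : 0 ≤ p)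
    {u : R2 → ℝ} (hu : adm2 u) (hE : Eaux V p u ≠ ⊤) : FiniteEnergy V p u := by
  have hc := hu.1.continuous
  have hc' := hu.1.continuous_fderiv one_ne_zero
  have hm := hV.meas
  have key : ∀ f : R2 → ℝ, Measurable f → (∀ x, 0 ≤ f x) →
      (∀ x, f x ≤ ‖fderiv ℝ u x‖ ^ 2 + V x * u x ^ 2 + p * u x ^ 4) → Integrable f := by
    intro f hf h0 hle
    refine ⟨hf.aestronglyMeasurable, ?_⟩
    rw [hasFiniteIntegral_iff_ofReal (ae_of_all _ h0)]
    exact (lintegral_mono fun x => ENNReal.ofReal_le_ofReal (hle x)).trans_lt hE.lt_top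
  have h1 : ∀ x, 0 ≤ V x * u x ^ 2 := fun x => mul_nonneg (hV.nonneg x) (sq_nonneg _)
  have h2 : ∀ x, 0 ≤ p * u x ^ 4 := fun x => by positivity
  have h3 : ∀ x, 0 ≤ ‖fderiv ℝ u x‖ ^ 2 := fun x => sq_nonneg _
  refine ⟨hu.1, ?_, key _ (hc'.norm.pow 2).measurable h3 fun x => ?_,
    key _ (hm.mul (hc.pow 2).measurable) h1 fun x => ?_,
    key _ (continuous_const.mul (hc.pow 4)).measurable h2 fun x => ?_⟩
  · exact (memLp_two_of_lintegral_ne_top hc.aestronglyMeasurable (by simp [hu.2])).integrable_sq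
  all_goals linarith [h1 x, h2 x, h3 x]

lemma fderiv_const_mul_eq {u : R2 → ℝ} (hu : ContDiff ℝ 1 u) (c : ℝ) (x : R2) :
    fderiv ℝ (fun y => c * u y) x = c • fderiv ℝ u x :=
  fderiv_const_mul (hu.differentiable one_ne_zero x) c

lemma FiniteEnergy.const_mul {V : R2 → ℝ} {p : ℝ} {u : R2 → ℝ} (h : FiniteEnergy V p u) (c : ℝ) :
    FiniteEnergy V p fun x => c * u x := by
  refine ⟨contDiff_const.mul h.contDiff, ?_, ?_, ?_, ?_⟩
  · exact (h.sq.const_mul (c ^ 2)).congr (ae_of_all _ fun x => (mul_pow _ _ _).symm)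
  · refine (h.grad.const_mul (c ^ 2)).congr (ae_of_all _ fun x => ?_)
    simp only [fderiv_const_mul_eq h.contDiff, norm_smul, mul_pow, Real.norm_eq_abs, sq_abs]
  · exact (h.pot.const_mul (c ^ 2)).congr (ae_of_all _ fun x => by simp only; ring)
  · exact (h.quart.const_mul (c ^ 4)).congr (ae_of_all _ fun x => by simp only; ring)

lemma FiniteEnergy.adm2_normalize {V : R2 → ℝ} {p : ℝ} {u : R2 → ℝ} (h : FiniteEnergy V p u)
    (hm : 0 < ∫ x, u x ^ 2) : adm2 fun x => (√(∫ x, u x ^ 2))⁻¹ * u x := by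
  refine ⟨(h.const_mul _).contDiff, (lintegral_eq_one_iff (h.const_mul _).sq).2 ?_⟩
  simp only [mul_pow, inv_pow, Real.sq_sqrt hm.le]
  rw [integral_const_mul, inv_mul_cancel₀ hm.ne']

/-- The variational inequality for functions that are not normalized. -/
lemma FiniteEnergy.EauxInf_mul_le {V : R2 → ℝ} (hV : IsTrapPotential V) {p : ℝ} (hp : 0 ≤ p)
    {u : R2 → ℝ} (h : FiniteEnergy V p u) :
    (EauxInf V p).toReal * (∫ x, u x ^ 2) ^ 2 ≤
      (∫ x, u x ^ 2) * ((∫ x, ‖fderiv ℝ u x‖ ^ 2) + ∫ x, V x * u x ^ 2) + ∫ x, p * u x ^ 4 := by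
  have hD : 0 ≤ (∫ x, ‖fderiv ℝ u x‖ ^ 2) := integral_nonneg fun x => sq_nonneg _
  have hVu : 0 ≤ ∫ x, V x * u x ^ 2 :=
    integral_nonneg fun x => mul_nonneg (hV.nonneg x) (sq_nonneg _)
  have hQ : 0 ≤ ∫ x, p * u x ^ 4 := integral_nonneg fun x => by positivity
  have hm0 : 0 ≤ ∫ x, u x ^ 2 := integral_nonneg fun x => sq_nonneg _
  rcases hm0.eq_or_lt with hm | hm
  · simp only [← hm]
    simpa using hQ
  set m := ∫ x, u x ^ 2 with hmdef
  set c := (√m)⁻¹ with hc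
  have hc2 : c ^ 2 = m⁻¹ := by rw [hc, inv_pow, Real.sq_sqrt hm.le]
  have hc4 : c ^ 4 = (m ^ 2)⁻¹ := by
    rw [show c ^ 4 = (c ^ 2) ^ 2 by ring, hc2, inv_pow]
  have h1 := EauxInf_le (V := V) (p := p) (h.adm2_normalize hm)
  rw [(h.const_mul c).Eaux_eq hV hp] at h1
  have h2 := ENNReal.toReal_le_of_le_ofReal (by
    refine add_nonneg (add_nonneg (integral_nonneg fun x => sq_nonneg _)
      (integral_nonneg fun x => mul_nonneg (hV.nonneg x) (sq_nonneg _)))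
      (integral_nonneg fun x => by positivity)) h1
  have e1 : ∫ x, ‖fderiv ℝ (fun y => c * u y) x‖ ^ 2 = m⁻¹ * ∫ x, ‖fderiv ℝ u x‖ ^ 2 := by
    rw [← hc2, ← integral_const_mul]
    refine integral_congr_ae (ae_of_all _ fun x => ?_)
    simp only [fderiv_const_mul_eq h.contDiff, norm_smul, mul_pow, Real.norm_eq_abs, sq_abs]
  have e2 : ∫ x, V x * (c * u x) ^ 2 = m⁻¹ * ∫ x, V x * u x ^ 2 := by
    rw [← hc2, ← integral_const_mul]
    exact integral_congr_ae (ae_of_all _ fun x => by simp only; ring)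
  have e3 : ∫ x, p * (c * u x) ^ 4 = (m ^ 2)⁻¹ * ∫ x, p * u x ^ 4 := by
    rw [← hc4, ← integral_const_mul]
    exact integral_congr_ae (ae_of_all _ fun x => by simp only; ring)
  rw [e1, e2, e3] at h2
  have h3 := mul_le_mul_of_nonneg_right h2 (sq_nonneg m)
  refine h3.trans (le_of_eq ?_)
  field_simp

lemma exists_trial {V : R2 → ℝ} (hV : IsTrapPotential V) : ∃ g : R2 → ℝ, adm2 g ∧
    (∀ x, 0 < g x) ∧ ∀ p, 0 ≤ p → Eaux V p g ≠ ⊤ := by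
  obtain ⟨C, k, hC, hVk⟩ := hV.exists_pow_bound
  set q : R2 → ℝ := fun x => 1 + ‖x‖ ^ 2 with hq
  have hq1 : ∀ x, 1 ≤ q x := fun x => by simp only [hq]; linarith [sq_nonneg ‖x‖]
  have hq0 : ∀ x, 0 < q x := fun x => one_pos.trans_le (hq1 x)
  have hqc : ContDiff ℝ 1 q := contDiff_const.add (contDiff_norm_sq ℝ)
  set N := k + 2 with hN
  set h : R2 → ℝ := fun x => (q x ^ N)⁻¹ with hh
  have hhp : ∀ x, 0 < h x := fun x => inv_pos.2 (pow_pos (hq0 x) N)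
  have hhc : ContDiff ℝ 1 h := (hqc.pow N).inv fun x => (pow_pos (hq0 x) N).ne'
  have hint : Integrable fun x : R2 => (q x ^ 2)⁻¹ := by
    have h1 := integrable_rpow_neg_one_add_norm_sq (E := R2) (μ := volume) (r := 4) (by simp; norm_num)
    refine h1.congr (ae_of_all _ fun x => ?_)
    simp only [hq]
    rw [show (-4 / 2 : ℝ) = -(2 : ℕ) by norm_num, Real.rpow_neg (hq0 x).le, Real.rpow_natCast]
  have hle : ∀ x, h x ≤ (q x ^ 2)⁻¹ := fun x =>
    inv_anti₀ (pow_pos (hq0 x) 2) (pow_le_pow_right₀ (hq1 x) (by omega))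
  have hle1 : ∀ x, h x ≤ 1 := fun x => inv_le_one_of_one_le₀ (one_le_pow₀ (hq1 x))
  have hsq : ∀ x, h x ^ 2 ≤ (q x ^ 2)⁻¹ := fun x => by
    have := mul_le_mul (hle x) (hle1 x) (hhp x).le (by have := hq0 x; positivity)
    linarith
  have hsqi : Integrable fun x => h x ^ 2 :=
    hint.mono' (hhc.continuous.pow 2).aestronglyMeasurable (ae_of_all _ fun x => by
      rw [Real.norm_of_nonneg (sq_nonneg _)]; exact hsq x)
  have hVh : ∀ x, V x * h x ^ 2 ≤ C * 2 ^ k * (q x ^ 2)⁻¹ := by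
    intro x
    have h1 : V x ≤ C * (2 * q x) ^ k := by
      refine (hVk x).trans (mul_le_mul_of_nonneg_left (pow_le_pow_left₀ (by positivity) ?_ k) hC)
      simp only [hq]
      nlinarith [sq_nonneg (‖x‖ - 1)]
    have hqx := hq0 x
    calc V x * h x ^ 2 ≤ (C * (2 * q x) ^ k) * (h x * 1) :=
          mul_le_mul h1 (by rw [sq]; exact mul_le_mul_of_nonneg_left (hle1 x) (hhp x).le)
            (sq_nonneg _) (by positivity)
      _ = C * 2 ^ k * (q x ^ 2)⁻¹ := by
          simp only [hh, hN, pow_add, mul_pow]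
          field_simp
  have hD : ∀ x, ‖fderiv ℝ h x‖ ≤ N * h x := by
    intro x
    have hqx := hq0 x
    have h1 : HasFDerivAt q ((2 : ℝ) • innerSL ℝ x) x :=
      ((hasStrictFDerivAt_norm_sq x).hasFDerivAt.const_add 1).congr_fderiv (by
        ext z; simp)
    have h2 : HasFDerivAt h ((-((q x ^ N) ^ 2)⁻¹) • (((N : ℝ) * q x ^ (N - 1)) •
        ((2 : ℝ) • innerSL ℝ x))) x :=
      (hasDerivAt_inv (pow_pos (hq0 x) N).ne').comp_hasFDerivAt x
        ((h1.pow N).congr_fderiv (by simp))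
    have hc1 : 0 ≤ (N : ℝ) * q x ^ (N - 1) := by positivity
    have hc2 : 0 ≤ ((q x ^ N) ^ 2)⁻¹ := by positivity
    rw [h2.fderiv, norm_smul, norm_smul, norm_smul, innerSL_apply_norm, norm_neg,
      Real.norm_of_nonneg hc2, Real.norm_of_nonneg hc1, Real.norm_of_nonneg zero_le_two]
    have h3 : 2 * ‖x‖ ≤ q x := by simp only [hq]; nlinarith [sq_nonneg (‖x‖ - 1)]
    calc ((q x ^ N) ^ 2)⁻¹ * (N * q x ^ (N - 1) * (2 * ‖x‖))
        ≤ ((q x ^ N) ^ 2)⁻¹ * (N * q x ^ (N - 1) * q x) := by gcongr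
      _ = N * h x := by
        rw [mul_assoc (N : ℝ), ← pow_succ, show N - 1 + 1 = N by omega]
        simp only [hh]
        field_simp
  have hmass : 0 < ∫ x, h x ^ 2 := by
    rw [integral_pos_iff_support_of_nonneg (fun x => sq_nonneg _) hsqi]
    have : Function.support (fun x => h x ^ 2) = univ :=
      eq_univ_of_forall fun x => (pow_pos (hhp x) 2).ne'
    rw [this]
    exact isOpen_univ.measure_pos volume univ_nonempty
  have hfin : ∀ p, 0 ≤ p → FiniteEnergy V p h := by
    intro p hp
    refine ⟨hhc, hsqi, ?_, ?_, ?_⟩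
    · refine (hsqi.const_mul ((N : ℝ) ^ 2)).mono'
        ((hhc.continuous_fderiv one_ne_zero).norm.pow 2).aestronglyMeasurable
        (ae_of_all _ fun x => ?_)
      rw [Real.norm_of_nonneg (sq_nonneg _), ← mul_pow]
      exact pow_le_pow_left₀ (norm_nonneg _) (hD x) 2
    · refine (hint.const_mul (C * 2 ^ k)).mono'
        (hV.meas.mul (hhc.continuous.pow 2).measurable).aestronglyMeasurable
        (ae_of_all _ fun x => ?_)
      rw [Real.norm_of_nonneg (mul_nonneg (hV.nonneg x) (sq_nonneg _))]
      exact hVh x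
    · refine Integrable.const_mul (f := fun x => h x ^ 4) (hsqi.mono' (hhc.continuous.pow 4).aestronglyMeasurable
        (ae_of_all _ fun x => ?_)) p
      rw [Real.norm_of_nonneg (pow_nonneg (hhp x).le 4)]
      exact pow_le_pow_of_le_one (hhp x).le (hle1 x) (by norm_num)
  refine ⟨fun x => (√(∫ x, h x ^ 2))⁻¹ * h x, (hfin 0 le_rfl).adm2_normalize hmass,
    fun x => mul_pos (inv_pos.2 (Real.sqrt_pos.2 hmass)) (hhp x), fun p hp => ?_⟩
  rw [((hfin p hp).const_mul _).Eaux_eq hV hp]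
  exact ENNReal.ofReal_ne_top

/-! ### Compactness of sequences of bounded energy -/

lemma integral_inner_toLp {f g : R2 → ℝ} (hf : MemLp f 2) (hg : MemLp g 2) :
    inner ℝ (hf.toLp f) (hg.toLp g) = ∫ x, f x * g x := by
  rw [L2.inner_def]
  refine integral_congr_ae ?_
  filter_upwards [hf.coeFn_toLp, hg.coeFn_toLp] with x h1 h2
  rw [h1, h2]; simp [mul_comm]

lemma norm_toLp_sq {f : R2 → ℝ} (hf : MemLp f 2) : ‖hf.toLp f‖ ^ 2 = ∫ x, f x ^ 2 := by
  rw [← real_inner_self_eq_norm_sq, integral_inner_toLp]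
  simp only [sq]

lemma exists_weak_limit {φ : ℕ → R2 → ℝ} (hφ : ∀ n, MemLp (φ n) 2) (h1 : ∀ n, ∫ x, φ n x ^ 2 = 1) :
    ∃ (f : R2 → ℝ) (σ : ℕ → ℕ), Measurable f ∧ MemLp f 2 ∧ StrictMono σ ∧ ∀ h, MemLp h 2 →
      Tendsto (fun n => ∫ x, φ (σ n) x * h x) atTop (𝓝 (∫ x, f x * h x)) := by
  have : Fact ((2 : ℝ≥0∞) ≠ ⊤) := ⟨by simp⟩
  have hn : ∀ n, ‖(hφ n).toLp (φ n)‖ ≤ 1 := fun n => by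
    rw [← sq_le_one_iff₀ (norm_nonneg _), norm_toLp_sq, h1]
  obtain ⟨a, -, σ, hσ, ht⟩ := WeakDual.isSeqCompact_closedBall ℝ (Lp ℝ 2 (volume : Measure R2)) 0 1
    (x := fun n => WeakDual.toStrongDual.symm (InnerProductSpace.toDual ℝ _ ((hφ n).toLp (φ n))))
    (fun n => by simpa using hn n)
  set g := (InnerProductSpace.toDual ℝ _).symm (WeakDual.toStrongDual a) with hg
  have hgm := (Lp.aestronglyMeasurable g).aemeasurable
  have hgf := hgm.ae_eq_mk
  refine ⟨hgm.mk g, σ, hgm.measurable_mk, (memLp_congr_ae hgf).1 (Lp.memLp g), hσ, fun h hh => ?_⟩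
  have h2 := ((WeakDual.eval_continuous (hh.toLp h)).tendsto a).comp ht
  have e1 : a (hh.toLp h) = ∫ x, hgm.mk g x * h x := by
    have : inner ℝ g (hh.toLp h) = a (hh.toLp h) := InnerProductSpace.toDual_symm_apply
    rw [← this, L2.inner_def]
    refine integral_congr_ae ?_
    filter_upwards [hgf, hh.coeFn_toLp] with x h3 h4
    rw [← h3, h4]; simp [mul_comm]
  rw [← e1]
  refine h2.congr fun n => ?_
  exact integral_inner_toLp _ _

lemma memLp_two_of_continuous {h : R2 → ℝ} (hc : Continuous h) (hs : HasCompactSupport h) (x : R2) :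
    MemLp (fun y => h (x - y)) 2 :=
  (hc.comp (by fun_prop : Continuous fun y => x - y)).memLp_of_hasCompactSupport
    (hasCompactSupport_comp_sub hs x)

lemma integral_sq_add_le {f g : R2 → ℝ} (hf : MemLp f 2) (hg : MemLp g 2) {δ : ℝ} (hδ : 0 < δ) {μ : Measure R2} (hμ : μ ≤ volume) :
    ∫ x, f x ^ 2 ∂μ ≤ (1 + δ) * (∫ x, g x ^ 2 ∂μ) + (1 + 1 / δ) * ∫ x, (f x - g x) ^ 2 ∂μ := by
  have h1 := hf.integrable_sq.mono_measure hμ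
  have h2 := hg.integrable_sq.mono_measure hμ
  have h3 : Integrable (fun x => (f x - g x) ^ 2) μ := (hf.sub hg).integrable_sq.mono_measure hμ
  rw [← integral_const_mul, ← integral_const_mul, ← integral_add (h2.const_mul _) (h3.const_mul _)]
  refine integral_mono h1 ((h2.const_mul _).add (h3.const_mul _)) fun x => ?_
  have h4 : 0 ≤ (δ * g x - (f x - g x)) ^ 2 / δ := by positivity
  have h5 : (δ * g x - (f x - g x)) ^ 2 / δ = (1 + δ) * g x ^ 2 + (1 + 1 / δ) * (f x - g x) ^ 2 - f x ^ 2 := by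
    field_simp; ring
  simp only
  linarith

lemma memLp_mol {u : R2 → ℝ} (hm : Measurable u) (hu : MemLp u 2) {s : ℝ} (hs : 0 < s) :
    MemLp (mol s u) 2 ∧ ∫ x, mol s u x ^ 2 ≤ ∫ x, u x ^ 2 := by
  have hl := hu.locallyIntegrable (by norm_num)
  have h1 := lintegral_sq_mol_le hm hl hu.integrable_sq.locallyIntegrable hs
  rw [← ofReal_integral_eq_lintegral_ofReal hu.integrable_sq (ae_of_all _ fun x => sq_nonneg _)] at h1
  have h2 : MemLp (mol s u) 2 := memLp_two_of_lintegral_ne_top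
    (contDiff_mol hl hs).continuous.aestronglyMeasurable (ne_top_of_le_ne_top ENNReal.ofReal_ne_top h1)
  refine ⟨h2, ?_⟩
  rw [← ofReal_integral_eq_lintegral_ofReal h2.integrable_sq (ae_of_all _ fun x => sq_nonneg _)] at h1
  exact (ENNReal.ofReal_le_ofReal_iff (integral_nonneg fun x => sq_nonneg _)).1 h1

lemma integral_sq_sub_mol_le {u : R2 → ℝ} (hc : ContDiff ℝ 1 u) (hu : MemLp u 2)
    (hD : Integrable fun x => ‖fderiv ℝ u x‖ ^ 2) {s : ℝ} (hs : 0 < s) :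
    ∫ x, (u x - mol s u x) ^ 2 ≤ s ^ 2 * ∫ x, ‖fderiv ℝ u x‖ ^ 2 := by
  have h1 := lintegral_sq_sub_mol_le hc hs
  rw [← ofReal_integral_eq_lintegral_ofReal hD (ae_of_all _ fun x => sq_nonneg _),
    ← ENNReal.ofReal_mul (sq_nonneg s), ← ofReal_integral_eq_lintegral_ofReal
      (f := fun x => (u x - mol s u x) ^ 2)
      (hu.sub (memLp_mol hc.continuous.measurable hu hs).1).integrable_sq
      (ae_of_all _ fun x => sq_nonneg _)] at h1
  exact (ENNReal.ofReal_le_ofReal_iff (mul_nonneg (sq_nonneg s)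
    (integral_nonneg fun x => sq_nonneg _))).1 h1

/-- A weak limit of a sequence of bounded energy does not lose mass. -/
lemma one_le_integral_sq_of_weak_limit {V : R2 → ℝ} (hV : IsTrapPotential V) {p : ℝ} {φ : ℕ → R2 → ℝ}
    (hfe : ∀ n, FiniteEnergy V p (φ n)) (h1 : ∀ n, ∫ x, φ n x ^ 2 = 1) {E : ℝ}
    (hE : ∀ n, (∫ x, ‖fderiv ℝ (φ n) x‖ ^ 2) + ∫ x, V x * φ n x ^ 2 ≤ E) {f : R2 → ℝ}
    (hfm : Measurable f) (hf : MemLp f 2)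
    (hw : ∀ h, MemLp h 2 → Tendsto (fun n => ∫ x, φ n x * h x) atTop (𝓝 (∫ x, f x * h x))) :
    1 ≤ ∫ x, f x ^ 2 := by
  have hφ : ∀ n, MemLp (φ n) 2 := fun n =>
    (memLp_two_iff_integrable_sq (hfe n).contDiff.continuous.aestronglyMeasurable).2 (hfe n).sq
  have hl : ∀ n, LocallyIntegrable (φ n) := fun n => (hφ n).locallyIntegrable (by norm_num)
  have hg0 : ∀ n, 0 ≤ ∫ x, ‖fderiv ℝ (φ n) x‖ ^ 2 := fun n => integral_nonneg fun x => sq_nonneg _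
  have hv0 : ∀ n, 0 ≤ ∫ x, V x * φ n x ^ 2 := fun n =>
    integral_nonneg fun x => mul_nonneg (hV.nonneg x) (sq_nonneg _)
  have hE0 : 0 ≤ E := (add_nonneg (hg0 0) (hv0 0)).trans (hE 0)
  set N := ∫ x, f x ^ 2 with hN
  obtain ⟨C, hC, hker⟩ := exists_kernel_bound
  have key : ∀ L : ℝ, 0 < L → ∀ δ : ℝ, 0 < δ → ∀ s : ℝ, 0 < s →
      1 - E / L ≤ (1 + δ) * N + (1 + 1 / δ) * (s ^ 2 * E) := by
    intro L hL δ hδ s hs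
    obtain ⟨R, -, hR⟩ := hV.exists_radius L
    set B := Metric.closedBall (0 : R2) R with hB
    have hBm : MeasurableSet B := Metric.isClosed_closedBall.measurableSet
    have hBf : volume B < ⊤ := measure_closedBall_lt_top
    have : IsFiniteMeasure (volume.restrict B) := ⟨by simpa using hBf⟩
    have hin : ∀ n, 1 - E / L ≤ ∫ x in B, φ n x ^ 2 := by
      intro n
      have h2 : L * ∫ x in Bᶜ, φ n x ^ 2 ≤ ∫ x, V x * φ n x ^ 2 := by
        rw [← integral_const_mul]
        refine (setIntegral_mono_on ((hfe n).sq.const_mul L).integrableOn (hfe n).pot.integrableOn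
          hBm.compl fun x hx => ?_).trans (setIntegral_le_integral (hfe n).pot
            (ae_of_all _ fun x => mul_nonneg (hV.nonneg x) (sq_nonneg _)))
        refine mul_le_mul_of_nonneg_right (hR x ?_) (sq_nonneg _)
        simp only [hB, mem_compl_iff, Metric.mem_closedBall, dist_zero_right, not_le] at hx
        exact hx.le
      have h3 := integral_add_compl hBm (hfe n).sq
      rw [h1 n] at h3
      have h4 : ∫ x in Bᶜ, φ n x ^ 2 ≤ E / L := by
        rw [le_div_iff₀ hL]
        linarith [hE n, hg0 n]
      linarith
    have hstep : ∀ n, 1 - E / L ≤ (1 + δ) * (∫ x in B, mol s (φ n) x ^ 2) +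
        (1 + 1 / δ) * (s ^ 2 * E) := by
      intro n
      have hmn := memLp_mol (hfe n).contDiff.continuous.measurable (hφ n) hs
      refine (hin n).trans ((integral_sq_add_le (hφ n) hmn.1 hδ Measure.restrict_le_self).trans ?_)
      gcongr
      refine (setIntegral_le_integral ((hφ n).sub hmn.1).integrable_sq
        (ae_of_all _ fun x => sq_nonneg _)).trans
        ((integral_sq_sub_mol_le (hfe n).contDiff (hφ n) (hfe n).grad hs).trans ?_)
      gcongr
      linarith [hE n, hv0 n]
    have hlim : Tendsto (fun n => ∫ x in B, mol s (φ n) x ^ 2) atTop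
        (𝓝 (∫ x in B, mol s f x ^ 2)) := by
      refine tendsto_integral_of_dominated_convergence (fun _ => C / s ^ 2) (fun n =>
        ((contDiff_mol (hl n) hs).continuous.pow 2).aestronglyMeasurable) (integrable_const _)
        (fun n => ae_of_all _ fun x => ?_) (ae_of_all _ fun x => ?_)
      · rw [Real.norm_of_nonneg (sq_nonneg _)]
        refine (sq_mol_le (hl n) (hfe n).sq.locallyIntegrable hs x).trans ?_
        calc mol s (fun x => φ n x ^ 2) x ≤ ∫ y, φ n y ^ 2 * (C / s ^ 2) :=
              integral_mono (integrable_mul_rho (hfe n).sq.locallyIntegrable hs x)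
                ((hfe n).sq.mul_const _) fun y => mul_le_mul_of_nonneg_left
                  ((le_abs_self _).trans (hker s hs (x - y) 0).1) (sq_nonneg _)
          _ = C / s ^ 2 := by rw [integral_mul_const, h1 n, one_mul]
      · exact (hw _ (memLp_two_of_continuous (contDiff_rho s).continuous
          (hasCompactSupport_rho hs) x)).pow 2
    have h5 := ge_of_tendsto ((hlim.const_mul (1 + δ)).add_const _) (Eventually.of_forall hstep)
    refine h5.trans ?_
    gcongr
    have hmf := memLp_mol hfm hf hs
    exact (setIntegral_le_integral hmf.1.integrable_sq (ae_of_all _ fun x => sq_nonneg _)).trans hmf.2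
  have key2 : ∀ L : ℝ, 0 < L → ∀ δ : ℝ, 0 < δ → 1 - E / L ≤ (1 + δ) * N := by
    intro L hL δ hδ
    have h2 : Tendsto (fun s : ℝ => (1 + δ) * N + (1 + 1 / δ) * (s ^ 2 * E)) (𝓝[>] 0)
        (𝓝 ((1 + δ) * N + (1 + 1 / δ) * (0 ^ 2 * E))) :=
      ((by fun_prop : Continuous fun s : ℝ => (1 + δ) * N + (1 + 1 / δ) * (s ^ 2 * E)).tendsto
        0).mono_left nhdsWithin_le_nhds
    have h3 := ge_of_tendsto h2 (eventually_mem_nhdsWithin.mono fun s hs => key L hL δ hδ s hs)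
    linarith
  have key3 : ∀ L : ℝ, 0 < L → 1 - E / L ≤ N := by
    intro L hL
    have h2 : Tendsto (fun δ : ℝ => (1 + δ) * N) (𝓝[>] 0) (𝓝 ((1 + 0) * N)) :=
      ((by fun_prop : Continuous fun δ : ℝ => (1 + δ) * N).tendsto 0).mono_left nhdsWithin_le_nhds
    have h3 := ge_of_tendsto h2 (eventually_mem_nhdsWithin.mono fun s hs => key2 L hL s hs)
    linarith
  have h2 : Tendsto (fun L : ℝ => 1 - E / L) atTop (𝓝 (1 - 0)) :=
    (tendsto_const_nhds.div_atTop tendsto_id).const_sub 1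
  have h3 := le_of_tendsto h2 ((eventually_gt_atTop 0).mono fun L hL => key3 L hL)
  linarith

/-- Nonnegative normalized sequences of bounded energy have strongly convergent subsequences. -/
lemma exists_strong_limit {V : R2 → ℝ} (hV : IsTrapPotential V) {p : ℝ} {φ : ℕ → R2 → ℝ}
    (hfe : ∀ n, FiniteEnergy V p (φ n)) (h1 : ∀ n, ∫ x, φ n x ^ 2 = 1) (h0 : ∀ n x, 0 ≤ φ n x) {E : ℝ}
    (hE : ∀ n, (∫ x, ‖fderiv ℝ (φ n) x‖ ^ 2) + ∫ x, V x * φ n x ^ 2 ≤ E) :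
    ∃ (f : R2 → ℝ) (σ : ℕ → ℕ), Measurable f ∧ MemLp f 2 ∧ (∫ x, f x ^ 2 = 1) ∧ (∀ x, 0 ≤ f x) ∧
      StrictMono σ ∧ (∀ᵐ x, Tendsto (fun n => φ (σ n) x) atTop (𝓝 (f x))) ∧
      (∀ h, MemLp h 2 → Tendsto (fun n => ∫ x, φ (σ n) x * h x) atTop (𝓝 (∫ x, f x * h x))) ∧
      Tendsto (fun n => ∫ x, (φ (σ n) x - f x) ^ 2) atTop (𝓝 0) := by
  have hφ : ∀ n, MemLp (φ n) 2 := fun n =>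
    (memLp_two_iff_integrable_sq (hfe n).contDiff.continuous.aestronglyMeasurable).2 (hfe n).sq
  obtain ⟨f, σ, hfm, hf, hσ, hw⟩ := exists_weak_limit hφ h1
  have hN := one_le_integral_sq_of_weak_limit hV (fun n => hfe (σ n)) (fun n => h1 (σ n))
    (fun n => hE (σ n)) hfm hf hw
  have hexp : ∀ n, ∫ x, (φ (σ n) x - f x) ^ 2 =
      1 - 2 * (∫ x, φ (σ n) x * f x) + ∫ x, f x ^ 2 := by
    intro n
    have i1 : Integrable fun x => φ (σ n) x * f x := (hφ (σ n)).integrable_mul hf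
    rw [← h1 (σ n), ← integral_const_mul, ← integral_sub (hφ (σ n)).integrable_sq (i1.const_mul 2),
      ← integral_add (f := fun x => φ (σ n) x ^ 2 - 2 * (φ (σ n) x * f x))
        ((hφ (σ n)).integrable_sq.sub (i1.const_mul 2)) hf.integrable_sq]
    exact integral_congr_ae (ae_of_all _ fun x => by simp only; ring)
  have hlim : Tendsto (fun n => ∫ x, (φ (σ n) x - f x) ^ 2) atTop (𝓝 (1 - ∫ x, f x ^ 2)) := by
    simp only [hexp]
    have h2 := ((hw f hf).const_mul 2).const_sub 1 |>.add_const (∫ x, f x ^ 2)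
    convert h2 using 2
    simp only [← sq]; ring
  have hN1 : ∫ x, f x ^ 2 = 1 := by
    have := ge_of_tendsto hlim (Eventually.of_forall fun n => integral_nonneg fun x => sq_nonneg _)
    linarith
  rw [hN1, sub_self] at hlim
  have hnorm : Tendsto (fun n => (hφ (σ n)).toLp (φ (σ n))) atTop (𝓝 (hf.toLp f)) := by
    rw [tendsto_iff_norm_sub_tendsto_zero]
    have h2 := hlim.sqrt
    rw [Real.sqrt_zero] at h2
    refine h2.congr fun n => ?_
    rw [← MemLp.toLp_sub, ← Real.sqrt_sq (norm_nonneg _), norm_toLp_sq]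
    rfl
  obtain ⟨τ, hτ, hae⟩ := (tendstoInMeasure_of_tendsto_Lp hnorm).exists_seq_tendsto_ae
  have hae' : ∀ᵐ x, Tendsto (fun n => φ (σ (τ n)) x) atTop (𝓝 (f x)) := by
    filter_upwards [hae, hf.coeFn_toLp, ae_all_iff.2 fun n => (hφ (σ (τ n))).coeFn_toLp]
      with x h2 h3 h4
    rw [h3] at h2
    exact h2.congr fun n => h4 n
  have hfn : ∀ᵐ x, max (f x) 0 = f x := by
    filter_upwards [hae'] with x hx
    exact max_eq_left (ge_of_tendsto hx (Eventually.of_forall fun n => h0 _ x))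
  refine ⟨fun x => max (f x) 0, σ ∘ τ, hfm.max measurable_const, (memLp_congr_ae hfn).2 hf, ?_,
    fun x => le_max_right _ _, hσ.comp hτ, ?_, fun h hh => ?_, ?_⟩
  · rw [← hN1]
    exact integral_congr_ae (hfn.mono fun x hx => by simp only [hx])
  · filter_upwards [hae', hfn] with x h2 h3
    rwa [h3]
  · rw [integral_congr_ae (hfn.mono fun x hx => by simp only [hx] : ∀ᵐ x, max (f x) 0 * h x = f x * h x)]
    exact (hw h hh).comp hτ.tendsto_atTop
  · refine (hlim.comp hτ.tendsto_atTop).congr fun n => ?_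
    exact integral_congr_ae (hfn.mono fun x hx => by simp only [hx, Function.comp])

/-! ### Minimizing sequences and the Euler-Lagrange equation -/

/-- A nonnegative minimizing sequence `φ` converging to `f`, whose quadratic energies converge to
`d`. -/
structure MinimizingSeq (V : R2 → ℝ) (p : ℝ) (φ : ℕ → R2 → ℝ) (f : R2 → ℝ) (d : ℝ) : Prop where
  fin : EauxInf V p ≠ ⊤
  fe : ∀ n, FiniteEnergy V p (φ n)
  norm_eq : ∀ n, ∫ x, φ n x ^ 2 = 1
  nonneg : ∀ n x, 0 ≤ φ n x
  quad : Tendsto (fun n => (∫ x, ‖fderiv ℝ (φ n) x‖ ^ 2) + ∫ x, V x * φ n x ^ 2) atTop (𝓝 d)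
  quart : Tendsto (fun n => ∫ x, p * φ n x ^ 4) atTop (𝓝 ((EauxInf V p).toReal - d))
  meas : Measurable f
  memLp : MemLp f 2
  lim_norm_eq : ∫ x, f x ^ 2 = 1
  lim_nonneg : ∀ x, 0 ≤ f x
  ae : ∀ᵐ x, Tendsto (fun n => φ n x) atTop (𝓝 (f x))
  weak : ∀ h, MemLp h 2 → Tendsto (fun n => ∫ x, φ n x * h x) atTop (𝓝 (∫ x, f x * h x))
  strong : Tendsto (fun n => ∫ x, (φ n x - f x) ^ 2) atTop (𝓝 0)

lemma EauxInf_ne_top {V : R2 → ℝ} (hV : IsTrapPotential V) {p : ℝ} (hp : 0 ≤ p) :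
    EauxInf V p ≠ ⊤ := by
  obtain ⟨g, hg, -, hfin⟩ := exists_trial hV
  exact ne_top_of_le_ne_top (hfin p hp) (EauxInf_le hg)

lemma exists_minimizing_tendsto {V : R2 → ℝ} (hV : IsTrapPotential V) {p : ℝ} (hp : 0 ≤ p) :
    ∃ φ : ℕ → R2 → ℝ, (∀ n, adm2 (φ n)) ∧ (∀ n x, 0 < φ n x) ∧ (∀ n, Eaux V p (φ n) ≠ ⊤) ∧
      Tendsto (fun n => Eaux V p (φ n)) atTop (𝓝 (EauxInf V p)) := by
  obtain ⟨g, hg, hgp, hfin⟩ := exists_trial hV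
  have hft := EauxInf_ne_top hV hp
  have ht : ∀ n : ℕ, (0 : ℝ) < 1 / ((n : ℝ) + 1) := fun n => by positivity
  have ht1 : ∀ n : ℕ, 1 / ((n : ℝ) + 1) ≤ 1 := fun n => by
    rw [div_le_one (by positivity)]; linarith [(Nat.cast_nonneg n : (0 : ℝ) ≤ n)]
  have hex : ∀ n : ℕ, ∃ ψ, adm2 ψ ∧ Eaux V p ψ < EauxInf V p + ENNReal.ofReal (1 / ((n : ℝ) + 1)) := by
    intro n
    have h1 : EauxInf V p < EauxInf V p + ENNReal.ofReal (1 / ((n : ℝ) + 1)) :=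
      ENNReal.lt_add_right hft (by simpa using ht n)
    obtain ⟨_, ⟨ψ, hψ, rfl⟩, h2⟩ := sInf_lt_iff.1 h1
    exact ⟨ψ, hψ, h2⟩
  choose ψ hψ hψE using hex
  set φ : ℕ → R2 → ℝ := fun n => mix (1 / ((n : ℝ) + 1)) (ψ n) g with hφ
  have hadm : ∀ n, adm2 (φ n) := fun n => adm2_mix (ht n) (ht1 n) hgp (hψ n) hg
  have hle : ∀ n, Eaux V p (φ n) ≤ EauxInf V p + ENNReal.ofReal (1 / ((n : ℝ) + 1)) +
      ENNReal.ofReal (1 / ((n : ℝ) + 1)) * Eaux V p g := by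
    intro n
    refine le_self_add.trans ((Eaux_mix_add_le hV hp (ht n) (ht1 n) hgp (hψ n).1 hg.1).trans ?_)
    gcongr
    refine (mul_le_of_le_one_left zero_le ?_).trans (hψE n).le
    exact ENNReal.ofReal_le_one.2 (by linarith [ht n])
  refine ⟨φ, hadm, fun n => mix_pos (ht n) (ht1 n) _ hgp, fun n => ?_, ?_⟩
  · refine ne_top_of_le_ne_top ?_ (hle n)
    exact ENNReal.add_ne_top.2 ⟨ENNReal.add_ne_top.2 ⟨hft, ENNReal.ofReal_ne_top⟩,
      ENNReal.mul_ne_top ENNReal.ofReal_ne_top (hfin p hp)⟩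
  · have h0 : Tendsto (fun n : ℕ => ENNReal.ofReal (1 / ((n : ℝ) + 1))) atTop (𝓝 0) := by
      simpa using ENNReal.tendsto_ofReal tendsto_one_div_add_atTop_nhds_zero_nat
    have h1 := (h0.const_add (EauxInf V p)).add
      (ENNReal.Tendsto.mul_const h0 (Or.inr (hfin p hp)))
    rw [zero_mul, add_zero, add_zero] at h1
    exact tendsto_of_tendsto_of_tendsto_of_le_of_le tendsto_const_nhds h1
      (fun n => EauxInf_le (hadm n)) hle

lemma exists_minimizingSeq {V : R2 → ℝ} (hV : IsTrapPotential V) {p : ℝ} (hp : 0 ≤ p) :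
    ∃ φ f d, MinimizingSeq V p φ f d ∧ 0 ≤ d ∧ d ≤ (EauxInf V p).toReal := by
  obtain ⟨φ, hadm, hpos, hfin, hE⟩ := exists_minimizing_tendsto hV hp
  have hfe : ∀ n, FiniteEnergy V p (φ n) := fun n => finiteEnergy_of_Eaux_ne_top hV hp (hadm n) (hfin n)
  have h1 : ∀ n, ∫ x, φ n x ^ 2 = 1 := fun n => (lintegral_eq_one_iff (hfe n).sq).1 (hadm n).2
  set D : ℕ → ℝ := fun n => (∫ x, ‖fderiv ℝ (φ n) x‖ ^ 2) + ∫ x, V x * φ n x ^ 2 with hD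
  set Q : ℕ → ℝ := fun n => ∫ x, p * φ n x ^ 4 with hQ
  have hD0 : ∀ n, 0 ≤ D n := fun n => add_nonneg (integral_nonneg fun x => sq_nonneg _)
    (integral_nonneg fun x => mul_nonneg (hV.nonneg x) (sq_nonneg _))
  have hQ0 : ∀ n, 0 ≤ Q n := fun n => integral_nonneg fun x => by positivity
  have hft := EauxInf_ne_top hV hp
  have hDQ : Tendsto (fun n => D n + Q n) atTop (𝓝 (EauxInf V p).toReal) := by
    refine ((ENNReal.tendsto_toReal hft).comp hE).congr fun n => ?_
    simp only [Function.comp]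
    rw [(hfe n).Eaux_eq hV hp, ENNReal.toReal_ofReal (add_nonneg (hD0 n) (hQ0 n))]
  obtain ⟨E, hEb⟩ := hDQ.bddAbove_range
  have hDE : ∀ n, D n ≤ E := fun n => by
    have : D n + Q n ≤ E := hEb (mem_range_self n)
    linarith [hQ0 n]
  obtain ⟨d, hd, τ, hτ, hτd⟩ := isCompact_Icc.tendsto_subseq fun n => (⟨hD0 n, hDE n⟩ : D n ∈ Icc 0 E)
  obtain ⟨f, σ, hfm, hf, hf1, hf0, hσ, hae, hw, hs⟩ := exists_strong_limit hV (fun n => hfe (τ n))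
    (fun n => h1 (τ n)) (fun n x => (hpos (τ n) x).le) (fun n => hDE (τ n))
  have hq := (hDQ.comp (hτ.comp hσ).tendsto_atTop).sub (hτd.comp hσ.tendsto_atTop)
  have hQl : Tendsto (fun n => Q (τ (σ n))) atTop (𝓝 ((EauxInf V p).toReal - d)) :=
    hq.congr fun n => by simp [Function.comp]
  refine ⟨fun n => φ (τ (σ n)), f, d, ⟨hft, fun n => hfe _, fun n => h1 _, fun n x => (hpos _ x).le,
    hτd.comp hσ.tendsto_atTop, hQl, hfm, hf, hf1, hf0, hae, hw, hs⟩, hd.1, ?_⟩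
  have := ge_of_tendsto hQl (Eventually.of_forall fun n => hQ0 _)
  linarith

lemma lintegral_le_of_ae_tendsto {F : ℕ → R2 → ℝ} {f : R2 → ℝ} (hm : ∀ n, Measurable (F n))
    (hF : ∀ᵐ x, Tendsto (fun n => F n x) atTop (𝓝 (f x))) {c : ℕ → ℝ≥0∞} {c₀ : ℝ≥0∞}
    (hle : ∀ n, ∫⁻ x, ENNReal.ofReal (F n x) ≤ c n) (hc : Tendsto c atTop (𝓝 c₀)) :
    ∫⁻ x, ENNReal.ofReal (f x) ≤ c₀ := by
  calc ∫⁻ x, ENNReal.ofReal (f x) = ∫⁻ x, liminf (fun n => ENNReal.ofReal (F n x)) atTop :=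
        lintegral_congr_ae (hF.mono fun x hx => (ENNReal.tendsto_ofReal hx).liminf_eq.symm)
    _ ≤ liminf (fun n => ∫⁻ x, ENNReal.ofReal (F n x)) atTop :=
        lintegral_liminf_le fun n => (hm n).ennreal_ofReal
    _ ≤ liminf c atTop := liminf_le_liminf (Eventually.of_forall hle)
    _ = c₀ := hc.liminf_eq

lemma abs_integral_mul_le_sqrt {f g : R2 → ℝ} (hf : MemLp f 2) (hg : MemLp g 2) :
    |∫ x, f x * g x| ≤ √(∫ x, f x ^ 2) * √(∫ x, g x ^ 2) := by
  rw [← integral_inner_toLp hf hg, ← norm_toLp_sq hf, ← norm_toLp_sq hg, Real.sqrt_sq (norm_nonneg _),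
    Real.sqrt_sq (norm_nonneg _)]
  exact abs_real_inner_le_norm _ _

namespace MinimizingSeq

variable {V : R2 → ℝ} {p : ℝ} {φ : ℕ → R2 → ℝ} {f : R2 → ℝ} {d : ℝ}

lemma memLp_seq (h : MinimizingSeq V p φ f d) (n : ℕ) : MemLp (φ n) 2 :=
  (memLp_two_iff_integrable_sq (h.fe n).contDiff.continuous.aestronglyMeasurable).2 (h.fe n).sq

lemma integrable_quart (h : MinimizingSeq V p φ f d) (hp : 0 ≤ p) :
    Integrable fun x => p * f x ^ 4 := by
  have h1 := lintegral_le_of_ae_tendsto (F := fun n x => p * φ n x ^ 4) (f := fun x => p * f x ^ 4)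
    (c := fun n => ENNReal.ofReal (∫ x, p * φ n x ^ 4))
    (fun n => ((h.fe n).contDiff.continuous.measurable.pow_const 4).const_mul p)
    (h.ae.mono fun x hx => (hx.pow 4).const_mul p)
    (fun n => (ofReal_integral_eq_lintegral_ofReal (h.fe n).quart
      (ae_of_all _ fun x => by simp only [Pi.zero_apply]; positivity)).ge)
    (ENNReal.tendsto_ofReal h.quart)
  refine ⟨((h.meas.pow_const 4).const_mul p).aestronglyMeasurable, ?_⟩
  rw [hasFiniteIntegral_iff_ofReal (ae_of_all _ fun x => by simp only [Pi.zero_apply]; positivity)]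
  exact h1.trans_lt ENNReal.ofReal_lt_top

end MinimizingSeq

lemma integrable_cube {u : R2 → ℝ} {p : ℝ} (hp : 0 ≤ p) (hm : Measurable u)
    (h2 : Integrable fun x => u x ^ 2) (h4 : Integrable fun x => p * u x ^ 4) :
    Integrable fun x => p * u x ^ 3 := by
  refine ((h2.const_mul p).add h4).mono' ((hm.pow_const 3).const_mul p).aestronglyMeasurable
    (ae_of_all _ fun x => ?_)
  rw [norm_mul, Real.norm_of_nonneg hp, norm_pow, Real.norm_eq_abs]
  simp only [Pi.add_apply]
  rw [← mul_add]
  refine mul_le_mul_of_nonneg_left ?_ hp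
  rw [← sq_abs (u x), show u x ^ 4 = |u x| ^ 4 by rw [← Even.pow_abs (by decide)]]
  nlinarith [mul_nonneg (sq_nonneg |u x|) (sq_nonneg (|u x| - 1)), sq_nonneg (|u x|), abs_nonneg (u x)]

lemma MinimizingSeq.tendsto_cube {V : R2 → ℝ} {p : ℝ} {φ : ℕ → R2 → ℝ} {f : R2 → ℝ} {d : ℝ}
    (h : MinimizingSeq V p φ f d) (hp : 0 ≤ p) {η : R2 → ℝ} (hη : Continuous η) {B : ℝ}
    (hB : ∀ x, |η x| ≤ B) :
    Tendsto (fun n => ∫ x, p * φ n x ^ 3 * η x) atTop (𝓝 (∫ x, p * f x ^ 3 * η x)) := by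
  rcases hp.eq_or_lt with rfl | hp0
  · simp
  obtain ⟨Qm, hQm⟩ := h.quart.bddAbove_range
  have hQ : ∀ n, ∫ x, p * φ n x ^ 4 ≤ Qm := fun n => hQm (mem_range_self n)
  have hf4 := h.integrable_quart hp
  have hB0 : 0 ≤ B := (abs_nonneg _).trans (hB 0)
  set K := 9 / 2 * B ^ 2 / p * (Qm + ∫ x, p * f x ^ 4) with hK
  have hηb : ∀ u : R2 → ℝ, Integrable (fun x => p * u x ^ 3) →
      Integrable fun x => p * u x ^ 3 * η x := fun u hu =>
    (hu.bdd_mul (c := B) hη.aestronglyMeasurable (ae_of_all _ hB)).congr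
      (ae_of_all _ fun x => mul_comm _ _)
  have hmem : ∀ n, MemLp (fun x => (φ n x ^ 2 + φ n x * f x + f x ^ 2) * η x) 2 ∧
      ∫ x, ((φ n x ^ 2 + φ n x * f x + f x ^ 2) * η x) ^ 2 ≤ K := by
    intro n
    have hmm : Measurable fun x => (φ n x ^ 2 + φ n x * f x + f x ^ 2) * η x := by
      have h1 := (h.fe n).contDiff.continuous.measurable
      have h2 := h.meas
      have h3 := hη.measurable
      fun_prop
    have hpt : ∀ x, ((φ n x ^ 2 + φ n x * f x + f x ^ 2) * η x) ^ 2 ≤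
        9 / 2 * B ^ 2 / p * (p * φ n x ^ 4 + p * f x ^ 4) := by
      intro x
      have h1 : η x ^ 2 ≤ B ^ 2 := sq_le_sq' (abs_le.1 (hB x)).1 (abs_le.1 (hB x)).2
      have h2 : (φ n x ^ 2 + φ n x * f x + f x ^ 2) ^ 2 ≤ 9 / 2 * (φ n x ^ 4 + f x ^ 4) := by
        nlinarith [sq_nonneg (φ n x ^ 2 - f x ^ 2), mul_nonneg (sq_nonneg (φ n x - f x)) (sq_nonneg (φ n x + f x)),
          sq_nonneg (φ n x - f x), mul_nonneg (sq_nonneg (φ n x - f x)) (add_nonneg (sq_nonneg (φ n x)) (sq_nonneg (f x)))]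
      rw [mul_pow]
      calc _ ≤ 9 / 2 * (φ n x ^ 4 + f x ^ 4) * B ^ 2 :=
            mul_le_mul h2 h1 (sq_nonneg _) (by positivity)
        _ = _ := by field_simp
    have hi : Integrable fun x => 9 / 2 * B ^ 2 / p * (p * φ n x ^ 4 + p * f x ^ 4) :=
      ((h.fe n).quart.add hf4).const_mul _
    have hi2 : Integrable fun x => ((φ n x ^ 2 + φ n x * f x + f x ^ 2) * η x) ^ 2 :=
      hi.mono' (hmm.pow_const 2).aestronglyMeasurable (ae_of_all _ fun x => by
        rw [Real.norm_of_nonneg (sq_nonneg _)]; exact hpt x)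
    refine ⟨(memLp_two_iff_integrable_sq hmm.aestronglyMeasurable).2 hi2,
      (integral_mono hi2 hi hpt).trans ?_⟩
    rw [integral_const_mul, integral_add (h.fe n).quart hf4, hK]
    refine mul_le_mul_of_nonneg_left ?_ (by positivity)
    linarith [hQ n]
  have hle : ∀ n, |(∫ x, p * φ n x ^ 3 * η x) - ∫ x, p * f x ^ 3 * η x| ≤
      p * (√(∫ x, (φ n x - f x) ^ 2) * √K) := by
    intro n
    rw [← integral_sub (hηb _ (integrable_cube hp (h.fe n).contDiff.continuous.measurable (h.fe n).sq
      (h.fe n).quart)) (hηb _ (integrable_cube hp h.meas h.memLp.integrable_sq hf4))]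
    have e : ∀ x, p * φ n x ^ 3 * η x - p * f x ^ 3 * η x =
        p * ((φ n x - f x) * ((φ n x ^ 2 + φ n x * f x + f x ^ 2) * η x)) := fun x => by ring
    simp only [e]
    rw [integral_const_mul, abs_mul, abs_of_nonneg hp]
    gcongr
    refine (abs_integral_mul_le_sqrt (f := fun x => φ n x - f x) ((h.memLp_seq n).sub h.memLp)
      (hmem n).1).trans ?_
    gcongr
    exact (hmem n).2
  rw [tendsto_iff_norm_sub_tendsto_zero]
  refine squeeze_zero (fun n => norm_nonneg _) hle ?_
  have h1 := (h.strong.sqrt.mul_const √K).const_mul p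
  simpa using h1

lemma norm_add_smul_innerSL_sq (L : R2 →L[ℝ] ℝ) (w : R2) (t : ℝ) :
    ‖L + t • innerSL ℝ w‖ ^ 2 = ‖L‖ ^ 2 + 2 * t * L w + t ^ 2 * ‖w‖ ^ 2 := by
  obtain ⟨v, rfl⟩ := (InnerProductSpace.toDual ℝ R2).surjective L
  have e : InnerProductSpace.toDual ℝ R2 v + t • innerSL ℝ w = innerSL ℝ (v + t • w) := by
    ext z; simp
  rw [e, innerSL_apply_norm, LinearIsometryEquiv.norm_map, norm_add_sq_real, norm_smul,
    InnerProductSpace.toDual_apply_apply, real_inner_smul_right, mul_pow, Real.norm_eq_abs, sq_abs]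
  ring

lemma hasFDerivAt_pot_sub {s : ℝ} (hs : 0 < s) (x y : R2) :
    HasFDerivAt (fun y => pot s (x - y)) (innerSL ℝ ((rho s (x - y) / s ^ 2) • (x - y))) y := by
  have hq : HasFDerivAt (qarg s) (-((2 / s ^ 2) • innerSL ℝ (x - y))) (x - y) := by
    have h1 : HasFDerivAt (fun z : R2 => ‖z‖ ^ 2) (2 • innerSL ℝ (x - y)) (x - y) :=
      (hasStrictFDerivAt_norm_sq (x - y)).hasFDerivAt
    refine ((h1.mul_const ((s ^ 2)⁻¹)).const_sub 1).congr_fderiv ?_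
    ext w
    simp
    ring
  have h1 : HasFDerivAt (fun y : R2 => x - y) (-ContinuousLinearMap.id ℝ R2) y :=
    (hasFDerivAt_id y).const_sub x
  have h2 := (((hasDerivAt_expNegInvGlue (qarg s (x - y))).comp_hasFDerivAt (x - y) hq).const_mul
    (1 / kmass / s ^ 2)).comp y h1
  refine h2.congr_fderiv ?_
  ext w
  simp [rho]
  field_simp

lemma quartic_le {a h t : ℝ} (ht : |t| ≤ 1) :
    (a + t * h) ^ 4 ≤ a ^ 4 + 4 * t * (a ^ 3 * h) + t ^ 2 * (8 * (a ^ 2 * h ^ 2) + 3 * h ^ 4) := by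
  obtain ⟨h1, h2⟩ := abs_le.1 ht
  have e1 : t ^ 2 ≤ 1 := by nlinarith
  have e2 : 0 ≤ t ^ 2 * (h ^ 2 * (a - t * h) ^ 2) := by positivity
  have e3 : 0 ≤ t ^ 2 * h ^ 4 * (1 - t ^ 2) := mul_nonneg (by positivity) (by linarith)
  linarith

/-- The variational inequality for perturbations of a normalized function. -/
lemma FiniteEnergy.perturbation_le {V : R2 → ℝ} (hV : IsTrapPotential V) {p : ℝ} (hp : 0 ≤ p)
    {u : R2 → ℝ} (hu : FiniteEnergy V p u) (hu1 : ∫ y, u y ^ 2 = 1) {η : R2 → ℝ} {w : R2 → R2}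
    (hηc : ContDiff ℝ 1 η) (hηs : HasCompactSupport η) (hwc : Continuous w)
    (hws : HasCompactSupport w) (hd : ∀ y, HasFDerivAt η (innerSL ℝ (w y)) y) {B : ℝ}
    (hηB : ∀ y, |η y| ≤ B) {t : ℝ} (ht : |t| ≤ 1) :
    (EauxInf V p).toReal * (1 + 2 * t * (∫ y, u y * η y) + t ^ 2 * ∫ y, η y ^ 2) ^ 2 ≤
      (1 + 2 * t * (∫ y, u y * η y) + t ^ 2 * ∫ y, η y ^ 2) *
        (((∫ y, ‖fderiv ℝ u y‖ ^ 2) + ∫ y, V y * u y ^ 2) +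
          2 * t * ((∫ y, V y * u y * η y) + ∫ y, fderiv ℝ u y (w y)) +
          t ^ 2 * ((∫ y, ‖w y‖ ^ 2) + ∫ y, V y * η y ^ 2)) +
        ((∫ y, p * u y ^ 4) + 4 * t * (∫ y, p * u y ^ 3 * η y) +
          t ^ 2 * (p * (8 * B ^ 2 + 3 * ∫ y, η y ^ 4))) := by
  have hcont := hηc.continuous
  have huc := hu.contDiff.continuous
  have huc' := hu.contDiff.continuous_fderiv one_ne_zero
  have hηm : ∀ g : R2 → ℝ, LocallyIntegrable g → Integrable fun y => g y * η y := fun g hg =>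
    hg.integrable_smul_right_of_hasCompactSupport hcont hηs
  have iη2 : Integrable fun y => η y ^ 2 :=
    (hηm η hcont.locallyIntegrable).congr (ae_of_all _ fun y => (pow_two _).symm)
  have iη4 : Integrable fun y => η y ^ 4 :=
    (hηm _ (hcont.pow 3).locallyIntegrable).congr (ae_of_all _ fun y => (pow_succ _ 3).symm)
  have iw : Integrable fun y => ‖w y‖ ^ 2 :=
    (hwc.norm.pow 2).integrable_of_hasCompactSupport
      (hws.mono fun y hy => by
        contrapose! hy
        simp only [Function.mem_support, not_not] at hy ⊢
        show ‖w y‖ ^ 2 = 0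
        rw [hy, norm_zero, zero_pow two_ne_zero])
  have iVη : Integrable fun y => V y * η y ^ 2 :=
    (hηm _ (hV.locallyIntegrable_mul hcont.locallyIntegrable)).congr
      (ae_of_all _ fun y => by simp only; ring)
  have hdu : Differentiable ℝ u := hu.contDiff.differentiable one_ne_zero
  have iu : Integrable fun y => u y * η y := hηm u huc.locallyIntegrable
  have iVu : Integrable fun y => V y * u y * η y :=
    hηm _ (hV.locallyIntegrable_mul huc.locallyIntegrable)
  have iu3 : Integrable fun y => p * u y ^ 3 * η y :=
    hηm _ (continuous_const.mul (huc.pow 3)).locallyIntegrable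
  have iu22 : Integrable fun y => u y ^ 2 * η y ^ 2 :=
    (hηm _ ((huc.pow 2).mul hcont).locallyIntegrable).congr
      (ae_of_all _ fun y => by simp only [Pi.mul_apply, Pi.pow_apply]; ring)
  have iDw : Integrable fun y => fderiv ℝ u y (w y) :=
    (huc'.clm_apply hwc).integrable_of_hasCompactSupport
      (hws.mono fun y hy => by
        contrapose! hy
        simp only [Function.mem_support, not_not] at hy ⊢
        rw [hy, map_zero])
  have hfd : ∀ y, fderiv ℝ (fun y => u y + t * η y) y = fderiv ℝ u y + t • innerSL ℝ (w y) :=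
    fun y => ((hdu y).hasFDerivAt.add ((hd y).const_mul t)).fderiv
  have e1 : ∀ y, (u y + t * η y) ^ 2 = u y ^ 2 + (2 * t * (u y * η y) + t ^ 2 * η y ^ 2) :=
    fun y => by ring
  have e2 : ∀ y, ‖fderiv ℝ (fun y => u y + t * η y) y‖ ^ 2 =
      ‖fderiv ℝ u y‖ ^ 2 + (2 * t * fderiv ℝ u y (w y) + t ^ 2 * ‖w y‖ ^ 2) := fun y => by
    rw [hfd, norm_add_smul_innerSL_sq, add_assoc]
  have e3 : ∀ y, V y * (u y + t * η y) ^ 2 =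
      V y * u y ^ 2 + (2 * t * (V y * u y * η y) + t ^ 2 * (V y * η y ^ 2)) := fun y => by ring
  have i1 : Integrable fun y => 2 * t * (u y * η y) + t ^ 2 * η y ^ 2 :=
    (iu.const_mul _).add (iη2.const_mul _)
  have i2 : Integrable fun y => 2 * t * fderiv ℝ u y (w y) + t ^ 2 * ‖w y‖ ^ 2 :=
    (iDw.const_mul _).add (iw.const_mul _)
  have i3 : Integrable fun y => 2 * t * (V y * u y * η y) + t ^ 2 * (V y * η y ^ 2) :=
    (iVu.const_mul _).add (iVη.const_mul _)
  have i5 : Integrable fun y => t ^ 2 * (8 * p * (u y ^ 2 * η y ^ 2) + 3 * p * η y ^ 4) :=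
    ((iu22.const_mul _).add (iη4.const_mul _)).const_mul _
  have i6 : Integrable fun y => 4 * t * (p * u y ^ 3 * η y) +
      t ^ 2 * (8 * p * (u y ^ 2 * η y ^ 2) + 3 * p * η y ^ 4) := (iu3.const_mul _).add i5
  have i4 : Integrable fun y => p * u y ^ 4 + (4 * t * (p * u y ^ 3 * η y) +
      t ^ 2 * (8 * p * (u y ^ 2 * η y ^ 2) + 3 * p * η y ^ 4)) := hu.quart.add i6
  have e4 : ∀ y, p * (u y + t * η y) ^ 4 ≤ p * u y ^ 4 + (4 * t * (p * u y ^ 3 * η y) +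
      t ^ 2 * (8 * p * (u y ^ 2 * η y ^ 2) + 3 * p * η y ^ 4)) := fun y => by
    have := mul_le_mul_of_nonneg_left (quartic_le (a := u y) (h := η y) ht) hp
    linarith
  have hcd : ContDiff ℝ 1 fun y => u y + t * η y := hu.contDiff.add (contDiff_const.mul hηc)
  have iq : Integrable fun y => p * (u y + t * η y) ^ 4 := by
    refine i4.mono' (continuous_const.mul (hcd.continuous.pow 4)).aestronglyMeasurable
      (ae_of_all _ fun y => ?_)
    rw [Real.norm_of_nonneg (by positivity)]
    exact e4 y
  have hfe : FiniteEnergy V p fun y => u y + t * η y := by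
    refine ⟨hcd, ?_, ?_, ?_, iq⟩
    · simp only [e1]; exact hu.sq.add i1
    · simp only [e2]; exact hu.grad.add i2
    · simp only [e3]; exact hu.pot.add i3
  have key := hfe.EauxInf_mul_le hV hp
  have q1 : ∫ y, (u y + t * η y) ^ 2 = 1 + 2 * t * (∫ y, u y * η y) + t ^ 2 * ∫ y, η y ^ 2 := by
    simp only [e1]
    rw [integral_add hu.sq i1, integral_add (iu.const_mul _) (iη2.const_mul _), integral_const_mul,
      integral_const_mul, hu1, add_assoc]
  have q2 : ∫ y, ‖fderiv ℝ (fun y => u y + t * η y) y‖ ^ 2 = (∫ y, ‖fderiv ℝ u y‖ ^ 2) +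
      (2 * t * (∫ y, fderiv ℝ u y (w y)) + t ^ 2 * ∫ y, ‖w y‖ ^ 2) := by
    simp only [e2]
    rw [integral_add hu.grad i2, integral_add (iDw.const_mul _) (iw.const_mul _), integral_const_mul,
      integral_const_mul]
  have q3 : ∫ y, V y * (u y + t * η y) ^ 2 = (∫ y, V y * u y ^ 2) +
      (2 * t * (∫ y, V y * u y * η y) + t ^ 2 * ∫ y, V y * η y ^ 2) := by
    simp only [e3]
    rw [integral_add hu.pot i3, integral_add (iVu.const_mul _) (iVη.const_mul _), integral_const_mul,
      integral_const_mul]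
  have q5 : ∫ y, u y ^ 2 * η y ^ 2 ≤ B ^ 2 := by
    calc _ ≤ ∫ y, u y ^ 2 * B ^ 2 := integral_mono iu22 (hu.sq.mul_const _) fun y =>
          mul_le_mul_of_nonneg_left (sq_le_sq' (abs_le.1 (hηB y)).1 (abs_le.1 (hηB y)).2)
            (sq_nonneg _)
      _ = B ^ 2 := by rw [integral_mul_const, hu1, one_mul]
  have q4 : ∫ y, p * (u y + t * η y) ^ 4 ≤ (∫ y, p * u y ^ 4) +
      4 * t * (∫ y, p * u y ^ 3 * η y) + t ^ 2 * (p * (8 * B ^ 2 + 3 * ∫ y, η y ^ 4)) := by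
    refine (integral_mono iq i4 e4).trans ?_
    rw [integral_add hu.quart i6, integral_add (iu3.const_mul _) i5,
      integral_const_mul (4 * t), integral_const_mul (t ^ 2),
      integral_add (iu22.const_mul _) (iη4.const_mul _), integral_const_mul (8 * p),
      integral_const_mul (3 * p)]
    have := mul_le_mul_of_nonneg_left (mul_le_mul_of_nonneg_left q5 hp) (sq_nonneg t)
    linarith
  rw [q1, q2, q3] at key
  refine key.trans (add_le_add (le_of_eq ?_) q4)
  ring

/-- Testing the minimization problem with a perturbation by `pot`. -/
lemma exists_perturbation_bound {V : R2 → ℝ} (hV : IsTrapPotential V) {p : ℝ} (hp : 0 ≤ p) {s : ℝ}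
    (hs : 0 < s) (x : R2) : ∃ N M K : ℝ, ∀ u, FiniteEnergy V p u →
      ∫ y, u y ^ 2 = 1 → ∀ t : ℝ, |t| ≤ 1 →
      (EauxInf V p).toReal * (1 + 2 * t * (∫ y, u y * pot s (x - y)) + t ^ 2 * N) ^ 2 ≤
        (1 + 2 * t * (∫ y, u y * pot s (x - y)) + t ^ 2 * N) *
          (((∫ y, ‖fderiv ℝ u y‖ ^ 2) + ∫ y, V y * u y ^ 2) +
            2 * t * ((∫ y, u y * (V y * pot s (x - y))) - ∫ y, u y * lapPot s (x - y)) + t ^ 2 * M) +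
          ((∫ y, p * u y ^ 4) + 4 * t * (∫ y, p * u y ^ 3 * pot s (x - y)) + t ^ 2 * K) := by
  obtain ⟨C, hC, hker⟩ := exists_kernel_bound
  have hsub : ContDiff ℝ 1 fun y : R2 => x - y := contDiff_const.sub contDiff_id
  have hrc : Continuous (rho s) := (contDiff_rho s).continuous
  refine ⟨∫ y, pot s (x - y) ^ 2, (∫ y, ‖(rho s (x - y) / s ^ 2) • (x - y)‖ ^ 2) +
    ∫ y, V y * pot s (x - y) ^ 2, p * (8 * (C / s ^ 2) ^ 2 + 3 * ∫ y, pot s (x - y) ^ 4),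
    fun u hu hu1 t ht => (hu.perturbation_le hV hp hu1
    (η := fun y => pot s (x - y)) (w := fun y => (rho s (x - y) / s ^ 2) • (x - y))
    (((contDiff_pot s).of_le (by norm_num)).comp hsub)
    (hasCompactSupport_comp_sub (hasCompactSupport_pot hs) x) (by fun_prop)
    ((hasCompactSupport_comp_sub (hasCompactSupport_rho hs) x).mono fun y hy => by
      contrapose! hy
      simp only [Function.mem_support, not_not] at hy ⊢
      rw [hy, zero_div, zero_smul]) (hasFDerivAt_pot_sub hs x)
    (fun y => (hker s hs (x - y) 0).2.1) ht).trans_eq ?_⟩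
  have h1 : ∫ y, fderiv ℝ u y ((rho s (x - y) / s ^ 2) • (x - y)) = -∫ y, u y * lapPot s (x - y) := by
    rw [← integral_fderiv_mul_rho hu.contDiff hs x]
    simp only [map_smul, smul_eq_mul, mul_comm]
  have h2 : ∀ y, u y * (V y * pot s (x - y)) = V y * u y * pot s (x - y) := fun y => by ring
  simp only [h1, h2]
  rw [← sub_eq_add_neg]

/-- First order optimality for the limit of the perturbation inequalities. -/
lemma eq_of_perturbation {e N M K a b c d : ℝ}
    (h : ∀ t : ℝ, |t| ≤ 1 → e * (1 + 2 * t * a + t ^ 2 * N) ^ 2 ≤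
      (1 + 2 * t * a + t ^ 2 * N) * (d + 2 * t * b + t ^ 2 * M) + (e - d + 4 * t * c + t ^ 2 * K)) :
    b + 2 * c = (2 * e - d) * a := by
  set P : ℝ → ℝ := fun t => (1 + 2 * t * a + t ^ 2 * N) * (d + 2 * t * b + t ^ 2 * M) +
    (e - d + 4 * t * c + t ^ 2 * K) - e * (1 + 2 * t * a + t ^ 2 * N) ^ 2 with hP
  have hmin : IsLocalMin P 0 := by
    filter_upwards [Metric.ball_mem_nhds (0 : ℝ) one_pos] with t ht
    have h1 := h t (by simpa using (mem_ball_zero_iff.1 ht).le)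
    have h2 : P 0 = 0 := by simp [hP]
    rw [h2]
    simp only [hP]
    linarith
  have hq : ∀ A B C : ℝ, HasDerivAt (fun t : ℝ => A + 2 * t * B + t ^ 2 * C) (2 * B) 0 := by
    intro A B C
    have h1 := (((hasDerivAt_id (0 : ℝ)).const_mul 2).mul_const B).const_add A |>.add
      (((hasDerivAt_id (0 : ℝ)).pow 2).mul_const C)
    exact (h1.congr_deriv (by simp)).congr_of_eventuallyEq (Eventually.of_forall fun t => by simp)
  have hd : HasDerivAt P (2 * a * d + 2 * b + 4 * c - e * (4 * a)) 0 := by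
    have h1 := (((hq 1 a N).mul (hq d b M)).add (hq (e - d) (2 * c) K)).sub
      (((hq 1 a N).pow 2).const_mul e)
    refine (h1.congr_deriv ?_).congr_of_eventuallyEq (Eventually.of_forall fun t => ?_)
    · simp; ring
    · simp [hP]; ring
  have := hmin.hasDerivAt_eq_zero hd
  linarith

lemma IsTrapPotential.memLp_mul_pot {V : R2 → ℝ} (hV : IsTrapPotential V) {s : ℝ} (hs : 0 < s)
    (x : R2) : MemLp (fun y => V y * pot s (x - y)) 2 := by
  obtain ⟨C, hC⟩ := hV.locBdd (‖x‖ + s)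
  have hp := memLp_two_of_continuous (contDiff_pot s).continuous (hasCompactSupport_pot hs) x
  refine (hp.const_mul C).mono (hV.meas.aestronglyMeasurable.mul hp.1) (ae_of_all _ fun y => ?_)
  rw [norm_mul, norm_mul]
  rcases le_or_gt s ‖x - y‖ with h | h
  · rw [pot_eq_zero hs h, norm_zero, mul_zero, mul_zero]
  · refine mul_le_mul_of_nonneg_right ?_ (norm_nonneg _)
    rw [Real.norm_of_nonneg (hV.nonneg y)]
    refine (hC y ?_).trans (le_abs_self C)
    have := norm_sub_norm_le y x
    rw [norm_sub_rev] at this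
    linarith

namespace MinimizingSeq

variable {V : R2 → ℝ} {p : ℝ} {φ : ℕ → R2 → ℝ} {f : R2 → ℝ} {d : ℝ}

lemma integral_mul_lapPot (hV : IsTrapPotential V) (hp : 0 ≤ p) (h : MinimizingSeq V p φ f d)
    {s : ℝ} (hs : 0 < s) (x : R2) :
    ((∫ y, f y * (V y * pot s (x - y))) - ∫ y, f y * lapPot s (x - y)) +
      2 * ∫ y, p * f y ^ 3 * pot s (x - y) =
      (2 * (EauxInf V p).toReal - d) * ∫ y, f y * pot s (x - y) := by
  obtain ⟨C, hC, hker⟩ := exists_kernel_bound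
  obtain ⟨N, M, K, hb⟩ := exists_perturbation_bound hV hp hs x
  have hpc := (contDiff_pot s).continuous
  have t1 := h.weak _ (memLp_two_of_continuous hpc (hasCompactSupport_pot hs) x)
  have t2 := h.weak _ (hV.memLp_mul_pot hs x)
  have t3 := h.weak _ (memLp_two_of_continuous (contDiff_lapPot s).continuous
    (hasCompactSupport_lapPot hs) x)
  have t4 := h.tendsto_cube hp (η := fun y => pot s (x - y)) (by fun_prop)
    (fun y => (hker s hs (x - y) 0).2.1)
  refine eq_of_perturbation (N := N) (M := M) (K := K) fun t ht => ?_
  have l1 := ((t1.const_mul (2 * t)).const_add 1).add_const (t ^ 2 * N)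
  have l2 := (h.quad.add ((t2.sub t3).const_mul (2 * t))).add_const (t ^ 2 * M)
  have l3 := (h.quart.add (t4.const_mul (4 * t))).add_const (t ^ 2 * K)
  exact le_of_tendsto_of_tendsto' ((l1.pow 2).const_mul (EauxInf V p).toReal) ((l1.mul l2).add l3)
    fun n => hb (φ n) (h.fe n) (h.norm_eq n) t ht

/-- The limit of a minimizing sequence solves the Euler–Lagrange equation. -/
lemma mollifiedGP (hV : IsTrapPotential V) (hp : 0 ≤ p) (h : MinimizingSeq V p φ f d) :
    MollifiedGP V p (2 * (EauxInf V p).toReal - d) f where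
  meas := h.meas
  nonneg := h.lim_nonneg
  norm_eq := (lintegral_eq_one_iff h.memLp.integrable_sq).2 h.lim_norm_eq
  cube := (integrable_cube hp h.meas h.memLp.integrable_sq (h.integrable_quart hp)).locallyIntegrable
  eqn s hs x := by
    have hf : LocallyIntegrable f := h.memLp.locallyIntegrable one_le_two
    have hpc := (contDiff_pot s).continuous
    have hps := hasCompactSupport_pot hs
    have i1 : Integrable fun y => V y * f y * pot s (x - y) :=
      integrable_mul_ker (hV.locallyIntegrable_mul hf) hpc hps x
    have i2 : Integrable fun y => p * f y ^ 3 * pot s (x - y) :=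
      integrable_mul_ker (integrable_cube hp h.meas h.memLp.integrable_sq
        (h.integrable_quart hp)).locallyIntegrable hpc hps x
    have i3 : Integrable fun y => f y * pot s (x - y) := integrable_mul_ker hf hpc hps x
    have key := h.integral_mul_lapPot hV hp hs x
    refine (hasDerivAt_mol hf hs x).congr_deriv ?_
    congr 1
    have e1 : ∀ y, (V y * f y + 2 * (p * f y ^ 3) - (2 * (EauxInf V p).toReal - d) * f y) *
        pot s (x - y) = V y * f y * pot s (x - y) + 2 * (p * f y ^ 3 * pot s (x - y)) -
          (2 * (EauxInf V p).toReal - d) * (f y * pot s (x - y)) := fun y => by ring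
    have e2 : ∀ y, f y * (V y * pot s (x - y)) = V y * f y * pot s (x - y) := fun y => by ring
    simp only [e2] at key
    simp only [e1]
    rw [integral_sub (f := fun y => V y * f y * pot s (x - y) + 2 * (p * f y ^ 3 * pot s (x - y)))
      (i1.add (i2.const_mul 2)) (i3.const_mul _), integral_add i1 (i2.const_mul 2),
      integral_const_mul 2, integral_const_mul (2 * (EauxInf V p).toReal - d)]
    linarith

lemma Eaux_tendsto (hV : IsTrapPotential V) (hp : 0 ≤ p) (h : MinimizingSeq V p φ f d) :
    Tendsto (fun n => Eaux V p (φ n)) atTop (𝓝 (EauxInf V p)) := by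
  have h1 := ENNReal.tendsto_ofReal (h.quad.add h.quart)
  rw [add_sub_cancel, ENNReal.ofReal_toReal h.fin] at h1
  exact h1.congr fun n => ((h.fe n).Eaux_eq hV hp).symm

end MinimizingSeq

lemma lintegral_density_eq {V : R2 → ℝ} (hV : IsTrapPotential V) {p : ℝ} (hp : 0 ≤ p)
    (u : R2 → ℝ) {v : R2 → ℝ} (hv : ContDiff ℝ 1 v) :
    ∫⁻ x, ENNReal.ofReal (‖fderiv ℝ v x‖ ^ 2 + V x * u x ^ 2 + p * u x ^ 4) =
      (∫⁻ x, ENNReal.ofReal (fderiv ℝ v x (EuclideanSpace.single 0 1) ^ 2)) +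
        (∫⁻ x, ENNReal.ofReal (fderiv ℝ v x (EuclideanSpace.single 1 1) ^ 2)) +
        ∫⁻ x, ENNReal.ofReal (V x * u x ^ 2 + p * u x ^ 4) := by
  have hm : ∀ w : R2, Measurable fun x => ENNReal.ofReal (fderiv ℝ v x w ^ 2) := fun w =>
    (((hv.continuous_fderiv one_ne_zero).clm_apply continuous_const).measurable.pow_const 2).ennreal_ofReal
  have hm2 : Measurable fun x => ENNReal.ofReal (fderiv ℝ v x (EuclideanSpace.single 0 1) ^ 2) +
    ENNReal.ofReal (fderiv ℝ v x (EuclideanSpace.single 1 1) ^ 2) := (hm _).add (hm _)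
  rw [← lintegral_add_left (hm _), ← lintegral_add_left hm2]
  refine lintegral_congr fun x => ?_
  have := hV.nonneg x
  rw [norm_sq_dual, add_assoc, ENNReal.ofReal_add (by positivity) (by positivity),
    ENNReal.ofReal_add (by positivity) (by positivity)]

/-- Mollifying only the gradient does not increase the energy. -/
lemma lintegral_mol_density_le {V : R2 → ℝ} (hV : IsTrapPotential V) {p : ℝ} (hp : 0 ≤ p)
    {u : R2 → ℝ} (hu : ContDiff ℝ 1 u) {s : ℝ} (hs : 0 < s) :
    ∫⁻ x, ENNReal.ofReal (‖fderiv ℝ (mol s u) x‖ ^ 2 + V x * u x ^ 2 + p * u x ^ 4) ≤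
      Eaux V p u := by
  have hc : ∀ w : R2, Continuous fun y => fderiv ℝ u y w := fun w =>
    (hu.continuous_fderiv one_ne_zero).clm_apply continuous_const
  have hle : ∀ w : R2, ∫⁻ x, ENNReal.ofReal (fderiv ℝ (mol s u) x w ^ 2) ≤
      ∫⁻ x, ENNReal.ofReal (fderiv ℝ u x w ^ 2) := fun w => by
    simp only [fderiv_mol_eq hu hs]
    exact lintegral_sq_mol_le (hc w).measurable (hc w).locallyIntegrable
      ((hc w).pow 2).locallyIntegrable hs
  rw [Eaux, lintegral_density_eq hV hp u hu,
    lintegral_density_eq hV hp u (contDiff_mol hu.continuous.locallyIntegrable hs)]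
  exact add_le_add (add_le_add (hle _) (hle _)) le_rfl

/-- Lower semicontinuity of the energy along minimizing sequences. -/
lemma MinimizingSeq.Eaux_le {V : R2 → ℝ} {p : ℝ} {φ : ℕ → R2 → ℝ} {f : R2 → ℝ} {d : ℝ}
    (hV : IsTrapPotential V) (hp : 0 ≤ p) (h : MinimizingSeq V p φ f d) {v : R2 → ℝ}
    (hfv : f =ᵐ[volume] v) (hv : ContDiff ℝ 1 v) : Eaux V p v ≤ EauxInf V p := by
  have hmeas : ∀ u w : R2 → ℝ, ContDiff ℝ 1 u → ContDiff ℝ 1 w →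
      Measurable fun x => ‖fderiv ℝ w x‖ ^ 2 + V x * u x ^ 2 + p * u x ^ 4 := fun u w hu hw => by
    have h1 := (hw.continuous_fderiv one_ne_zero).measurable
    have h2 := hu.continuous.measurable
    have h3 := hV.meas
    fun_prop
  have hf : LocallyIntegrable f := h.memLp.locallyIntegrable one_le_two
  have hvl := hv.continuous.locallyIntegrable (μ := (volume : Measure R2))
  have step : ∀ s, 0 < s → ∫⁻ x, ENNReal.ofReal
      (‖fderiv ℝ (mol s v) x‖ ^ 2 + V x * v x ^ 2 + p * v x ^ 4) ≤ EauxInf V p := by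
    intro s hs
    refine lintegral_le_of_ae_tendsto (F := fun n x => ‖fderiv ℝ (mol s (φ n)) x‖ ^ 2 +
      V x * φ n x ^ 2 + p * φ n x ^ 4) (fun n => hmeas _ _ (h.fe n).contDiff
        (contDiff_mol (h.fe n).contDiff.continuous.locallyIntegrable hs)) ?_
      (fun n => lintegral_mol_density_le hV hp (h.fe n).contDiff hs) (h.Eaux_tendsto hV hp)
    have hd : ∀ x w, Tendsto (fun n => fderiv ℝ (mol s (φ n)) x w) atTop
        (𝓝 (fderiv ℝ (mol s v) x w)) := fun x w => by
      rw [← mol_congr hfv s, fderiv_mol_apply hf hs]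
      simp only [fun n => fderiv_mol_apply (h.fe n).contDiff.continuous.locallyIntegrable hs x w]
      have hcr := (contDiff_rho s).continuous_fderiv two_ne_zero
      exact h.weak _ (memLp_two_of_continuous (h := fun z => fderiv ℝ (rho s) z w)
        (hcr.clm_apply continuous_const) ((hasCompactSupport_rho hs).fderiv_apply ℝ w) x)
    filter_upwards [h.ae, hfv] with x hx hxv
    rw [hxv] at hx
    simp only [norm_sq_dual]
    exact ((((hd x _).pow 2).add ((hd x _).pow 2)).add ((hx.pow 2).const_mul _)).add
      ((hx.pow 4).const_mul _)
  have hs0 : ∀ k : ℕ, 0 < 1 / ((k : ℝ) + 1) := fun k => Nat.one_div_pos_of_nat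
  have ht : Tendsto (fun k : ℕ => 1 / ((k : ℝ) + 1)) atTop (𝓝[>] 0) :=
    tendsto_nhdsWithin_iff.2 ⟨tendsto_one_div_add_atTop_nhds_zero_nat,
      Eventually.of_forall fun k => hs0 k⟩
  refine lintegral_le_of_ae_tendsto (F := fun k x => ‖fderiv ℝ (mol (1 / ((k : ℝ) + 1)) v) x‖ ^ 2 +
      V x * v x ^ 2 + p * v x ^ 4) (c := fun _ => EauxInf V p)
    (fun k => hmeas _ _ hv (contDiff_mol hvl (hs0 k))) (ae_of_all _ fun x => ?_)
    (fun k => step _ (hs0 k)) tendsto_const_nhds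
  have hd : ∀ w, Tendsto (fun k : ℕ => fderiv ℝ (mol (1 / ((k : ℝ) + 1)) v) x w) atTop
      (𝓝 (fderiv ℝ v x w)) := fun w => by
    simp only [fun k => fderiv_mol_eq hv (hs0 k) x w]
    exact (tendsto_mol_of_continuous (u := fun y => fderiv ℝ v y w)
      ((hv.continuous_fderiv one_ne_zero).clm_apply continuous_const) x).comp ht
  simp only [norm_sq_dual]
  exact (((((hd _).pow 2).add ((hd _).pow 2)).add_const _).add_const _)

lemma exists_mollifiedGP {V : R2 → ℝ} (hV : IsTrapPotential V) {p : ℝ} (hp : 0 ≤ p) :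
    ∃ f μ, 0 ≤ μ ∧ μ ≤ 2 * (EauxInf V p).toReal ∧ MollifiedGP V p μ f ∧
      ∀ v, f =ᵐ[volume] v → ContDiff ℝ 1 v → Eaux V p v ≤ EauxInf V p := by
  obtain ⟨φ, f, d, h, hd0, hd⟩ := exists_minimizingSeq hV hp
  have := ENNReal.toReal_nonneg (a := EauxInf V p)
  exact ⟨f, 2 * (EauxInf V p).toReal - d, by linarith, by linarith, h.mollifiedGP hV hp,
    fun v => h.Eaux_le hV hp⟩

lemma EauxInf_le_Eaux_of_le {V : R2 → ℝ} {p P : ℝ} (h : p ≤ P) {g : R2 → ℝ} (hg : adm2 g) :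
    EauxInf V p ≤ Eaux V P g :=
  (EauxInf_le hg).trans (lintegral_mono fun x => ENNReal.ofReal_le_ofReal (by gcongr))

/-- For each `p ≥ 0` the auxiliary 2D GP functional has a unique (up to sign,
i.e. constant phase for real functions) minimizer `φ_p` under `∫φ² = 1`, which
can be chosen strictly positive; moreover `φ_p` and `∇φ_p` are bounded uniformly
in `x` and in `p` ranging over any finite interval `[0,P]`. -/
theorem stmt12 (Vp : R2 → ℝ) (hVp : IsTrapPotential Vp) :
    ∃ Φ : ℝ → R2 → ℝ,
      (∀ p : ℝ, 0 ≤ p →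
        adm2 (Φ p) ∧ (∀ x, 0 < Φ p x) ∧
        Eaux Vp p (Φ p) = EauxInf Vp p ∧ Eaux Vp p (Φ p) ≠ ⊤ ∧
        (∀ ψ : R2 → ℝ, adm2 ψ → Eaux Vp p ψ = EauxInf Vp p →
          ψ = Φ p ∨ ψ = fun x => -(Φ p x))) ∧
      (∀ P : ℝ, 0 < P → ∃ C : ℝ,
        ∀ p ∈ Set.Icc (0:ℝ) P, ∀ x : R2, |Φ p x| + ‖fderiv ℝ (Φ p) x‖ ≤ C) := by
  choose f μ hμ0 hμ hGP hmin using
    fun p : {p : ℝ // 0 ≤ p} => exists_mollifiedGP hVp p.2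
  have hbound := fun p : {p : ℝ // 0 ≤ p} => MollifiedGP.exists_uniform_bound hVp (p : ℝ)
    (2 * (EauxInf Vp p).toReal) p.2 (by positivity)
  choose C hC using hbound
  choose v hfv hv hpos hvC using fun p : {p : ℝ // 0 ≤ p} =>
    hC p p (μ p) (f p) p.2 le_rfl (hμ0 p) (hμ p) (hGP p)
  have hadm : ∀ p, adm2 (v p) := fun p =>
    ⟨hv p, by
      rw [← (hGP p).norm_eq]
      exact lintegral_congr_ae ((hfv p).mono fun x hx => by simp only [hx])⟩
  have hE : ∀ p : {p : ℝ // 0 ≤ p}, Eaux Vp p (v p) = EauxInf Vp p := fun p =>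
    (hmin p _ (hfv p) (hv p)).antisymm (EauxInf_le (hadm p))
  refine ⟨fun p => if hp : 0 ≤ p then v ⟨p, hp⟩ else 0, fun p hp => ?_, fun P hP => ?_⟩
  · simp only [dif_pos hp]
    have hfin := EauxInf_ne_top hVp hp
    have hEp := hE ⟨p, hp⟩
    exact ⟨hadm _, hpos _, hEp, hEp.trans_ne hfin, fun ψ hψ hψE =>
      eq_or_eq_neg_of_minimizer hVp hp (hadm _) (hpos _) hEp hfin hψ hψE⟩
  · obtain ⟨g, hg, -, hgfin⟩ := exists_trial hVp
    obtain ⟨B, hB⟩ := MollifiedGP.exists_uniform_bound hVp P (2 * (Eaux Vp P g).toReal) hP.le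
      (by positivity)
    refine ⟨B, fun p hp x => ?_⟩
    simp only [dif_pos hp.1]
    have hμP : μ ⟨p, hp.1⟩ ≤ 2 * (Eaux Vp P g).toReal := by
      refine (hμ _).trans (mul_le_mul_of_nonneg_left ?_ zero_le_two)
      exact ENNReal.toReal_mono (hgfin P hP.le) (EauxInf_le_Eaux_of_le hp.2 hg)
    obtain ⟨w, hfw, hw, -, hwB⟩ := hB p _ _ hp.1 hp.2 (hμ0 _) hμP (hGP ⟨p, hp.1⟩)
    have hvw : v ⟨p, hp.1⟩ = w :=
      (hv _).continuous.ae_eq_iff_eq volume hw.continuous |>.1 ((hfv _).symm.trans hfw)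
    rw [hvw]
    exact hwB x
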